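/- Approximation Theorem: for every typed term M of the recursively typed λ-calculus with parallel case and every environment ε, the denotational semantics of M equals the union of the semantics of its normal form approximations: ⟦M⟧ε = ⋃_{A ∈ 𝒜(M)} ⟦A⟧ε. Equivalently, ⟦M⟧ε = ⋃ { ⟦A⟧ε | A a normal form and ∃N. M →* N and A ≼ N }. -/

import Mathlib

set_option autoImplicit false

namespace RecLam

/-- Type expressions: type variables, separated sum, product, function space,
recursion `μt.τ`, and `void`. -/
inductive TyExpr : Type where
  | tvar : ℕ → TyExpr
  | sum : TyExpr → TyExpr → TyExpr
  | prod : TyExpr → TyExpr → TyExpr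
  | arrow : TyExpr → TyExpr → TyExpr
  | mu : ℕ → TyExpr → TyExpr
  | void : TyExpr
  deriving DecidableEq

namespace TyExpr

/-- Free type variables of a type expression. -/
def freeTV : TyExpr → Finset ℕ
  | .tvar t => {t}
  | .sum a b => freeTV a ∪ freeTV b
  | .prod a b => freeTV a ∪ freeTV b
  | .arrow a b => freeTV a ∪ freeTV b
  | .mu t a => (freeTV a).erase t
  | .void => ∅

/-- A type expression is closed (a *type*) iff it has no free type variables. -/
def Closed (τ : TyExpr) : Prop := freeTV τ = ∅

/-- `substTy σ t ρ` is `σ[ρ/t]`, substitution of `ρ` for the free occurrences of `t`. -/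
def substTy : TyExpr → ℕ → TyExpr → TyExpr
  | .tvar s, t, ρ => if s = t then ρ else .tvar s
  | .sum a b, t, ρ => .sum (substTy a t ρ) (substTy b t ρ)
  | .prod a b, t, ρ => .prod (substTy a t ρ) (substTy b t ρ)
  | .arrow a b, t, ρ => .arrow (substTy a t ρ) (substTy b t ρ)
  | .mu s a, t, ρ => if s = t then .mu s a else .mu s (substTy a t ρ)
  | .void, _, _ => .void

end TyExpr

/-- One-step unfolding `↝` of an outermost `μ`-redex. -/
inductive Unfold : TyExpr → TyExpr → Prop
  | mu (t : ℕ) (a : TyExpr) : Unfold (.mu t a) (TyExpr.substTy a t (.mu t a))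
  | sumL {a a' : TyExpr} (b : TyExpr) : Unfold a a' → Unfold (.sum a b) (.sum a' b)
  | sumR (a : TyExpr) {b b' : TyExpr} : Unfold b b' → Unfold (.sum a b) (.sum a b')
  | prodL {a a' : TyExpr} (b : TyExpr) : Unfold a a' → Unfold (.prod a b) (.prod a' b)
  | prodR (a : TyExpr) {b b' : TyExpr} : Unfold b b' → Unfold (.prod a b) (.prod a b')
  | arrowL {a a' : TyExpr} (b : TyExpr) : Unfold a a' → Unfold (.arrow a b) (.arrow a' b)
  | arrowR (a : TyExpr) {b b' : TyExpr} : Unfold b b' → Unfold (.arrow a b) (.arrow a b')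

/-- `↝*`, the reflexive transitive closure of one-step unfolding. -/
def Unfolds : TyExpr → TyExpr → Prop := Relation.ReflTransGen Unfold

/-- The `void`-prefix order `σ ≼ τ`: the least relation with `void ≼ τ` for all `τ`
and compatible with the constructors `+`, `×`, `→`.  Its left-hand sides are
exactly the simple types. -/
inductive Pre : TyExpr → TyExpr → Prop
  | void (τ : TyExpr) : Pre .void τ
  | sum {s s' t t' : TyExpr} : Pre s s' → Pre t t' → Pre (.sum s t) (.sum s' t')
  | prod {s s' t t' : TyExpr} : Pre s s' → Pre t t' → Pre (.prod s t) (.prod s' t')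
  | arrow {s s' t t' : TyExpr} : Pre s s' → Pre t t' → Pre (.arrow s t) (.arrow s' t')

/-- The unfolding `τ* = { σ ∈ T ∣ ∃ τ'. τ ↝* τ' ∧ σ ≼ τ' }` of a type `τ`. -/
def unfolding (τ : TyExpr) : Set TyExpr := {σ | ∃ τ', Unfolds τ τ' ∧ Pre σ τ'}

/-- Two types are equivalent iff they have the same unfolding as (regular) trees. -/
def TyEquiv (σ τ : TyExpr) : Prop := unfolding σ = unfolding τ

end RecLam

namespace RecLam

/-- The constants of the calculus, with their type subscripts. -/
inductive Const : Type where
  | czero : TyExpr → TyExpr → Const      -- 0_{σ,τ} : σ → (σ+τ)   ("inleft")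
  | cone : TyExpr → TyExpr → Const       -- 1_{σ,τ} : τ → (σ+τ)   ("inright")
  | ccase : TyExpr → TyExpr → TyExpr → Const   -- case_{σ,τ,ρ}
  | cpcase : TyExpr → TyExpr → TyExpr → Const  -- pcase_{σ,τ,ρ}
  | cpair : TyExpr → TyExpr → Const      -- pair_{σ,τ}
  | cfst : TyExpr → TyExpr → Const       -- fst_{σ,τ}
  | csnd : TyExpr → TyExpr → Const       -- snd_{σ,τ}
  | comega : TyExpr → Const              -- Ω_σ
  deriving DecidableEq

/-- The type of each constant. -/
def constType : Const → TyExpr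
  | .czero σ τ => .arrow σ (.sum σ τ)
  | .cone σ τ => .arrow τ (.sum σ τ)
  | .ccase σ τ ρ => .arrow (.sum σ τ) (.arrow (.arrow σ ρ) (.arrow (.arrow τ ρ) ρ))
  | .cpcase σ τ ρ => .arrow (.sum σ τ) (.arrow ρ (.arrow ρ ρ))
  | .cpair σ τ => .arrow σ (.arrow τ (.prod σ τ))
  | .cfst σ τ => .arrow (.prod σ τ) σ
  | .csnd σ τ => .arrow (.prod σ τ) τ
  | .comega σ => σ

/-- Terms, in de Bruijn representation (so terms are identified up to α-conversion):
variables, constants, application and λ-abstraction (the binder carries the type of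
the abstracted variable). -/
inductive Tm : Type where
  | var : ℕ → Tm
  | const : Const → Tm
  | app : Tm → Tm → Tm
  | lam : TyExpr → Tm → Tm
  deriving DecidableEq

/-- Lift (shift) the de Bruijn variables `≥ d` by one. -/
def liftTm (d : ℕ) : Tm → Tm
  | .var n => if n < d then .var n else .var (n + 1)
  | .const c => .const c
  | .app M N => .app (liftTm d M) (liftTm d N)
  | .lam σ M => .lam σ (liftTm (d + 1) M)

/-- Capture-avoiding substitution `M[k := N]` (de Bruijn). -/
def substTm : Tm → ℕ → Tm → Tm
  | .var n, k, N => if n = k then N else if k < n then .var (n - 1) else .var n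
  | .const c, _, _ => .const c
  | .app M P, k, N => .app (substTm M k N) (substTm P k N)
  | .lam σ M, k, N => .lam σ (substTm M (k + 1) (liftTm 0 N))

/-- The typing relation.  A context is a list of types of the free de Bruijn
variables.  It includes the rule (≈): a term of a type `σ` also has every type
equivalent to `σ`. -/
inductive HasType : List TyExpr → Tm → TyExpr → Prop
  | var {Γ : List TyExpr} {n : ℕ} {σ : TyExpr} :
      Γ[n]? = some σ → HasType Γ (.var n) σ
  | const {Γ : List TyExpr} (c : Const) : HasType Γ (.const c) (constType c)
  | app {Γ : List TyExpr} {M N : Tm} {σ τ : TyExpr} :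
      HasType Γ M (.arrow σ τ) → HasType Γ N σ → HasType Γ (.app M N) τ
  | lam {Γ : List TyExpr} {M : Tm} {σ τ : TyExpr} :
      HasType (σ :: Γ) M τ → HasType Γ (.lam σ M) (.arrow σ τ)
  | equiv {Γ : List TyExpr} {M : Tm} {σ τ : TyExpr} :
      HasType Γ M σ → TyEquiv σ τ → HasType Γ M τ

/-- One-step reduction: β-reduction, the ten rewrite rules for the constants,
closed under arbitrary contexts. -/
inductive Step : Tm → Tm → Prop
  | beta (σ : TyExpr) (M N : Tm) :
      Step (.app (.lam σ M) N) (substTm M 0 N)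
  | caseZero (σ τ ρ σ' τ' : TyExpr) (x y z : Tm) :
      Step (.app (.app (.app (.const (.ccase σ τ ρ)) (.app (.const (.czero σ' τ')) x)) y) z)
        (.app y x)
  | caseOne (σ τ ρ σ' τ' : TyExpr) (x y z : Tm) :
      Step (.app (.app (.app (.const (.ccase σ τ ρ)) (.app (.const (.cone σ' τ')) x)) y) z)
        (.app z x)
  | fstPair (σ τ σ' τ' : TyExpr) (x y : Tm) :
      Step (.app (.const (.cfst σ τ)) (.app (.app (.const (.cpair σ' τ')) x) y)) x
  | sndPair (σ τ σ' τ' : TyExpr) (x y : Tm) :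
      Step (.app (.const (.csnd σ τ)) (.app (.app (.const (.cpair σ' τ')) x) y)) y
  | pcaseZero (σ τ ρ σ' τ' : TyExpr) (x y z : Tm) :
      Step (.app (.app (.app (.const (.cpcase σ τ ρ)) (.app (.const (.czero σ' τ')) x)) y) z) y
  | pcaseOne (σ τ ρ σ' τ' : TyExpr) (x y z : Tm) :
      Step (.app (.app (.app (.const (.cpcase σ τ ρ)) (.app (.const (.cone σ' τ')) x)) y) z) z
  | pcaseZZ (σ τ ρ₀ ρ₁ σ₁ τ₁ σ₂ τ₂ : TyExpr) (x y z : Tm) :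
      Step (.app (.app (.app (.const (.cpcase σ τ (.sum ρ₀ ρ₁))) x)
              (.app (.const (.czero σ₁ τ₁)) y)) (.app (.const (.czero σ₂ τ₂)) z))
        (.app (.const (.czero ρ₀ ρ₁)) (.app (.app (.app (.const (.cpcase σ τ ρ₀)) x) y) z))
  | pcaseOO (σ τ ρ₀ ρ₁ σ₁ τ₁ σ₂ τ₂ : TyExpr) (x y z : Tm) :
      Step (.app (.app (.app (.const (.cpcase σ τ (.sum ρ₀ ρ₁))) x)
              (.app (.const (.cone σ₁ τ₁)) y)) (.app (.const (.cone σ₂ τ₂)) z))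
        (.app (.const (.cone ρ₀ ρ₁)) (.app (.app (.app (.const (.cpcase σ τ ρ₁)) x) y) z))
  | pcasePair (σ τ ρ₁ ρ₂ σ₁ τ₁ σ₂ τ₂ : TyExpr) (x y₁ y₂ z₁ z₂ : Tm) :
      Step (.app (.app (.app (.const (.cpcase σ τ (.prod ρ₁ ρ₂))) x)
              (.app (.app (.const (.cpair σ₁ τ₁)) y₁) y₂))
              (.app (.app (.const (.cpair σ₂ τ₂)) z₁) z₂))
        (.app (.app (.const (.cpair ρ₁ ρ₂))
            (.app (.app (.app (.const (.cpcase σ τ ρ₁)) x) y₁) z₁))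
          (.app (.app (.app (.const (.cpcase σ τ ρ₂)) x) y₂) z₂))
  | pcaseArrow (σ τ ρ₁ ρ₂ : TyExpr) (x y z w : Tm) :
      Step (.app (.app (.app (.app (.const (.cpcase σ τ (.arrow ρ₁ ρ₂))) x) y) z) w)
        (.app (.app (.app (.const (.cpcase σ τ ρ₂)) x) (.app y w)) (.app z w))
  | appL {M M' : Tm} (N : Tm) : Step M M' → Step (.app M N) (.app M' N)
  | appR (M : Tm) {N N' : Tm} : Step N N' → Step (.app M N) (.app M N')
  | lamC (σ : TyExpr) {M M' : Tm} : Step M M' → Step (.lam σ M) (.lam σ M')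

/-- `→*`, the reflexive transitive closure of one-step reduction. -/
def Steps : Tm → Tm → Prop := Relation.ReflTransGen Step

end RecLam

namespace RecLam

/-- The universe of primes for the prime-system interpretation of types:
`stag b` is the atom `b ∈ {0,1}` of a separated sum, `spr b a` is the pair `(b,a)`
of a separated sum, `ppr b a` is the pair `(b,a)` of a product, and `fn X a`
is the prime `(X, a)` of a function space (the finite set `X` is represented
as a list). -/
inductive Pm : Type where
  | stag : Bool → Pm
  | spr : Bool → Pm → Pm
  | ppr : Bool → Pm → Pm
  | fn : List Pm → Pm → Pm

/-- The data of a prime system on the universe `Pm`. -/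
structure PData where
  carrier : Set Pm
  con : Pm → Pm → Prop
  le : Pm → Pm → Prop

/-- The elements of a prime system: downward closed, pairwise consistent subsets
of the prime set. -/
def PData.IsElem (A : PData) (d : Set Pm) : Prop :=
  d ⊆ A.carrier ∧ (∀ a b : Pm, A.le a b → b ∈ d → a ∈ d) ∧ ∀ a ∈ d, ∀ b ∈ d, A.con a b

/-- The prime system of the type `void`: no primes. -/
def voidP : PData := ⟨∅, fun _ _ => False, fun _ _ => False⟩

/-- One side `{b} ∪ ({b} × A)` of a separated sum. -/
def sumSideP (A : PData) (b : Bool) : Set Pm :=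
  {p | p = .stag b ∨ ∃ a ∈ A.carrier, p = .spr b a}

/-- The separated sum of prime systems. -/
def sumP (A B : PData) : PData where
  carrier := sumSideP A false ∪ sumSideP B true
  con x y :=
    (x ∈ sumSideP A false ∧ y ∈ sumSideP A false ∧
      ∀ a b, x = .spr false a → y = .spr false b → A.con a b) ∨
    (x ∈ sumSideP B true ∧ y ∈ sumSideP B true ∧
      ∀ a b, x = .spr true a → y = .spr true b → B.con a b)
  le x y :=
    (x = .stag false ∧ y ∈ sumSideP A false) ∨
    (x = .stag true ∧ y ∈ sumSideP B true) ∨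
    (∃ a b, x = .spr false a ∧ y = .spr false b ∧ A.le a b) ∨
    (∃ a b, x = .spr true a ∧ y = .spr true b ∧ B.le a b)

/-- The cartesian product of prime systems. -/
def prodP (A B : PData) : PData where
  carrier := {p | (∃ a ∈ A.carrier, p = .ppr false a) ∨ ∃ b ∈ B.carrier, p = .ppr true b}
  con x y :=
    (∃ a b, x = .ppr false a ∧ y = .ppr false b ∧ A.con a b) ∨
    (∃ a b, x = .ppr true a ∧ y = .ppr true b ∧ B.con a b) ∨
    (∃ a b, x = .ppr false a ∧ y = .ppr true b ∧ a ∈ A.carrier ∧ b ∈ B.carrier) ∨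
    (∃ a b, x = .ppr true a ∧ y = .ppr false b ∧ a ∈ B.carrier ∧ b ∈ A.carrier)
  le x y :=
    (∃ a b, x = .ppr false a ∧ y = .ppr false b ∧ A.le a b) ∨
    (∃ a b, x = .ppr true a ∧ y = .ppr true b ∧ B.le a b)

/-- `X ∈ Ā`: the (finite) list `X` consists of primes of `A` that are pairwise
consistent and pairwise incomparable. -/
def goodList (A : PData) (X : List Pm) : Prop :=
  (∀ x ∈ X, x ∈ A.carrier) ∧ ∀ x ∈ X, ∀ y ∈ X, A.con x y ∧ (A.le x y → x = y)

/-- The function-space prime system `A → B`. -/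
def funcP (A B : PData) : PData where
  carrier := {p | ∃ X a, p = .fn X a ∧ goodList A X ∧ a ∈ B.carrier}
  con x y := ∃ X a Y b, x = .fn X a ∧ y = .fn Y b ∧
    goodList A X ∧ a ∈ B.carrier ∧ goodList A Y ∧ b ∈ B.carrier ∧
    ((∀ u ∈ X, ∀ v ∈ Y, A.con u v) → B.con a b)
  le x y := ∃ X a Y b, x = .fn X a ∧ y = .fn Y b ∧
    goodList A X ∧ a ∈ B.carrier ∧ goodList A Y ∧ b ∈ B.carrier ∧
    (∀ v ∈ Y, ∃ u ∈ X, A.le v u) ∧ B.le a b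

/-- Interpretation of simple types as prime systems. -/
def interpSimple : TyExpr → PData
  | .void => voidP
  | .tvar _ => voidP
  | .mu _ _ => voidP
  | .sum a b => sumP (interpSimple a) (interpSimple b)
  | .prod a b => prodP (interpSimple a) (interpSimple b)
  | .arrow a b => funcP (interpSimple a) (interpSimple b)

/-- The prime-system interpretation `P(τ*)` of a type `τ`: the lub (union) of the
interpretations of the simple prefixes of the unfoldings of `τ` (this directed
union equals the lub of the chain of finite approximations of the type tree
`τ*`). -/
def tyInterp (τ : TyExpr) : PData where
  carrier := {p | ∃ σ ∈ unfolding τ, p ∈ (interpSimple σ).carrier}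
  con x y := ∃ σ ∈ unfolding τ, (interpSimple σ).con x y
  le x y := ∃ σ ∈ unfolding τ, (interpSimple σ).le x y

/-- Application `|r|(d)` of (the function associated with) a set `r` of
function-space primes to a set `d` of primes. -/
def aps (r d : Set Pm) : Set Pm :=
  {b | ∃ X : List Pm, (∀ x ∈ X, x ∈ d) ∧ Pm.fn X b ∈ r}

/-- The downward closure `↓X` of a finite set (list) of primes in `A`. -/
def downListP (A : PData) (X : List Pm) : Set Pm := {a | ∃ x ∈ X, A.le a x}

/-- `Pr(f) = {(X, a) ∣ X ∈ Ā ∧ a ∈ f(↓X)}`, the element of a function-space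
prime system associated with a function `f` (on sets of primes of `A`). -/
def PrOf (A : PData) (f : Set Pm → Set Pm) : Set Pm :=
  {p | ∃ X a, p = Pm.fn X a ∧ goodList A X ∧ a ∈ f (downListP A X)}

/-- Semantic injection `0`: `d ↦ {0} ∪ ({0} × d)`. -/
def inj0 (d : Set Pm) : Set Pm := {p | p = .stag false ∨ ∃ a ∈ d, p = .spr false a}

/-- Semantic injection `1`: `d ↦ {1} ∪ ({1} × d)`. -/
def inj1 (d : Set Pm) : Set Pm := {p | p = .stag true ∨ ∃ a ∈ d, p = .spr true a}

/-- Semantic pairing: `(d, e) ↦ ({0} × d) ∪ ({1} × e)`. -/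
def pairS (d e : Set Pm) : Set Pm :=
  {p | (∃ a ∈ d, p = .ppr false a) ∨ ∃ b ∈ e, p = .ppr true b}

/-- First projection. -/
def fstS (d : Set Pm) : Set Pm := {a | Pm.ppr false a ∈ d}

/-- Second projection. -/
def sndS (d : Set Pm) : Set Pm := {a | Pm.ppr true a ∈ d}

/-- The component `e` of a sum element `0e` (resp. `1e`). -/
def prj0 (d : Set Pm) : Set Pm := {a | Pm.spr false a ∈ d}
def prj1 (d : Set Pm) : Set Pm := {a | Pm.spr true a ∈ d}

/-- The (strict) `case` function: `⊥` if `d = ⊥`, `|f|e` if `d = 0e`,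
`|g|e` if `d = 1e`. -/
def caseS (d f g : Set Pm) : Set Pm :=
  {b | (Pm.stag false ∈ d ∧ b ∈ aps f (prj0 d)) ∨ (Pm.stag true ∈ d ∧ b ∈ aps g (prj1 d))}

/-- The parallel `pcase` function: `b ∩ c` if `a = ⊥`, `b` if `a = 0a'`,
`c` if `a = 1a'`. -/
def pcaseS (a b c : Set Pm) : Set Pm :=
  {p | (Pm.stag false ∉ a ∧ Pm.stag true ∉ a ∧ p ∈ b ∩ c) ∨
       (Pm.stag false ∈ a ∧ p ∈ b) ∨ (Pm.stag true ∈ a ∧ p ∈ c)}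

/-- The semantics of the constants (the semantic functions are transported into
the domains by `Pr` and its curried variants). -/
def constSem : Const → Set Pm
  | .czero σ _ => PrOf (tyInterp σ) inj0
  | .cone _ τ => PrOf (tyInterp τ) inj1
  | .ccase σ τ ρ =>
      PrOf (tyInterp (.sum σ τ)) fun d =>
        PrOf (tyInterp (.arrow σ ρ)) fun f =>
          PrOf (tyInterp (.arrow τ ρ)) fun g => caseS d f g
  | .cpcase σ τ ρ =>
      PrOf (tyInterp (.sum σ τ)) fun a =>
        PrOf (tyInterp ρ) fun b =>
          PrOf (tyInterp ρ) fun c => pcaseS a b c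
  | .cpair σ τ =>
      PrOf (tyInterp σ) fun d => PrOf (tyInterp τ) fun e => pairS d e
  | .cfst σ τ => PrOf (tyInterp (.prod σ τ)) fstS
  | .csnd σ τ => PrOf (tyInterp (.prod σ τ)) sndS
  | .comega _ => ∅

/-- Environments assign a domain element (a set of primes) to every de Bruijn
variable. -/
def Env : Type := ℕ → Set Pm

/-- Extend an environment by a value for the variable `0` (de Bruijn cons). -/
def envCons (d : Set Pm) (ε : Env) : Env :=
  fun n => match n with
  | 0 => d
  | n + 1 => ε n

/-- The denotational semantics `⟦M⟧ε` of a term. -/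
def sem : Tm → Env → Set Pm
  | .var n, ε => ε n
  | .const c, _ => constSem c
  | .app M N, ε => aps (sem M ε) (sem N ε)
  | .lam σ M, ε => PrOf (tyInterp σ) fun d => sem M (envCons d ε)

/-- An environment is typed by a context `Γ` iff it maps each variable to an
element of the domain of its type. -/
def GoodEnv (Γ : List TyExpr) (ε : Env) : Prop :=
  ∀ (n : ℕ) (σ : TyExpr), Γ[n]? = some σ → (tyInterp σ).IsElem (ε n)

/-- The environment assigning `⊥ = ∅` to every variable. -/
def botEnv : Env := fun _ => ∅

end RecLam

namespace RecLam

/-- The Ω-prefix order `≼` on terms: the least compatible relation with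
`Ω ≼ M` for all `M`. -/
inductive TmPre : Tm → Tm → Prop
  | omega (σ : TyExpr) (M : Tm) : TmPre (.const (.comega σ)) M
  | var (n : ℕ) : TmPre (.var n) (.var n)
  | const (c : Const) : TmPre (.const c) (.const c)
  | app {M M' N N' : Tm} : TmPre M M' → TmPre N N' → TmPre (.app M N) (.app M' N')
  | lam (σ : TyExpr) {M M' : Tm} : TmPre M M' → TmPre (.lam σ M) (.lam σ M')

/-- A normal form: a term with no redex. -/
def Normal (M : Tm) : Prop := ∀ N, ¬ Step M N

/-- `A` is a direct approximation of `M` (`A ≪ M`): `A` is a normal form and a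
prefix of every reduct of `M`. -/
def DirApprox (A M : Tm) : Prop := Normal A ∧ ∀ N, Steps M N → TmPre A N

/-- The set `𝒜(M)` of approximations of `M`: normal forms that directly
approximate some reduct of `M`. -/
def approxSet (M : Tm) : Set Tm := {A | ∃ N, Steps M N ∧ DirApprox A N}

end RecLam


set_option autoImplicit false
set_option linter.all false

namespace RecLam

/-! ### Part A: type unfoldings and prime systems -/

theorem unfold_diamond {a b c : TyExpr} (h1 : Unfold a b) (h2 : Unfold a c) :
    b = c ∨ ∃ d, Unfold b d ∧ Unfold c d := by
  induction h1 generalizing c with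
  | mu t a => cases h2; exact Or.inl rfl
  | sumL b h ih =>
    cases h2 with
    | sumL _ h' =>
      rcases ih h' with rfl | ⟨d, h1, h2⟩
      · exact Or.inl rfl
      · exact Or.inr ⟨_, .sumL _ h1, .sumL _ h2⟩
    | sumR _ h' => exact Or.inr ⟨_, .sumR _ h', .sumL _ h⟩
  | sumR a h ih =>
    cases h2 with
    | sumR _ h' =>
      rcases ih h' with rfl | ⟨d, h1, h2⟩
      · exact Or.inl rfl
      · exact Or.inr ⟨_, .sumR _ h1, .sumR _ h2⟩
    | sumL _ h' => exact Or.inr ⟨_, .sumL _ h', .sumR _ h⟩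
  | prodL b h ih =>
    cases h2 with
    | prodL _ h' =>
      rcases ih h' with rfl | ⟨d, h1, h2⟩
      · exact Or.inl rfl
      · exact Or.inr ⟨_, .prodL _ h1, .prodL _ h2⟩
    | prodR _ h' => exact Or.inr ⟨_, .prodR _ h', .prodL _ h⟩
  | prodR a h ih =>
    cases h2 with
    | prodR _ h' =>
      rcases ih h' with rfl | ⟨d, h1, h2⟩
      · exact Or.inl rfl
      · exact Or.inr ⟨_, .prodR _ h1, .prodR _ h2⟩
    | prodL _ h' => exact Or.inr ⟨_, .prodL _ h', .prodR _ h⟩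
  | arrowL b h ih =>
    cases h2 with
    | arrowL _ h' =>
      rcases ih h' with rfl | ⟨d, h1, h2⟩
      · exact Or.inl rfl
      · exact Or.inr ⟨_, .arrowL _ h1, .arrowL _ h2⟩
    | arrowR _ h' => exact Or.inr ⟨_, .arrowR _ h', .arrowL _ h⟩
  | arrowR a h ih =>
    cases h2 with
    | arrowR _ h' =>
      rcases ih h' with rfl | ⟨d, h1, h2⟩
      · exact Or.inl rfl
      · exact Or.inr ⟨_, .arrowR _ h1, .arrowR _ h2⟩
    | arrowL _ h' => exact Or.inr ⟨_, .arrowL _ h', .arrowR _ h⟩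

theorem unfolds_confl {a b c : TyExpr} (h1 : Unfolds a b) (h2 : Unfolds a c) :
    ∃ d, Unfolds b d ∧ Unfolds c d := by
  refine Relation.church_rosser (r := Unfold) ?_ h1 h2
  intro a b c h1 h2
  rcases unfold_diamond h1 h2 with rfl | ⟨d, h1, h2⟩
  · exact ⟨_, .refl, .refl⟩
  · exact ⟨d, .single h1, .single h2⟩

theorem Pre.unfold {s t t' : TyExpr} (h : Pre s t) (hu : Unfold t t') : Pre s t' := by
  induction h generalizing t' with
  | void => exact .void _
  | sum h1 h2 ih1 ih2 =>
    cases hu with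
    | sumL _ h => exact .sum (ih1 h) h2
    | sumR _ h => exact .sum h1 (ih2 h)
  | prod h1 h2 ih1 ih2 =>
    cases hu with
    | prodL _ h => exact .prod (ih1 h) h2
    | prodR _ h => exact .prod h1 (ih2 h)
  | arrow h1 h2 ih1 ih2 =>
    cases hu with
    | arrowL _ h => exact .arrow (ih1 h) h2
    | arrowR _ h => exact .arrow h1 (ih2 h)

theorem Pre.unfolds {s t t' : TyExpr} (h : Pre s t) (hu : Unfolds t t') : Pre s t' := by
  induction hu with
  | refl => exact h
  | tail _ h2 ih => exact ih.unfold h2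

theorem Pre.join {s1 s2 t : TyExpr} (h1 : Pre s1 t) (h2 : Pre s2 t) :
    ∃ s, Pre s t ∧ Pre s1 s ∧ Pre s2 s := by
  have selfPre : ∀ {s t : TyExpr}, Pre s t → Pre s s := by
    intro s t h
    induction h with
    | void => exact .void _
    | sum _ _ ih1 ih2 => exact .sum ih1 ih2
    | prod _ _ ih1 ih2 => exact .prod ih1 ih2
    | arrow _ _ ih1 ih2 => exact .arrow ih1 ih2
  induction h1 generalizing s2 with
  | void => exact ⟨s2, h2, .void _, selfPre h2⟩
  | sum ha hb ih1 ih2 =>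
    cases h2 with
    | void => exact ⟨_, .sum ha hb, selfPre (.sum ha hb), .void _⟩
    | sum hc hd =>
      obtain ⟨u, u1, u2, u3⟩ := ih1 hc
      obtain ⟨v, v1, v2, v3⟩ := ih2 hd
      exact ⟨_, .sum u1 v1, .sum u2 v2, .sum u3 v3⟩
  | prod ha hb ih1 ih2 =>
    cases h2 with
    | void => exact ⟨_, .prod ha hb, selfPre (.prod ha hb), .void _⟩
    | prod hc hd =>
      obtain ⟨u, u1, u2, u3⟩ := ih1 hc
      obtain ⟨v, v1, v2, v3⟩ := ih2 hd
      exact ⟨_, .prod u1 v1, .prod u2 v2, .prod u3 v3⟩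
  | arrow ha hb ih1 ih2 =>
    cases h2 with
    | void => exact ⟨_, .arrow ha hb, selfPre (.arrow ha hb), .void _⟩
    | arrow hc hd =>
      obtain ⟨u, u1, u2, u3⟩ := ih1 hc
      obtain ⟨v, v1, v2, v3⟩ := ih2 hd
      exact ⟨_, .arrow u1 v1, .arrow u2 v2, .arrow u3 v3⟩

theorem unfolding_directed {t s1 s2 : TyExpr} (h1 : s1 ∈ unfolding t) (h2 : s2 ∈ unfolding t) :
    ∃ s ∈ unfolding t, Pre s1 s ∧ Pre s2 s := by
  obtain ⟨t1, u1, p1⟩ := h1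
  obtain ⟨t2, u2, p2⟩ := h2
  obtain ⟨t3, v1, v2⟩ := unfolds_confl u1 u2
  obtain ⟨s, a, b, c⟩ := (p1.unfolds v1).join (p2.unfolds v2)
  exact ⟨s, ⟨t3, u1.trans v1, a⟩, b, c⟩

theorem void_mem_unfolding (t : TyExpr) : TyExpr.void ∈ unfolding t := ⟨t, .refl, .void _⟩

theorem unfolding_sum (a b : TyExpr) : unfolding (.sum a b) =
    {s | s = .void ∨ ∃ u ∈ unfolding a, ∃ v ∈ unfolding b, s = .sum u v} := by
  ext s
  constructor
  · rintro ⟨t, hu, hp⟩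
    have : ∃ a' b', t = .sum a' b' ∧ Unfolds a a' ∧ Unfolds b b' := by
      clear hp
      induction hu with
      | refl => exact ⟨a, b, rfl, .refl, .refl⟩
      | tail _ h2 ih =>
        obtain ⟨a', b', rfl, ha, hb⟩ := ih
        cases h2 with
        | sumL _ h => exact ⟨_, _, rfl, ha.tail h, hb⟩
        | sumR _ h => exact ⟨_, _, rfl, ha, hb.tail h⟩
    obtain ⟨a', b', rfl, ha, hb⟩ := this
    cases hp with
    | void => exact Or.inl rfl
    | sum h1 h2 => exact Or.inr ⟨_, ⟨_, ha, h1⟩, _, ⟨_, hb, h2⟩, rfl⟩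
  · rintro (rfl | ⟨u, ⟨a', ha, pa⟩, v, ⟨b', hb, pb⟩, rfl⟩)
    · exact void_mem_unfolding _
    · refine ⟨.sum a' b', ?_, .sum pa pb⟩
      exact (ha.lift (fun x => TyExpr.sum x b) (fun _ _ h => .sumL _ h)).trans
        (hb.lift (fun x => TyExpr.sum a' x) (fun _ _ h => .sumR _ h))

theorem unfolding_prod (a b : TyExpr) : unfolding (.prod a b) =
    {s | s = .void ∨ ∃ u ∈ unfolding a, ∃ v ∈ unfolding b, s = .prod u v} := by
  ext s
  constructor
  · rintro ⟨t, hu, hp⟩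
    have : ∃ a' b', t = .prod a' b' ∧ Unfolds a a' ∧ Unfolds b b' := by
      clear hp
      induction hu with
      | refl => exact ⟨a, b, rfl, .refl, .refl⟩
      | tail _ h2 ih =>
        obtain ⟨a', b', rfl, ha, hb⟩ := ih
        cases h2 with
        | prodL _ h => exact ⟨_, _, rfl, ha.tail h, hb⟩
        | prodR _ h => exact ⟨_, _, rfl, ha, hb.tail h⟩
    obtain ⟨a', b', rfl, ha, hb⟩ := this
    cases hp with
    | void => exact Or.inl rfl
    | prod h1 h2 => exact Or.inr ⟨_, ⟨_, ha, h1⟩, _, ⟨_, hb, h2⟩, rfl⟩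
  · rintro (rfl | ⟨u, ⟨a', ha, pa⟩, v, ⟨b', hb, pb⟩, rfl⟩)
    · exact void_mem_unfolding _
    · refine ⟨.prod a' b', ?_, .prod pa pb⟩
      exact (ha.lift (fun x => TyExpr.prod x b) (fun _ _ h => .prodL _ h)).trans
        (hb.lift (fun x => TyExpr.prod a' x) (fun _ _ h => .prodR _ h))

theorem unfolding_arrow (a b : TyExpr) : unfolding (.arrow a b) =
    {s | s = .void ∨ ∃ u ∈ unfolding a, ∃ v ∈ unfolding b, s = .arrow u v} := by
  ext s
  constructor
  · rintro ⟨t, hu, hp⟩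
    have : ∃ a' b', t = .arrow a' b' ∧ Unfolds a a' ∧ Unfolds b b' := by
      clear hp
      induction hu with
      | refl => exact ⟨a, b, rfl, .refl, .refl⟩
      | tail _ h2 ih =>
        obtain ⟨a', b', rfl, ha, hb⟩ := ih
        cases h2 with
        | arrowL _ h => exact ⟨_, _, rfl, ha.tail h, hb⟩
        | arrowR _ h => exact ⟨_, _, rfl, ha, hb.tail h⟩
    obtain ⟨a', b', rfl, ha, hb⟩ := this
    cases hp with
    | void => exact Or.inl rfl
    | arrow h1 h2 => exact Or.inr ⟨_, ⟨_, ha, h1⟩, _, ⟨_, hb, h2⟩, rfl⟩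
  · rintro (rfl | ⟨u, ⟨a', ha, pa⟩, v, ⟨b', hb, pb⟩, rfl⟩)
    · exact void_mem_unfolding _
    · refine ⟨.arrow a' b', ?_, .arrow pa pb⟩
      exact (ha.lift (fun x => TyExpr.arrow x b) (fun _ _ h => .arrowL _ h)).trans
        (hb.lift (fun x => TyExpr.arrow a' x) (fun _ _ h => .arrowR _ h))

theorem TyEquiv.rfl' {a : TyExpr} : TyEquiv a a := Eq.refl _
theorem TyEquiv.symm' {a b : TyExpr} (h : TyEquiv a b) : TyEquiv b a := Eq.symm h
theorem TyEquiv.trans' {a b c : TyExpr} (h : TyEquiv a b) (h2 : TyEquiv b c) : TyEquiv a c :=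
  Eq.trans h h2

theorem TyEquiv.sum' {a b c d : TyExpr} (h1 : TyEquiv a b) (h2 : TyEquiv c d) :
    TyEquiv (.sum a c) (.sum b d) := by
  unfold TyEquiv at *; rw [unfolding_sum, unfolding_sum, h1, h2]
theorem TyEquiv.prod' {a b c d : TyExpr} (h1 : TyEquiv a b) (h2 : TyEquiv c d) :
    TyEquiv (.prod a c) (.prod b d) := by
  unfold TyEquiv at *; rw [unfolding_prod, unfolding_prod, h1, h2]
theorem TyEquiv.arrow' {a b c d : TyExpr} (h1 : TyEquiv a b) (h2 : TyEquiv c d) :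
    TyEquiv (.arrow a c) (.arrow b d) := by
  unfold TyEquiv at *; rw [unfolding_arrow, unfolding_arrow, h1, h2]

theorem TyEquiv.sum_inv {a b c d : TyExpr} (h : TyEquiv (.sum a c) (.sum b d)) :
    TyEquiv a b ∧ TyEquiv c d := by
  have key : ∀ s t, (s ∈ unfolding a ∧ t ∈ unfolding c) ↔ (s ∈ unfolding b ∧ t ∈ unfolding d) := by
    intro s t
    have := Set.ext_iff.1 h (.sum s t)
    simpa [unfolding_sum] using this
  constructor
  · ext s; simpa [void_mem_unfolding] using key s .void
  · ext s; simpa [void_mem_unfolding] using key .void s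
theorem TyEquiv.prod_inv {a b c d : TyExpr} (h : TyEquiv (.prod a c) (.prod b d)) :
    TyEquiv a b ∧ TyEquiv c d := by
  have key : ∀ s t, (s ∈ unfolding a ∧ t ∈ unfolding c) ↔ (s ∈ unfolding b ∧ t ∈ unfolding d) := by
    intro s t
    have := Set.ext_iff.1 h (.prod s t)
    simpa [unfolding_prod] using this
  constructor
  · ext s; simpa [void_mem_unfolding] using key s .void
  · ext s; simpa [void_mem_unfolding] using key .void s
theorem TyEquiv.arrow_inv {a b c d : TyExpr} (h : TyEquiv (.arrow a c) (.arrow b d)) :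
    TyEquiv a b ∧ TyEquiv c d := by
  have key : ∀ s t, (s ∈ unfolding a ∧ t ∈ unfolding c) ↔ (s ∈ unfolding b ∧ t ∈ unfolding d) := by
    intro s t
    have := Set.ext_iff.1 h (.arrow s t)
    simpa [unfolding_arrow] using this
  constructor
  · ext s; simpa [void_mem_unfolding] using key s .void
  · ext s; simpa [void_mem_unfolding] using key .void s

theorem TyEquiv.interp {a b : TyExpr} (h : TyEquiv a b) : tyInterp a = tyInterp b := by
  unfold TyEquiv at h; unfold tyInterp; rw [h]

/-- Induction principle for primes. -/
theorem Pm.ind {P : Pm → Prop} (h1 : ∀ b, P (.stag b)) (h2 : ∀ b a, P a → P (.spr b a))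
    (h3 : ∀ b a, P a → P (.ppr b a))
    (h4 : ∀ X a, (∀ x ∈ X, P x) → P a → P (.fn X a)) : ∀ p, P p
  | .stag b => h1 b
  | .spr b a => h2 b a (Pm.ind h1 h2 h3 h4 a)
  | .ppr b a => h3 b a (Pm.ind h1 h2 h3 h4 a)
  | .fn X a => h4 X a (fun x _ => Pm.ind h1 h2 h3 h4 x) (Pm.ind h1 h2 h3 h4 a)

/-- Type-independent order on primes. -/
def pmLe : Pm → Pm → Prop
  | .stag b, .stag c => b = c
  | .stag b, .spr c _ => b = c
  | .spr b x, .spr c y => b = c ∧ pmLe x y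
  | .ppr b x, .ppr c y => b = c ∧ pmLe x y
  | .fn X a, .fn Y b => (∀ v, ∀ _ : v ∈ Y, ∃ u, ∃ _ : u ∈ X, pmLe v u) ∧ pmLe a b
  | _, _ => False
termination_by x y => sizeOf x + sizeOf y
decreasing_by
  all_goals simp_wf
  all_goals try have := List.sizeOf_lt_of_mem ‹_ ∈ X›
  all_goals try have := List.sizeOf_lt_of_mem ‹_ ∈ Y›
  all_goals omega

/-- Type-independent consistency on primes. -/
def pmCon : Pm → Pm → Prop
  | .stag b, .stag c => b = c
  | .stag b, .spr c _ => b = c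
  | .spr b _, .stag c => b = c
  | .spr b x, .spr c y => b = c ∧ pmCon x y
  | .ppr b x, .ppr c y => b = c → pmCon x y
  | .fn X a, .fn Y b => (∀ u, ∀ _ : u ∈ X, ∀ v, ∀ _ : v ∈ Y, pmCon u v) → pmCon a b
  | _, _ => False
termination_by x y => sizeOf x + sizeOf y
decreasing_by
  all_goals simp_wf
  all_goals try have := List.sizeOf_lt_of_mem ‹_ ∈ X›
  all_goals try have := List.sizeOf_lt_of_mem ‹_ ∈ Y›
  all_goals omega

theorem pmLe_refl (a : Pm) : pmLe a a := by
  induction a using Pm.ind with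
  | h1 b => simp [pmLe]
  | h2 b a ih => simpa [pmLe] using ih
  | h3 b a ih => simpa [pmLe] using ih
  | h4 X a ih1 ih2 => rw [pmLe]; exact ⟨fun v hv => ⟨v, hv, ih1 v hv⟩, ih2⟩

theorem pmLe_trans {a b c : Pm} (h1 : pmLe a b) (h2 : pmLe b c) : pmLe a c := by
  induction b using Pm.ind generalizing a c with
  | h1 b => cases a <;> cases c <;> simp_all [pmLe]
  | h2 b x ih =>
    cases a <;> cases c <;> simp_all [pmLe]
  | h3 b x ih =>
    cases a <;> cases c <;> simp_all [pmLe]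
  | h4 X x ih1 ih2 =>
    cases a <;> cases c <;> simp only [pmLe] at *
    refine ⟨fun v hv => ?_, ih2 h1.2 h2.2⟩
    obtain ⟨u, hu, h⟩ := h2.1 v hv
    obtain ⟨w, hw, h'⟩ := h1.1 u hu
    exact ⟨w, hw, ih1 u hu h h'⟩

theorem pmCon_refl (a : Pm) : pmCon a a := by
  induction a using Pm.ind with
  | h1 b => simp [pmCon]
  | h2 b a ih => simpa [pmCon] using ih
  | h3 b a ih => simpa [pmCon] using ih
  | h4 X a ih1 ih2 => rw [pmCon]; exact fun _ => ih2

theorem pmCon_comm {a b : Pm} : pmCon a b ↔ pmCon b a := by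
  induction a using Pm.ind generalizing b with
  | h1 c => cases b <;> simp [pmCon, eq_comm]
  | h2 c x ih => cases b <;> simp [pmCon, eq_comm, ih]
  | h3 c x ih => cases b <;> simp [pmCon, eq_comm, ih]
  | h4 X x ih1 ih2 =>
    cases b with
    | fn Y y =>
      simp only [pmCon]
      rw [ih2]
      refine ⟨fun h h' => h fun u hu v hv => ?_, fun h h' => h fun u hu v hv => ?_⟩
      · exact (ih1 u hu).2 (h' v hv u hu)
      · exact (ih1 v hv).1 (h' v hv u hu)
    | _ => simp [pmCon]

theorem pmCon_down {a' a b : Pm} (h : pmLe a' a) (hc : pmCon a b) : pmCon a' b := by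
  induction b using Pm.ind generalizing a a' with
  | h1 c => cases a' <;> cases a <;> simp_all [pmCon, pmLe]
  | h2 c x ih =>
    cases a' <;> cases a <;> simp_all [pmCon, pmLe]
    exact ih h.2 hc.2
  | h3 c x ih =>
    cases a' <;> cases a <;> simp_all [pmCon, pmLe]
    exact fun e => ih h.2 (hc e)
  | h4 X x ih1 ih2 =>
    cases a' <;> cases a <;> simp only [pmCon, pmLe] at *
    intro hh
    refine ih2 h.2 (hc fun u hu v hv => ?_)
    obtain ⟨w, hw, h'⟩ := h.1 u hu
    exact ih1 v hv h' (hh w hw v hv)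

/-- A prime system whose relations are the restrictions of the global ones. -/
structure Nice (A : PData) : Prop where
  le : ∀ x y, A.le x y ↔ x ∈ A.carrier ∧ y ∈ A.carrier ∧ pmLe x y
  con : ∀ x y, A.con x y ↔ x ∈ A.carrier ∧ y ∈ A.carrier ∧ pmCon x y

theorem Nice.ext' {A B : PData} (hA : Nice A) (hB : Nice B) (h : A.carrier = B.carrier) : A = B := by
  cases A with | mk c k l =>
  cases B with | mk c' k' l' =>
  have h1 : k = k' := by
    funext x y; apply propext; refine (hA.con x y).trans (Iff.trans ?_ (hB.con x y).symm); rw [h]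
  have h2 : l = l' := by
    funext x y; apply propext; refine (hA.le x y).trans (Iff.trans ?_ (hB.le x y).symm); rw [h]
  simp only at h
  rw [h, h1, h2]

/-- Untyped part of `goodList`. -/
def gl (X : List Pm) : Prop := ∀ x ∈ X, ∀ y ∈ X, pmCon x y ∧ (pmLe x y → x = y)

theorem Nice.goodList {A : PData} (hA : Nice A) (X : List Pm) :
    goodList A X ↔ (∀ x ∈ X, x ∈ A.carrier) ∧ gl X := by
  unfold RecLam.goodList gl
  constructor
  · rintro ⟨h1, h2⟩
    exact ⟨h1, fun x hx y hy => ⟨((hA.con _ _).1 (h2 x hx y hy).1).2.2,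
      fun h => (h2 x hx y hy).2 ((hA.le _ _).2 ⟨h1 x hx, h1 y hy, h⟩)⟩⟩
  · rintro ⟨h1, h2⟩
    exact ⟨h1, fun x hx y hy => ⟨(hA.con _ _).2 ⟨h1 x hx, h1 y hy, (h2 x hx y hy).1⟩,
      fun h => (h2 x hx y hy).2 ((hA.le _ _).1 h).2.2⟩⟩

theorem nice_void : Nice voidP := ⟨by simp [voidP], by simp [voidP]⟩

theorem nice_sum {A B : PData} (hA : Nice A) (hB : Nice B) : Nice (sumP A B) := by
  constructor
  · intro x y
    cases x with
    | stag b => cases y <;> cases b <;> simp [sumP, sumSideP, pmLe] <;> aesop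
    | spr b x =>
      cases y with
      | spr c y => cases b <;> cases c <;> simp [sumP, sumSideP, pmLe, hA.le, hB.le]
      | _ => simp [sumP, sumSideP, pmLe]
    | _ => simp [sumP, sumSideP, pmLe]
  · intro x y
    cases x with
    | stag b => cases y <;> cases b <;> simp [sumP, sumSideP, pmCon] <;> aesop
    | spr b x =>
      cases y with
      | spr c y =>
        cases b <;> cases c <;> simp [sumP, sumSideP, pmCon, hA.con, hB.con] <;> tauto
      | stag c => cases b <;> cases c <;> simp [sumP, sumSideP, pmCon]
      | _ => simp [sumP, sumSideP, pmCon]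
    | _ => simp [sumP, sumSideP, pmCon]

theorem nice_prod {A B : PData} (hA : Nice A) (hB : Nice B) : Nice (prodP A B) := by
  constructor
  · intro x y
    cases x with
    | ppr b x =>
      cases y with
      | ppr c y => cases b <;> cases c <;> simp [prodP, pmLe, hA.le, hB.le]
      | _ => simp [prodP, pmLe]
    | _ => simp [prodP, pmLe]
  · intro x y
    cases x with
    | ppr b x =>
      cases y with
      | ppr c y => cases b <;> cases c <;> simp [prodP, pmCon, hA.con, hB.con]
      | _ => simp [prodP, pmCon]
    | _ => simp [prodP, pmCon]

theorem nice_func {A B : PData} (hA : Nice A) (hB : Nice B) : Nice (funcP A B) := by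
  constructor
  · intro x y
    constructor
    · rintro ⟨X, a, Y, b, rfl, rfl, hX, ha, hY, hb, h, h'⟩
      refine ⟨⟨X, a, rfl, hX, ha⟩, ⟨Y, b, rfl, hY, hb⟩, ?_⟩
      rw [pmLe]
      refine ⟨fun v hv => ?_, ((hB.le _ _).1 h').2.2⟩
      obtain ⟨u, hu, h⟩ := h v hv
      exact ⟨u, hu, ((hA.le _ _).1 h).2.2⟩
    · rintro ⟨⟨X, a, rfl, hX, ha⟩, ⟨Y, b, rfl, hY, hb⟩, h⟩
      rw [pmLe] at h
      refine ⟨X, a, Y, b, rfl, rfl, hX, ha, hY, hb, fun v hv => ?_, (hB.le _ _).2 ⟨ha, hb, h.2⟩⟩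
      obtain ⟨u, hu, h⟩ := h.1 v hv
      exact ⟨u, hu, (hA.le _ _).2 ⟨hY.1 v hv, hX.1 u hu, h⟩⟩
  · intro x y
    constructor
    · rintro ⟨X, a, Y, b, rfl, rfl, hX, ha, hY, hb, h⟩
      refine ⟨⟨X, a, rfl, hX, ha⟩, ⟨Y, b, rfl, hY, hb⟩, ?_⟩
      rw [pmCon]
      exact fun h' => ((hB.con _ _).1 (h fun u hu v hv =>
        (hA.con _ _).2 ⟨hX.1 u hu, hY.1 v hv, h' u hu v hv⟩)).2.2
    · rintro ⟨⟨X, a, rfl, hX, ha⟩, ⟨Y, b, rfl, hY, hb⟩, h⟩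
      rw [pmCon] at h
      exact ⟨X, a, Y, b, rfl, rfl, hX, ha, hY, hb, fun h' => (hB.con _ _).2 ⟨ha, hb,
        h fun u hu v hv => ((hA.con _ _).1 (h' u hu v hv)).2.2⟩⟩

theorem nice_simple (s : TyExpr) : Nice (interpSimple s) := by
  induction s with
  | tvar => exact nice_void
  | mu => exact nice_void
  | void => exact nice_void
  | sum a b iha ihb => exact nice_sum iha ihb
  | prod a b iha ihb => exact nice_prod iha ihb
  | arrow a b iha ihb => exact nice_func iha ihb

theorem Pre.carrier {s t : TyExpr} (h : Pre s t) :
    (interpSimple s).carrier ⊆ (interpSimple t).carrier := by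
  induction h with
  | void => intro x hx; exact hx.elim
  | sum _ _ ih1 ih2 =>
    rintro x ((rfl | ⟨a, ha, rfl⟩) | (rfl | ⟨a, ha, rfl⟩))
    · exact Or.inl (Or.inl rfl)
    · exact Or.inl (Or.inr ⟨a, ih1 ha, rfl⟩)
    · exact Or.inr (Or.inl rfl)
    · exact Or.inr (Or.inr ⟨a, ih2 ha, rfl⟩)
  | prod _ _ ih1 ih2 =>
    rintro x (⟨a, ha, rfl⟩ | ⟨a, ha, rfl⟩)
    · exact Or.inl ⟨a, ih1 ha, rfl⟩
    · exact Or.inr ⟨a, ih2 ha, rfl⟩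
  | arrow _ _ ih1 ih2 =>
    rintro x ⟨X, a, rfl, hX, ha⟩
    have hX := ((nice_simple _).goodList X).1 hX
    exact ⟨X, a, rfl, ((nice_simple _).goodList X).2 ⟨fun x hx => ih1 (hX.1 x hx), hX.2⟩, ih2 ha⟩

theorem nice_ty (t : TyExpr) : Nice (tyInterp t) := by
  constructor
  · intro x y
    constructor
    · rintro ⟨s, hs, h⟩
      obtain ⟨h1, h2, h3⟩ := ((nice_simple s).le _ _).1 h
      exact ⟨⟨s, hs, h1⟩, ⟨s, hs, h2⟩, h3⟩
    · rintro ⟨⟨s, hs, h1⟩, ⟨s', hs', h2⟩, h3⟩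
      obtain ⟨u, hu, p1, p2⟩ := unfolding_directed hs hs'
      exact ⟨u, hu, ((nice_simple u).le _ _).2 ⟨p1.carrier h1, p2.carrier h2, h3⟩⟩
  · intro x y
    constructor
    · rintro ⟨s, hs, h⟩
      obtain ⟨h1, h2, h3⟩ := ((nice_simple s).con _ _).1 h
      exact ⟨⟨s, hs, h1⟩, ⟨s, hs, h2⟩, h3⟩
    · rintro ⟨⟨s, hs, h1⟩, ⟨s', hs', h2⟩, h3⟩
      obtain ⟨u, hu, p1, p2⟩ := unfolding_directed hs hs'
      exact ⟨u, hu, ((nice_simple u).con _ _).2 ⟨p1.carrier h1, p2.carrier h2, h3⟩⟩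

theorem tyInterp_sum (a b : TyExpr) : tyInterp (.sum a b) = sumP (tyInterp a) (tyInterp b) := by
  refine (nice_ty _).ext' (nice_sum (nice_ty _) (nice_ty _)) ?_
  ext x
  constructor
  · rintro ⟨s, hs, hx⟩
    rw [unfolding_sum] at hs
    rcases hs with rfl | ⟨u, hu, v, hv, rfl⟩
    · exact hx.elim
    · rcases hx with (rfl | ⟨a, ha, rfl⟩) | (rfl | ⟨a, ha, rfl⟩)
      · exact Or.inl (Or.inl rfl)
      · exact Or.inl (Or.inr ⟨a, ⟨u, hu, ha⟩, rfl⟩)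
      · exact Or.inr (Or.inl rfl)
      · exact Or.inr (Or.inr ⟨a, ⟨v, hv, ha⟩, rfl⟩)
  · have hm : ∀ {u v}, u ∈ unfolding a → v ∈ unfolding b → TyExpr.sum u v ∈ unfolding (.sum a b) := by
      intro u v hu hv; rw [unfolding_sum]; exact Or.inr ⟨u, hu, v, hv, rfl⟩
    rintro ((rfl | ⟨c, ⟨u, hu, hc⟩, rfl⟩) | (rfl | ⟨c, ⟨u, hu, hc⟩, rfl⟩))
    · exact ⟨_, hm (void_mem_unfolding a) (void_mem_unfolding b), Or.inl (Or.inl rfl)⟩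
    · exact ⟨_, hm hu (void_mem_unfolding b), Or.inl (Or.inr ⟨c, hc, rfl⟩)⟩
    · exact ⟨_, hm (void_mem_unfolding a) (void_mem_unfolding b), Or.inr (Or.inl rfl)⟩
    · exact ⟨_, hm (void_mem_unfolding a) hu, Or.inr (Or.inr ⟨c, hc, rfl⟩)⟩

theorem tyInterp_prod (a b : TyExpr) : tyInterp (.prod a b) = prodP (tyInterp a) (tyInterp b) := by
  refine (nice_ty _).ext' (nice_prod (nice_ty _) (nice_ty _)) ?_
  ext x
  constructor
  · rintro ⟨s, hs, hx⟩
    rw [unfolding_prod] at hs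
    rcases hs with rfl | ⟨u, hu, v, hv, rfl⟩
    · exact hx.elim
    · rcases hx with ⟨a, ha, rfl⟩ | ⟨a, ha, rfl⟩
      · exact Or.inl ⟨a, ⟨u, hu, ha⟩, rfl⟩
      · exact Or.inr ⟨a, ⟨v, hv, ha⟩, rfl⟩
  · have hm : ∀ {u v}, u ∈ unfolding a → v ∈ unfolding b →
        TyExpr.prod u v ∈ unfolding (.prod a b) := by
      intro u v hu hv; rw [unfolding_prod]; exact Or.inr ⟨u, hu, v, hv, rfl⟩
    rintro (⟨c, ⟨u, hu, hc⟩, rfl⟩ | ⟨c, ⟨u, hu, hc⟩, rfl⟩)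
    · exact ⟨_, hm hu (void_mem_unfolding b), Or.inl ⟨c, hc, rfl⟩⟩
    · exact ⟨_, hm (void_mem_unfolding a) hu, Or.inr ⟨c, hc, rfl⟩⟩

theorem list_common {t : TyExpr} (X : List Pm) (h : ∀ x ∈ X, x ∈ (tyInterp t).carrier) :
    ∃ s ∈ unfolding t, ∀ x ∈ X, x ∈ (interpSimple s).carrier := by
  induction X with
  | nil => exact ⟨.void, void_mem_unfolding t, by simp⟩
  | cons x X ih =>
    obtain ⟨s, hs, h1⟩ := ih fun y hy => h y (List.mem_cons_of_mem _ hy)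
    obtain ⟨s', hs', h2⟩ := h x List.mem_cons_self
    obtain ⟨u, hu, p1, p2⟩ := unfolding_directed hs hs'
    refine ⟨u, hu, fun y hy => ?_⟩
    rcases List.mem_cons.1 hy with rfl | hy
    · exact p2.carrier h2
    · exact p1.carrier (h1 y hy)

theorem tyInterp_arrow (a b : TyExpr) :
    tyInterp (.arrow a b) = funcP (tyInterp a) (tyInterp b) := by
  refine (nice_ty _).ext' (nice_func (nice_ty _) (nice_ty _)) ?_
  ext x
  constructor
  · rintro ⟨s, hs, hx⟩
    rw [unfolding_arrow] at hs
    rcases hs with rfl | ⟨u, hu, v, hv, rfl⟩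
    · exact hx.elim
    · obtain ⟨X, c, rfl, hX, hc⟩ := hx
      have hX := ((nice_simple _).goodList X).1 hX
      exact ⟨X, c, rfl, ((nice_ty _).goodList X).2 ⟨fun x hx => ⟨u, hu, hX.1 x hx⟩, hX.2⟩,
        v, hv, hc⟩
  · rintro ⟨X, c, rfl, hX, v, hv, hc⟩
    have hX := ((nice_ty _).goodList X).1 hX
    obtain ⟨u, hu, h⟩ := list_common X hX.1
    refine ⟨.arrow u v, ?_, X, c, rfl, ((nice_simple _).goodList X).2 ⟨h, hX.2⟩, hc⟩
    rw [unfolding_arrow]; exact Or.inr ⟨u, hu, v, hv, rfl⟩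

end RecLam


set_option autoImplicit false
set_option linter.all false

namespace RecLam

/-! ### Part B: renaming, substitution, typing, root steps -/

def upr (r : ℕ → ℕ) : ℕ → ℕ
  | 0 => 0
  | n + 1 => r n + 1

def ren : (ℕ → ℕ) → Tm → Tm
  | r, .var n => .var (r n)
  | _, .const c => .const c
  | r, .app M N => .app (ren r M) (ren r N)
  | r, .lam σ M => .lam σ (ren (upr r) M)

def consS (N : Tm) (s : ℕ → Tm) : ℕ → Tm
  | 0 => N
  | n + 1 => s n

def ups (s : ℕ → Tm) : ℕ → Tm := consS (.var 0) fun n => ren Nat.succ (s n)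

def sub : (ℕ → Tm) → Tm → Tm
  | s, .var n => s n
  | _, .const c => .const c
  | s, .app M N => .app (sub s M) (sub s N)
  | s, .lam σ M => .lam σ (sub (ups s) M)

theorem liftTm_eq (d : ℕ) (M : Tm) : liftTm d M = ren (fun n => if n < d then n else n + 1) M := by
  induction M generalizing d with
  | var n => simp only [liftTm, ren]; split <;> rfl
  | const c => rfl
  | app M N ih1 ih2 => simp only [liftTm, ren, ih1, ih2]
  | lam σ M ih =>
    simp only [liftTm, ren, ih]
    congr 2
    funext n
    cases n with
    | zero => simp [upr]
    | succ n => simp only [upr]; split <;> split <;> omega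

theorem liftTm_zero (M : Tm) : liftTm 0 M = ren Nat.succ M := by
  rw [liftTm_eq]; congr 1

theorem substTm_eq (M : Tm) (k : ℕ) (N : Tm) : substTm M k N =
    sub (fun n => if n = k then N else if k < n then .var (n - 1) else .var n) M := by
  induction M generalizing k N with
  | var n => simp only [substTm, sub]
  | const c => rfl
  | app M N ih1 ih2 => simp only [substTm, sub, ih1, ih2]
  | lam σ M ih =>
    simp only [substTm, sub, ih]
    congr 2
    funext n
    cases n with
    | zero => simp [ups, consS]
    | succ n =>
      simp only [ups, consS, liftTm_zero]
      by_cases h : n = k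
      · simp [h]
      · by_cases h2 : k < n
        · have : n ≠ 0 := by omega
          simp [h, h2, ren]; omega
        · simp [h, h2, ren]

theorem substTm_zero (M N : Tm) : substTm M 0 N = sub (consS N .var) M := by
  rw [substTm_eq]; congr 1; funext n
  cases n with
  | zero => rfl
  | succ n => simp [consS]

theorem ren_ren (r r' : ℕ → ℕ) (M : Tm) : ren r (ren r' M) = ren (fun n => r (r' n)) M := by
  induction M generalizing r r' with
  | var n => rfl
  | const c => rfl
  | app M N ih1 ih2 => simp only [ren, ih1, ih2]
  | lam σ M ih => simp only [ren, ih]; congr 2; funext n; cases n <;> rfl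

theorem sub_ren (s : ℕ → Tm) (r : ℕ → ℕ) (M : Tm) : sub s (ren r M) = sub (fun n => s (r n)) M := by
  induction M generalizing s r with
  | var n => rfl
  | const c => rfl
  | app M N ih1 ih2 => simp only [ren, sub, ih1, ih2]
  | lam σ M ih => simp only [ren, sub, ih]; congr 2; funext n; cases n <;> rfl

theorem ren_sub (r : ℕ → ℕ) (s : ℕ → Tm) (M : Tm) :
    ren r (sub s M) = sub (fun n => ren r (s n)) M := by
  induction M generalizing s r with
  | var n => rfl
  | const c => rfl
  | app M N ih1 ih2 => simp only [ren, sub, ih1, ih2]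
  | lam σ M ih =>
    simp only [ren, sub, ih]; congr 2; funext n
    cases n with
    | zero => rfl
    | succ n => simp only [ups, consS, ren_ren]; rfl

theorem sub_sub (s s' : ℕ → Tm) (M : Tm) : sub s (sub s' M) = sub (fun n => sub s (s' n)) M := by
  induction M generalizing s s' with
  | var n => rfl
  | const c => rfl
  | app M N ih1 ih2 => simp only [sub, ih1, ih2]
  | lam σ M ih =>
    simp only [sub, ih]; congr 2; funext n
    cases n with
    | zero => rfl
    | succ n => simp only [ups, consS, sub_ren, ren_sub]

theorem ups_var : ups .var = .var := by
  funext n; cases n <;> rfl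

theorem sub_var (M : Tm) : sub .var M = M := by
  induction M with
  | var n => rfl
  | const c => rfl
  | app M N ih1 ih2 => simp only [sub, ih1, ih2]
  | lam σ M ih => simp only [sub, ups_var, ih]

theorem upr_id : upr (fun n => n) = fun n => n := by
  funext n; cases n <;> rfl

theorem ren_id (M : Tm) : ren (fun n => n) M = M := by
  induction M with
  | var n => rfl
  | const c => rfl
  | app M N ih1 ih2 => simp only [ren, ih1, ih2]
  | lam σ M ih => simp only [ren, upr_id, ih]

theorem ren_substTm (r : ℕ → ℕ) (M N : Tm) :
    ren r (substTm M 0 N) = substTm (ren (upr r) M) 0 (ren r N) := by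
  rw [substTm_zero, substTm_zero, ren_sub, sub_ren]
  congr 1; funext n; cases n <;> rfl

theorem sub_substTm (s : ℕ → Tm) (M N : Tm) :
    sub s (substTm M 0 N) = substTm (sub (ups s) M) 0 (sub s N) := by
  rw [substTm_zero, substTm_zero, sub_sub, sub_sub]
  congr 1; funext n
  cases n with
  | zero => rfl
  | succ n => simp only [consS, ups, sub_ren, sub]; exact (sub_var _).symm

theorem substTm_ren_sub (r : ℕ → ℕ) (s : ℕ → Tm) (M P : Tm) :
    substTm (ren (upr r) (sub (ups s) M)) 0 P = sub (consS P fun n => ren r (s n)) M := by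
  rw [substTm_zero, sub_ren, sub_sub]
  congr 1; funext n
  cases n with
  | zero => rfl
  | succ n =>
    simp only [ups, consS, sub_ren, upr]
    rw [← sub_var (ren r (s n)), sub_ren]

/-- Typing in which `Ω` has every type. -/
inductive HT : List TyExpr → Tm → TyExpr → Prop
  | var {Γ : List TyExpr} {n : ℕ} {σ : TyExpr} : Γ[n]? = some σ → HT Γ (.var n) σ
  | const {Γ : List TyExpr} (c : Const) : HT Γ (.const c) (constType c)
  | om {Γ : List TyExpr} (τ σ : TyExpr) : HT Γ (.const (.comega τ)) σ
  | app {Γ : List TyExpr} {M N : Tm} {σ τ : TyExpr} :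
      HT Γ M (.arrow σ τ) → HT Γ N σ → HT Γ (.app M N) τ
  | lam {Γ : List TyExpr} {M : Tm} {σ τ : TyExpr} :
      HT (σ :: Γ) M τ → HT Γ (.lam σ M) (.arrow σ τ)
  | equiv {Γ : List TyExpr} {M : Tm} {σ τ : TyExpr} : HT Γ M σ → TyEquiv σ τ → HT Γ M τ

theorem HasType.ht {Γ : List TyExpr} {M : Tm} {σ : TyExpr} (h : HasType Γ M σ) : HT Γ M σ := by
  induction h with
  | var h => exact .var h
  | const c => exact .const c
  | app _ _ h1 h2 => exact .app h1 h2
  | lam _ h => exact .lam h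
  | equiv _ h2 h => exact .equiv h h2

theorem HT.app_inv {Γ : List TyExpr} {M N : Tm} {T : TyExpr} (h : HT Γ (.app M N) T) :
    ∃ τ, HT Γ M (.arrow τ T) ∧ HT Γ N τ := by
  generalize hL : Tm.app M N = L at h
  induction h with
  | app h1 h2 => cases hL; exact ⟨_, h1, h2⟩
  | equiv _ h2 ih =>
    obtain ⟨τ, h1, h3⟩ := ih hL
    exact ⟨τ, .equiv h1 (.arrow' .rfl' h2), h3⟩
  | _ => cases hL

theorem HT.lam_inv {Γ : List TyExpr} {M : Tm} {σ T : TyExpr} (h : HT Γ (.lam σ M) T) :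
    ∃ τ, HT (σ :: Γ) M τ ∧ TyEquiv (.arrow σ τ) T := by
  generalize hL : Tm.lam σ M = L at h
  induction h with
  | lam h1 => cases hL; exact ⟨_, h1, .rfl'⟩
  | equiv _ h2 ih =>
    obtain ⟨τ, h1, h3⟩ := ih hL
    exact ⟨τ, h1, h3.trans' h2⟩
  | _ => cases hL

theorem HT.var_inv {Γ : List TyExpr} {n : ℕ} {T : TyExpr} (h : HT Γ (.var n) T) :
    ∃ σ, Γ[n]? = some σ ∧ TyEquiv σ T := by
  generalize hL : Tm.var n = L at h
  induction h with
  | var h1 => cases hL; exact ⟨_, h1, .rfl'⟩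
  | equiv _ h2 ih =>
    obtain ⟨τ, h1, h3⟩ := ih hL
    exact ⟨τ, h1, h3.trans' h2⟩
  | _ => cases hL

theorem HT.const_inv {Γ : List TyExpr} {c : Const} {T : TyExpr} (h : HT Γ (.const c) T) :
    (∃ s, c = .comega s) ∨ TyEquiv (constType c) T := by
  generalize hL : Tm.const c = L at h
  induction h with
  | const c => cases hL; exact Or.inr .rfl'
  | om τ => cases hL; exact Or.inl ⟨_, rfl⟩
  | equiv _ h2 ih => exact (ih hL).imp id fun h => h.trans' h2
  | _ => cases hL

/-- `a` is a principal type of `M` (up to equivalence). -/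
def Princ (Γ : List TyExpr) (M : Tm) (a : TyExpr) : Prop := ∀ T, HT Γ M T → TyEquiv a T

theorem Princ.app {Γ : List TyExpr} {M N : Tm} {a b T : TyExpr} (h : Princ Γ M (.arrow a b))
    (hT : HT Γ (.app M N) T) : HT Γ N a ∧ Princ Γ (.app M N) b := by
  constructor
  · obtain ⟨τ, h1, h2⟩ := hT.app_inv
    exact .equiv h2 (h _ h1).arrow_inv.1.symm'
  · intro T' hT'
    obtain ⟨τ, h1, h2⟩ := hT'.app_inv
    exact (h _ h1).arrow_inv.2

theorem princ_const {Γ : List TyExpr} {c : Const} (h : ∀ s, c ≠ .comega s) :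
    Princ Γ (.const c) (constType c) := fun T hT =>
  hT.const_inv.resolve_left fun ⟨s, hs⟩ => h s hs

theorem HT.app1 {Γ : List TyExpr} {c : Const} {x : Tm} {a b T : TyExpr}
    (h : HT Γ (.app (.const c) x) T) (hc : constType c = .arrow a b) (hn : ∀ s, c ≠ .comega s) :
    HT Γ x a ∧ TyEquiv b T := by
  have h0 : Princ Γ (.const c) (.arrow a b) := hc ▸ princ_const hn
  obtain ⟨h1, h2⟩ := h0.app h
  exact ⟨h1, h2 _ h⟩

theorem HT.app2 {Γ : List TyExpr} {c : Const} {x y : Tm} {a b d T : TyExpr}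
    (h : HT Γ (.app (.app (.const c) x) y) T) (hc : constType c = .arrow a (.arrow b d))
    (hn : ∀ s, c ≠ .comega s) :
    HT Γ x a ∧ HT Γ y b ∧ TyEquiv d T := by
  have h0 : Princ Γ (.const c) (.arrow a (.arrow b d)) := hc ▸ princ_const hn
  obtain ⟨τ, h1, _⟩ := h.app_inv
  obtain ⟨hx, h2⟩ := h0.app h1
  obtain ⟨hy, h3⟩ := h2.app h
  exact ⟨hx, hy, h3 _ h⟩

theorem HT.app3 {Γ : List TyExpr} {c : Const} {x y z : Tm} {a b d e T : TyExpr}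
    (h : HT Γ (.app (.app (.app (.const c) x) y) z) T)
    (hc : constType c = .arrow a (.arrow b (.arrow d e)))
    (hn : ∀ s, c ≠ .comega s) :
    HT Γ x a ∧ HT Γ y b ∧ HT Γ z d ∧ TyEquiv e T := by
  have h0 : Princ Γ (.const c) (.arrow a (.arrow b (.arrow d e))) := hc ▸ princ_const hn
  obtain ⟨τ, h1, _⟩ := h.app_inv
  obtain ⟨τ', h1', _⟩ := h1.app_inv
  obtain ⟨hx, h2⟩ := h0.app h1'
  obtain ⟨hy, h3⟩ := h2.app h1
  obtain ⟨hz, h4⟩ := h3.app h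
  exact ⟨hx, hy, hz, h4 _ h⟩

theorem HT.zero_inv {Γ : List TyExpr} {x : Tm} {s t T : TyExpr}
    (h : HT Γ (.app (.const (.czero s t)) x) T) : HT Γ x s ∧ TyEquiv (.sum s t) T :=
  h.app1 rfl (by simp)
theorem HT.one_inv {Γ : List TyExpr} {x : Tm} {s t T : TyExpr}
    (h : HT Γ (.app (.const (.cone s t)) x) T) : HT Γ x t ∧ TyEquiv (.sum s t) T :=
  h.app1 rfl (by simp)
theorem HT.fst_inv {Γ : List TyExpr} {x : Tm} {s t T : TyExpr}
    (h : HT Γ (.app (.const (.cfst s t)) x) T) : HT Γ x (.prod s t) ∧ TyEquiv s T :=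
  h.app1 rfl (by simp)
theorem HT.snd_inv {Γ : List TyExpr} {x : Tm} {s t T : TyExpr}
    (h : HT Γ (.app (.const (.csnd s t)) x) T) : HT Γ x (.prod s t) ∧ TyEquiv t T :=
  h.app1 rfl (by simp)
theorem HT.pair_inv {Γ : List TyExpr} {x y : Tm} {s t T : TyExpr}
    (h : HT Γ (.app (.app (.const (.cpair s t)) x) y) T) :
    HT Γ x s ∧ HT Γ y t ∧ TyEquiv (.prod s t) T :=
  h.app2 rfl (by simp)
theorem HT.case_inv {Γ : List TyExpr} {x y z : Tm} {s t r T : TyExpr}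
    (h : HT Γ (.app (.app (.app (.const (.ccase s t r)) x) y) z) T) :
    HT Γ x (.sum s t) ∧ HT Γ y (.arrow s r) ∧ HT Γ z (.arrow t r) ∧ TyEquiv r T :=
  h.app3 rfl (by simp)
theorem HT.pcase_inv {Γ : List TyExpr} {x y z : Tm} {s t r T : TyExpr}
    (h : HT Γ (.app (.app (.app (.const (.cpcase s t r)) x) y) z) T) :
    HT Γ x (.sum s t) ∧ HT Γ y r ∧ HT Γ z r ∧ TyEquiv r T :=
  h.app3 rfl (by simp)

theorem ht_pcase {Γ : List TyExpr} {x y z : Tm} {s t r : TyExpr}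
    (hx : HT Γ x (.sum s t)) (hy : HT Γ y r) (hz : HT Γ z r) :
    HT Γ (.app (.app (.app (.const (.cpcase s t r)) x) y) z) r :=
  .app (.app (.app (.const (.cpcase s t r)) hx) hy) hz

theorem HT.ren' {Γ Δ : List TyExpr} {M : Tm} {T : TyExpr} {r : ℕ → ℕ} (h : HT Γ M T)
    (hr : ∀ n σ, Γ[n]? = some σ → Δ[r n]? = some σ) : HT Δ (ren r M) T := by
  induction h generalizing Δ r with
  | var h => exact .var (hr _ _ h)
  | const c => exact .const c
  | om τ σ => exact .om τ σ
  | app _ _ ih1 ih2 => exact .app (ih1 hr) (ih2 hr)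
  | lam _ ih =>
    refine .lam (ih fun n σ h => ?_)
    cases n with
    | zero => exact h
    | succ n => exact hr n σ h
  | equiv _ h2 ih => exact .equiv (ih hr) h2

theorem HT.sub' {Γ Δ : List TyExpr} {M : Tm} {T : TyExpr} {s : ℕ → Tm} (h : HT Γ M T)
    (hs : ∀ n σ, Γ[n]? = some σ → HT Δ (s n) σ) : HT Δ (sub s M) T := by
  induction h generalizing Δ s with
  | var h => exact hs _ _ h
  | const c => exact .const c
  | om τ σ => exact .om τ σ
  | app _ _ ih1 ih2 => exact .app (ih1 hs) (ih2 hs)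
  | lam _ ih =>
    refine .lam (ih fun n σ h => ?_)
    cases n with
    | zero => exact .var h
    | succ n => exact (hs n σ h).ren' fun n σ h => h
  | equiv _ h2 ih => exact .equiv (ih hs) h2

theorem HT.subst {Γ : List TyExpr} {M N : Tm} {σ T : TyExpr} (h : HT (σ :: Γ) M T)
    (hN : HT Γ N σ) : HT Γ (substTm M 0 N) T := by
  rw [substTm_zero]
  refine h.sub' fun n τ h => ?_
  cases n with
  | zero => cases h; exact hN
  | succ n => exact .var h

/-- Reduction steps at the root. -/
inductive Root : Tm → Tm → Prop
  | beta (σ : TyExpr) (M N : Tm) :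
      Root (.app (.lam σ M) N) (substTm M 0 N)
  | caseZero (σ τ ρ σ' τ' : TyExpr) (x y z : Tm) :
      Root (.app (.app (.app (.const (.ccase σ τ ρ)) (.app (.const (.czero σ' τ')) x)) y) z)
        (.app y x)
  | caseOne (σ τ ρ σ' τ' : TyExpr) (x y z : Tm) :
      Root (.app (.app (.app (.const (.ccase σ τ ρ)) (.app (.const (.cone σ' τ')) x)) y) z)
        (.app z x)
  | fstPair (σ τ σ' τ' : TyExpr) (x y : Tm) :
      Root (.app (.const (.cfst σ τ)) (.app (.app (.const (.cpair σ' τ')) x) y)) x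
  | sndPair (σ τ σ' τ' : TyExpr) (x y : Tm) :
      Root (.app (.const (.csnd σ τ)) (.app (.app (.const (.cpair σ' τ')) x) y)) y
  | pcaseZero (σ τ ρ σ' τ' : TyExpr) (x y z : Tm) :
      Root (.app (.app (.app (.const (.cpcase σ τ ρ)) (.app (.const (.czero σ' τ')) x)) y) z) y
  | pcaseOne (σ τ ρ σ' τ' : TyExpr) (x y z : Tm) :
      Root (.app (.app (.app (.const (.cpcase σ τ ρ)) (.app (.const (.cone σ' τ')) x)) y) z) z
  | pcaseZZ (σ τ ρ₀ ρ₁ σ₁ τ₁ σ₂ τ₂ : TyExpr) (x y z : Tm) :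
      Root (.app (.app (.app (.const (.cpcase σ τ (.sum ρ₀ ρ₁))) x)
              (.app (.const (.czero σ₁ τ₁)) y)) (.app (.const (.czero σ₂ τ₂)) z))
        (.app (.const (.czero ρ₀ ρ₁)) (.app (.app (.app (.const (.cpcase σ τ ρ₀)) x) y) z))
  | pcaseOO (σ τ ρ₀ ρ₁ σ₁ τ₁ σ₂ τ₂ : TyExpr) (x y z : Tm) :
      Root (.app (.app (.app (.const (.cpcase σ τ (.sum ρ₀ ρ₁))) x)
              (.app (.const (.cone σ₁ τ₁)) y)) (.app (.const (.cone σ₂ τ₂)) z))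
        (.app (.const (.cone ρ₀ ρ₁)) (.app (.app (.app (.const (.cpcase σ τ ρ₁)) x) y) z))
  | pcasePair (σ τ ρ₁ ρ₂ σ₁ τ₁ σ₂ τ₂ : TyExpr) (x y₁ y₂ z₁ z₂ : Tm) :
      Root (.app (.app (.app (.const (.cpcase σ τ (.prod ρ₁ ρ₂))) x)
              (.app (.app (.const (.cpair σ₁ τ₁)) y₁) y₂))
              (.app (.app (.const (.cpair σ₂ τ₂)) z₁) z₂))
        (.app (.app (.const (.cpair ρ₁ ρ₂))
            (.app (.app (.app (.const (.cpcase σ τ ρ₁)) x) y₁) z₁))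
          (.app (.app (.app (.const (.cpcase σ τ ρ₂)) x) y₂) z₂))
  | pcaseArrow (σ τ ρ₁ ρ₂ : TyExpr) (x y z w : Tm) :
      Root (.app (.app (.app (.app (.const (.cpcase σ τ (.arrow ρ₁ ρ₂))) x) y) z) w)
        (.app (.app (.app (.const (.cpcase σ τ ρ₂)) x) (.app y w)) (.app z w))

theorem Root.step {M N : Tm} (h : Root M N) : Step M N := by
  cases h <;> constructor

theorem step_app_inv {P Q N : Tm} (h : Step (.app P Q) N) :
    Root (.app P Q) N ∨ (∃ P', Step P P' ∧ N = .app P' Q) ∨ (∃ Q', Step Q Q' ∧ N = .app P Q') := by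
  cases h with
  | appL _ h => exact Or.inr (Or.inl ⟨_, h, rfl⟩)
  | appR _ h => exact Or.inr (Or.inr ⟨_, h, rfl⟩)
  | _ => left; constructor

theorem Root.ht {Γ : List TyExpr} {M N : Tm} {T : TyExpr} (h : Root M N) (hM : HT Γ M T) :
    HT Γ N T := by
  cases h with
  | beta σ M N =>
    obtain ⟨τ, h1, h2⟩ := hM.app_inv
    obtain ⟨τ', h3, h4⟩ := h1.lam_inv
    exact .equiv (h3.subst (.equiv h2 h4.arrow_inv.1.symm')) h4.arrow_inv.2
  | caseZero =>
    obtain ⟨hx, hy, hz, hT⟩ := hM.case_inv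
    obtain ⟨hx, he⟩ := hx.zero_inv
    exact .equiv (.app hy (.equiv hx he.sum_inv.1)) hT
  | caseOne =>
    obtain ⟨hx, hy, hz, hT⟩ := hM.case_inv
    obtain ⟨hx, he⟩ := hx.one_inv
    exact .equiv (.app hz (.equiv hx he.sum_inv.2)) hT
  | fstPair =>
    obtain ⟨hx, hT⟩ := hM.fst_inv
    obtain ⟨hx, hy, he⟩ := hx.pair_inv
    exact .equiv hx (he.prod_inv.1.trans' hT)
  | sndPair =>
    obtain ⟨hx, hT⟩ := hM.snd_inv
    obtain ⟨hx, hy, he⟩ := hx.pair_inv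
    exact .equiv hy (he.prod_inv.2.trans' hT)
  | pcaseZero =>
    obtain ⟨hx, hy, hz, hT⟩ := hM.pcase_inv
    exact .equiv hy hT
  | pcaseOne =>
    obtain ⟨hx, hy, hz, hT⟩ := hM.pcase_inv
    exact .equiv hz hT
  | pcaseZZ =>
    obtain ⟨hx, hy, hz, hT⟩ := hM.pcase_inv
    obtain ⟨hy, he⟩ := hy.zero_inv
    obtain ⟨hz, he'⟩ := hz.zero_inv
    exact .equiv (.app (.const (.czero _ _)) (ht_pcase hx (.equiv hy he.sum_inv.1)
      (.equiv hz he'.sum_inv.1))) hT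
  | pcaseOO =>
    obtain ⟨hx, hy, hz, hT⟩ := hM.pcase_inv
    obtain ⟨hy, he⟩ := hy.one_inv
    obtain ⟨hz, he'⟩ := hz.one_inv
    exact .equiv (.app (.const (.cone _ _)) (ht_pcase hx (.equiv hy he.sum_inv.2)
      (.equiv hz he'.sum_inv.2))) hT
  | pcasePair =>
    obtain ⟨hx, hy, hz, hT⟩ := hM.pcase_inv
    obtain ⟨hy1, hy2, he⟩ := hy.pair_inv
    obtain ⟨hz1, hz2, he'⟩ := hz.pair_inv
    exact .equiv (.app (.app (.const (.cpair _ _)) (ht_pcase hx (.equiv hy1 he.prod_inv.1)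
      (.equiv hz1 he'.prod_inv.1))) (ht_pcase hx (.equiv hy2 he.prod_inv.2)
      (.equiv hz2 he'.prod_inv.2))) hT
  | pcaseArrow =>
    obtain ⟨τ, h1, hw⟩ := hM.app_inv
    obtain ⟨hx, hy, hz, hT⟩ := h1.pcase_inv
    have hw := HT.equiv hw hT.arrow_inv.1.symm'
    exact .equiv (ht_pcase hx (.app hy hw) (.app hz hw)) hT.arrow_inv.2

theorem Step.ht {Γ : List TyExpr} {M N : Tm} {T : TyExpr} (h : Step M N) (hM : HT Γ M T) :
    HT Γ N T := by
  induction h generalizing Γ T with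
  | appL N h ih =>
    obtain ⟨τ, h1, h2⟩ := hM.app_inv
    exact .app (ih h1) h2
  | appR N h ih =>
    obtain ⟨τ, h1, h2⟩ := hM.app_inv
    exact .app h1 (ih h2)
  | lamC σ h ih =>
    obtain ⟨τ, h1, h2⟩ := hM.lam_inv
    exact .equiv (.lam (ih h1)) h2
  | _ => exact Root.ht (by constructor) hM

theorem Steps.ht {Γ : List TyExpr} {M N : Tm} {T : TyExpr} (h : Steps M N) (hM : HT Γ M T) :
    HT Γ N T := by
  induction h with
  | refl => exact hM
  | tail _ h ih => exact h.ht ih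

theorem TmPre.ht {Γ : List TyExpr} {A M : Tm} {T : TyExpr} (h : TmPre A M) (hM : HT Γ M T) :
    HT Γ A T := by
  induction h generalizing Γ T with
  | omega σ M => exact .om _ _
  | var => exact hM
  | const => exact hM
  | app _ _ ih1 ih2 =>
    obtain ⟨τ, h1, h2⟩ := hM.app_inv
    exact .app (ih1 h1) (ih2 h2)
  | lam σ _ ih =>
    obtain ⟨τ, h1, h2⟩ := hM.lam_inv
    exact .equiv (.lam (ih h1)) h2

theorem steps_map (f : Tm → Tm) (hf : ∀ a b, Step a b → Step (f a) (f b)) {M N : Tm}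
    (h : Steps M N) : Steps (f M) (f N) := by
  induction h with
  | refl => exact .refl
  | tail _ h ih => exact ih.tail (hf _ _ h)

theorem steps_app {M M' N N' : Tm} (h1 : Steps M M') (h2 : Steps N N') :
    Steps (.app M N) (.app M' N') :=
  (steps_map (fun x => Tm.app x N) (fun _ _ h => .appL _ h) h1).trans
    (steps_map (fun x => Tm.app M' x) (fun _ _ h => .appR _ h) h2)

theorem steps_lam {M M' : Tm} (σ : TyExpr) (h1 : Steps M M') : Steps (.lam σ M) (.lam σ M') :=
  steps_map (fun x => Tm.lam σ x) (fun _ _ h => .lamC _ h) h1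

theorem Root.steps {M N : Tm} (h : Root M N) : Steps M N := .single h.step

theorem Step.ren' {M N : Tm} (h : Step M N) (r : ℕ → ℕ) : Step (ren r M) (ren r N) := by
  induction h generalizing r with
  | beta σ M N => rw [ren_substTm]; exact .beta _ _ _
  | appL N _ ih => exact .appL _ (ih r)
  | appR N _ ih => exact .appR _ (ih r)
  | lamC σ _ ih => exact .lamC _ (ih _)
  | _ => constructor

theorem Steps.ren' {M N : Tm} (h : Steps M N) (r : ℕ → ℕ) : Steps (ren r M) (ren r N) :=
  steps_map (ren r) (fun _ _ h => h.ren' r) h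

theorem ren_eq_app {r : ℕ → ℕ} {M P Q : Tm} (h : ren r M = .app P Q) :
    ∃ P' Q', M = .app P' Q' ∧ ren r P' = P ∧ ren r Q' = Q := by
  cases M with
  | app P' Q' => cases h; exact ⟨_, _, rfl, rfl, rfl⟩
  | _ => cases h
theorem ren_eq_const {r : ℕ → ℕ} {M : Tm} {c : Const} (h : ren r M = .const c) : M = .const c := by
  cases M with
  | const c => cases h; rfl
  | _ => cases h
theorem ren_eq_lam {r : ℕ → ℕ} {M P : Tm} {σ : TyExpr} (h : ren r M = .lam σ P) :
    ∃ P', M = .lam σ P' ∧ ren (upr r) P' = P := by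
  cases M with
  | lam σ P' => cases h; exact ⟨_, rfl, rfl⟩
  | _ => cases h

theorem Root.ren_inv {M N : Tm} {r : ℕ → ℕ} (h : Root (ren r M) N) :
    ∃ N', Root M N' ∧ ren r N' = N := by
  generalize hL : ren r M = L at h
  cases h with
  | beta σ A B =>
    obtain ⟨P1, Q1, rfl, hP1, rfl⟩ := ren_eq_app hL
    obtain ⟨P', rfl, rfl⟩ := ren_eq_lam hP1
    exact ⟨_, .beta _ _ _, ren_substTm _ _ _⟩
  | caseZero =>
    obtain ⟨P1, z1, rfl, hP1, rfl⟩ := ren_eq_app hL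
    obtain ⟨P2, y2, rfl, hP2, rfl⟩ := ren_eq_app hP1
    obtain ⟨P3, x3, rfl, hP3, hx⟩ := ren_eq_app hP2
    cases ren_eq_const hP3
    obtain ⟨P4, x4, rfl, hP4, rfl⟩ := ren_eq_app hx
    cases ren_eq_const hP4
    exact ⟨_, .caseZero .., rfl⟩
  | caseOne =>
    obtain ⟨P1, z1, rfl, hP1, rfl⟩ := ren_eq_app hL
    obtain ⟨P2, y2, rfl, hP2, rfl⟩ := ren_eq_app hP1
    obtain ⟨P3, x3, rfl, hP3, hx⟩ := ren_eq_app hP2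
    cases ren_eq_const hP3
    obtain ⟨P4, x4, rfl, hP4, rfl⟩ := ren_eq_app hx
    cases ren_eq_const hP4
    exact ⟨_, .caseOne .., rfl⟩
  | fstPair =>
    obtain ⟨P1, x1, rfl, hP1, hx⟩ := ren_eq_app hL
    cases ren_eq_const hP1
    obtain ⟨P2, y2, rfl, hP2, rfl⟩ := ren_eq_app hx
    obtain ⟨P3, x3, rfl, hP3, rfl⟩ := ren_eq_app hP2
    cases ren_eq_const hP3
    exact ⟨_, .fstPair .., rfl⟩
  | sndPair =>
    obtain ⟨P1, x1, rfl, hP1, hx⟩ := ren_eq_app hL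
    cases ren_eq_const hP1
    obtain ⟨P2, y2, rfl, hP2, rfl⟩ := ren_eq_app hx
    obtain ⟨P3, x3, rfl, hP3, rfl⟩ := ren_eq_app hP2
    cases ren_eq_const hP3
    exact ⟨_, .sndPair .., rfl⟩
  | pcaseZero =>
    obtain ⟨P1, z1, rfl, hP1, rfl⟩ := ren_eq_app hL
    obtain ⟨P2, y2, rfl, hP2, rfl⟩ := ren_eq_app hP1
    obtain ⟨P3, x3, rfl, hP3, hx⟩ := ren_eq_app hP2
    cases ren_eq_const hP3
    obtain ⟨P4, x4, rfl, hP4, rfl⟩ := ren_eq_app hx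
    cases ren_eq_const hP4
    exact ⟨_, .pcaseZero .., rfl⟩
  | pcaseOne =>
    obtain ⟨P1, z1, rfl, hP1, rfl⟩ := ren_eq_app hL
    obtain ⟨P2, y2, rfl, hP2, rfl⟩ := ren_eq_app hP1
    obtain ⟨P3, x3, rfl, hP3, hx⟩ := ren_eq_app hP2
    cases ren_eq_const hP3
    obtain ⟨P4, x4, rfl, hP4, rfl⟩ := ren_eq_app hx
    cases ren_eq_const hP4
    exact ⟨_, .pcaseOne .., rfl⟩
  | pcaseZZ =>
    obtain ⟨P1, z1, rfl, hP1, hz⟩ := ren_eq_app hL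
    obtain ⟨P2, y2, rfl, hP2, hy⟩ := ren_eq_app hP1
    obtain ⟨P3, x3, rfl, hP3, rfl⟩ := ren_eq_app hP2
    cases ren_eq_const hP3
    obtain ⟨P4, x4, rfl, hP4, rfl⟩ := ren_eq_app hy
    cases ren_eq_const hP4
    obtain ⟨P5, x5, rfl, hP5, rfl⟩ := ren_eq_app hz
    cases ren_eq_const hP5
    exact ⟨_, .pcaseZZ .., rfl⟩
  | pcaseOO =>
    obtain ⟨P1, z1, rfl, hP1, hz⟩ := ren_eq_app hL
    obtain ⟨P2, y2, rfl, hP2, hy⟩ := ren_eq_app hP1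
    obtain ⟨P3, x3, rfl, hP3, rfl⟩ := ren_eq_app hP2
    cases ren_eq_const hP3
    obtain ⟨P4, x4, rfl, hP4, rfl⟩ := ren_eq_app hy
    cases ren_eq_const hP4
    obtain ⟨P5, x5, rfl, hP5, rfl⟩ := ren_eq_app hz
    cases ren_eq_const hP5
    exact ⟨_, .pcaseOO .., rfl⟩
  | pcasePair =>
    obtain ⟨P1, z1, rfl, hP1, hz⟩ := ren_eq_app hL
    obtain ⟨P2, y2, rfl, hP2, hy⟩ := ren_eq_app hP1
    obtain ⟨P3, x3, rfl, hP3, rfl⟩ := ren_eq_app hP2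
    cases ren_eq_const hP3
    obtain ⟨P4, x4, rfl, hP4, rfl⟩ := ren_eq_app hy
    obtain ⟨P5, x5, rfl, hP5, rfl⟩ := ren_eq_app hP4
    cases ren_eq_const hP5
    obtain ⟨P6, x6, rfl, hP6, rfl⟩ := ren_eq_app hz
    obtain ⟨P7, x7, rfl, hP7, rfl⟩ := ren_eq_app hP6
    cases ren_eq_const hP7
    exact ⟨_, .pcasePair .., rfl⟩
  | pcaseArrow =>
    obtain ⟨P1, w1, rfl, hP1, rfl⟩ := ren_eq_app hL
    obtain ⟨P2, z2, rfl, hP2, rfl⟩ := ren_eq_app hP1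
    obtain ⟨P3, y3, rfl, hP3, rfl⟩ := ren_eq_app hP2
    obtain ⟨P4, x4, rfl, hP4, rfl⟩ := ren_eq_app hP3
    cases ren_eq_const hP4
    exact ⟨_, .pcaseArrow .., rfl⟩

theorem Step.ren_inv {M N : Tm} {r : ℕ → ℕ} (h : Step (ren r M) N) :
    ∃ N', Step M N' ∧ ren r N' = N := by
  induction M generalizing r N with
  | var n => cases h
  | const c => cases h
  | app P Q ih1 ih2 =>
    rcases step_app_inv h with h0 | ⟨P', h0, rfl⟩ | ⟨Q', h0, rfl⟩
    · obtain ⟨N', h1, h2⟩ := Root.ren_inv (M := .app P Q) h0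
      exact ⟨N', h1.step, h2⟩
    · obtain ⟨N', h1, rfl⟩ := ih1 h0
      exact ⟨_, .appL _ h1, rfl⟩
    · obtain ⟨N', h1, rfl⟩ := ih2 h0
      exact ⟨_, .appR _ h1, rfl⟩
  | lam σ P ih =>
    cases h with
    | lamC _ h =>
      obtain ⟨N', h1, rfl⟩ := ih h
      exact ⟨_, .lamC _ h1, rfl⟩

theorem Steps.ren_inv {M N : Tm} {r : ℕ → ℕ} (h : Steps (ren r M) N) :
    ∃ N', Steps M N' ∧ ren r N' = N := by
  induction h with
  | refl => exact ⟨M, .refl, rfl⟩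
  | tail _ h ih =>
    obtain ⟨N', h1, rfl⟩ := ih
    obtain ⟨N'', h2, rfl⟩ := h.ren_inv
    exact ⟨N'', h1.tail h2, rfl⟩

end RecLam


set_option autoImplicit false
set_option linter.all false

namespace RecLam

/-! ### Part C: confluence modulo equivalent subscripts -/

inductive CEq : Const → Const → Prop
  | zero {s t s' t' : TyExpr} : TyEquiv s s' → TyEquiv t t' → CEq (.czero s t) (.czero s' t')
  | one {s t s' t' : TyExpr} : TyEquiv s s' → TyEquiv t t' → CEq (.cone s t) (.cone s' t')
  | pair {s t s' t' : TyExpr} : TyEquiv s s' → TyEquiv t t' → CEq (.cpair s t) (.cpair s' t')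
  | case (s t r : TyExpr) : CEq (.ccase s t r) (.ccase s t r)
  | pcase (s t r : TyExpr) : CEq (.cpcase s t r) (.cpcase s t r)
  | fst (s t : TyExpr) : CEq (.cfst s t) (.cfst s t)
  | snd (s t : TyExpr) : CEq (.csnd s t) (.csnd s t)
  | om (s : TyExpr) : CEq (.comega s) (.comega s)

theorem CEq.rfl' (c : Const) : CEq c c := by
  cases c <;> constructor <;> exact .rfl'

theorem CEq.symm' {c d : Const} (h : CEq c d) : CEq d c := by
  cases h <;> constructor <;> (apply TyEquiv.symm'; assumption)

theorem CEq.trans' {c d e : Const} (h : CEq c d) (h' : CEq d e) : CEq c e := by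
  cases h <;> cases h' <;> constructor <;> (apply TyEquiv.trans' <;> assumption)

theorem CEq.ty {c d : Const} (h : CEq c d) : TyEquiv (constType c) (constType d) := by
  cases h with
  | zero h1 h2 => exact .arrow' h1 (.sum' h1 h2)
  | one h1 h2 => exact .arrow' h2 (.sum' h1 h2)
  | pair h1 h2 => exact .arrow' h1 (.arrow' h2 (.prod' h1 h2))
  | _ => exact .rfl'

theorem CEq.sem {c d : Const} (h : CEq c d) : constSem c = constSem d := by
  cases h with
  | zero h1 h2 => simp only [constSem, h1.interp]
  | one h1 h2 => simp only [constSem, h2.interp]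
  | pair h1 h2 => simp only [constSem, h1.interp, h2.interp]
  | _ => rfl

inductive Sim : Tm → Tm → Prop
  | var (n : ℕ) : Sim (.var n) (.var n)
  | const {c d : Const} : CEq c d → Sim (.const c) (.const d)
  | app {M M' N N' : Tm} : Sim M M' → Sim N N' → Sim (.app M N) (.app M' N')
  | lam (σ : TyExpr) {M M' : Tm} : Sim M M' → Sim (.lam σ M) (.lam σ M')

theorem Sim.rfl' (M : Tm) : Sim M M := by
  induction M with
  | var n => exact .var n
  | const c => exact .const (.rfl' c)
  | app _ _ h1 h2 => exact .app h1 h2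
  | lam σ _ h => exact .lam σ h

theorem Sim.symm' {M N : Tm} (h : Sim M N) : Sim N M := by
  induction h with
  | var n => exact .var n
  | const c => exact .const c.symm'
  | app _ _ h1 h2 => exact .app h1 h2
  | lam σ _ h => exact .lam σ h

theorem Sim.trans' {M N K : Tm} (h : Sim M N) (h' : Sim N K) : Sim M K := by
  induction h generalizing K with
  | var n => exact h'
  | const c => cases h' with | const c' => exact .const (c.trans' c')
  | app _ _ h1 h2 => cases h' with | app h3 h4 => exact .app (h1 h3) (h2 h4)
  | lam σ _ h => cases h' with | lam _ h1 => exact .lam σ (h h1)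

theorem Sim.ren' {M N : Tm} (h : Sim M N) (r : ℕ → ℕ) : Sim (ren r M) (ren r N) := by
  induction h generalizing r with
  | var n => exact .var _
  | const c => exact .const c
  | app _ _ h1 h2 => exact .app (h1 r) (h2 r)
  | lam σ _ h => exact .lam σ (h _)

theorem Sim.sub' {M N : Tm} (h : Sim M N) {s s' : ℕ → Tm} (hs : ∀ n, Sim (s n) (s' n)) :
    Sim (sub s M) (sub s' N) := by
  induction h generalizing s s' with
  | var n => exact hs n
  | const c => exact .const c
  | app _ _ h1 h2 => exact .app (h1 hs) (h2 hs)
  | lam σ _ h =>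
    refine .lam σ (h fun n => ?_)
    cases n with
    | zero => exact .var 0
    | succ n => exact (hs n).ren' _

theorem Sim.subst {M M' N N' : Tm} (h : Sim M M') (h' : Sim N N') :
    Sim (substTm M 0 N) (substTm M' 0 N') := by
  rw [substTm_zero, substTm_zero]
  refine h.sub' fun n => ?_
  cases n with
  | zero => exact h'
  | succ n => exact .var n

theorem Sim.ht {Γ : List TyExpr} {M N : Tm} {T : TyExpr} (h : Sim M N) (hM : HT Γ M T) :
    HT Γ N T := by
  induction h generalizing Γ T with
  | var n => exact hM
  | const c =>
    rcases hM.const_inv with ⟨s, rfl⟩ | h1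
    · cases c; exact .om _ _
    · exact .equiv (.const _) (c.ty.symm'.trans' h1)
  | app _ _ h1 h2 =>
    obtain ⟨τ, h3, h4⟩ := hM.app_inv
    exact .app (h1 h3) (h2 h4)
  | lam σ _ h =>
    obtain ⟨τ, h3, h4⟩ := hM.lam_inv
    exact .equiv (.lam (h h3)) h4

theorem Sim.sem {M N : Tm} (h : Sim M N) (ε : Env) : sem M ε = sem N ε := by
  induction h generalizing ε with
  | var n => rfl
  | const c => exact c.sem
  | app _ _ h1 h2 => simp only [RecLam.sem, h1, h2]
  | lam σ _ h => simp only [RecLam.sem, h]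

theorem Root.sim {M M' N : Tm} (h : Root M N) (hs : Sim M M') : ∃ N', Root M' N' ∧ Sim N N' := by
  cases h with
  | beta σ A B =>
    cases hs with | app h1 h2 => cases h1 with | lam _ h1 => exact ⟨_, .beta .., h1.subst h2⟩
  | caseZero =>
    cases hs with | app h1 hz => cases h1 with | app h1 hy => cases h1 with | app h1 hx =>
    cases h1 with | const h1 => cases h1; cases hx with | app h2 hx => cases h2 with | const h2 =>
    cases h2
    exact ⟨_, .caseZero .., .app hy hx⟩
  | caseOne =>
    cases hs with | app h1 hz => cases h1 with | app h1 hy => cases h1 with | app h1 hx =>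
    cases h1 with | const h1 => cases h1; cases hx with | app h2 hx => cases h2 with | const h2 =>
    cases h2
    exact ⟨_, .caseOne .., .app hz hx⟩
  | fstPair =>
    cases hs with | app h1 h2 => cases h1 with | const h1 => cases h1; cases h2 with | app h1 hy =>
    cases h1 with | app h1 hx => cases h1 with | const h1 => cases h1; exact ⟨_, .fstPair .., hx⟩
  | sndPair =>
    cases hs with | app h1 h2 => cases h1 with | const h1 => cases h1; cases h2 with | app h1 hy =>
    cases h1 with | app h1 hx => cases h1 with | const h1 => cases h1; exact ⟨_, .sndPair .., hy⟩
  | pcaseZero =>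
    cases hs with | app h1 hz => cases h1 with | app h1 hy => cases h1 with | app h1 hx =>
    cases h1 with | const h1 => cases h1; cases hx with | app h2 hx => cases h2 with | const h2 =>
    cases h2
    exact ⟨_, .pcaseZero .., hy⟩
  | pcaseOne =>
    cases hs with | app h1 hz => cases h1 with | app h1 hy => cases h1 with | app h1 hx =>
    cases h1 with | const h1 => cases h1; cases hx with | app h2 hx => cases h2 with | const h2 =>
    cases h2
    exact ⟨_, .pcaseOne .., hz⟩
  | pcaseZZ =>
    cases hs with | app h1 hz => cases h1 with | app h1 hy => cases h1 with | app h1 hx =>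
    cases h1 with | const h1 => cases h1; cases hy with | app h2 hy => cases h2 with | const h2 =>
    cases h2; cases hz with | app h2 hz => cases h2 with | const h2 => cases h2; exact ⟨_, .pcaseZZ .., .app (.rfl' _) (.app (.app (.app (.rfl' _) hx) hy) hz)⟩
  | pcaseOO =>
    cases hs with | app h1 hz => cases h1 with | app h1 hy => cases h1 with | app h1 hx =>
    cases h1 with | const h1 => cases h1; cases hy with | app h2 hy => cases h2 with | const h2 =>
    cases h2; cases hz with | app h2 hz => cases h2 with | const h2 => cases h2; exact ⟨_, .pcaseOO .., .app (.rfl' _) (.app (.app (.app (.rfl' _) hx) hy) hz)⟩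
  | pcasePair =>
    cases hs with | app h1 hz => cases h1 with | app h1 hy => cases h1 with | app h1 hx =>
    cases h1 with | const h1 => cases h1; cases hy with | app h2 hy2 => cases h2 with | app h2 hy1 =>
    cases h2 with | const h2 =>
    cases h2; cases hz with | app h2 hz2 => cases h2 with | app h2 hz1 =>
    cases h2 with | const h2 => cases h2; exact ⟨_, .pcasePair .., .app (.app (.rfl' _) (.app (.app (.app (.rfl' _) hx) hy1) hz1))
      (.app (.app (.app (.rfl' _) hx) hy2) hz2)⟩
  | pcaseArrow =>
    cases hs with | app h1 hw => cases h1 with | app h1 hz => cases h1 with | app h1 hy =>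
    cases h1 with | app h1 hx =>
    cases h1 with | const h1 => cases h1; exact ⟨_, .pcaseArrow .., .app (.app (.app (.rfl' _) hx) (.app hy hw)) (.app hz hw)⟩

theorem Step.sim {M M' N : Tm} (h : Step M N) (hs : Sim M M') : ∃ N', Step M' N' ∧ Sim N N' := by
  induction h generalizing M' with
  | appL N h ih =>
    cases hs with | app h1 h2 => obtain ⟨K, h3, h4⟩ := ih h1; exact ⟨_, .appL _ h3, .app h4 h2⟩
  | appR N h ih =>
    cases hs with | app h1 h2 => obtain ⟨K, h3, h4⟩ := ih h2; exact ⟨_, .appR _ h3, .app h1 h4⟩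
  | lamC σ h ih =>
    cases hs with | lam _ h1 => obtain ⟨K, h3, h4⟩ := ih h1; exact ⟨_, .lamC _ h3, .lam _ h4⟩
  | _ =>
    obtain ⟨N', h1, h2⟩ := Root.sim (by constructor) hs
    exact ⟨N', h1.step, h2⟩

theorem Steps.sim {M M' N : Tm} (h : Steps M N) (hs : Sim M M') :
    ∃ N', Steps M' N' ∧ Sim N N' := by
  induction h with
  | refl => exact ⟨_, .refl, hs⟩
  | tail _ h ih =>
    obtain ⟨K, h1, h2⟩ := ih
    obtain ⟨K', h3, h4⟩ := h.sim h2
    exact ⟨K', h1.tail h3, h4⟩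

/-- Parallel reduction (superdevelopments). -/
inductive Par : Tm → Tm → Prop
  | var (n : ℕ) : Par (.var n) (.var n)
  | const {c d : Const} : CEq c d → Par (.const c) (.const d)
  | app {M M' N N' : Tm} : Par M M' → Par N N' → Par (.app M N) (.app M' N')
  | lam (σ : TyExpr) {M M' : Tm} : Par M M' → Par (.lam σ M) (.lam σ M')
  | root {M M' N N' K : Tm} : Par M M' → Par N N' → Root (.app M' N') K → Par (.app M N) K

theorem Sim.par {M N : Tm} (h : Sim M N) : Par M N := by
  induction h with
  | var n => exact .var n
  | const c => exact .const c
  | app _ _ h1 h2 => exact .app h1 h2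
  | lam σ _ h => exact .lam σ h

theorem Par.rfl' (M : Tm) : Par M M := (Sim.rfl' M).par

theorem Step.par {M N : Tm} (h : Step M N) : Par M N := by
  induction h with
  | appL N h ih => exact .app ih (.rfl' _)
  | appR N h ih => exact .app (.rfl' _) ih
  | lamC σ h ih => exact .lam _ ih
  | _ => exact .root (.rfl' _) (.rfl' _) (by constructor)

theorem Par.steps {M N : Tm} (h : Par M N) : ∃ N', Steps M N' ∧ Sim N' N := by
  induction h with
  | var n => exact ⟨_, .refl, .var n⟩
  | const c => exact ⟨_, .refl, .const c⟩
  | app _ _ h1 h2 =>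
    obtain ⟨A, h1, h1'⟩ := h1
    obtain ⟨B, h2, h2'⟩ := h2
    exact ⟨_, steps_app h1 h2, .app h1' h2'⟩
  | lam σ _ h =>
    obtain ⟨A, h1, h1'⟩ := h
    exact ⟨_, steps_lam σ h1, .lam σ h1'⟩
  | root _ _ h h1 h2 =>
    obtain ⟨A, h1, h1'⟩ := h1
    obtain ⟨B, h2, h2'⟩ := h2
    obtain ⟨N', h3, h4⟩ := h.sim (Sim.app h1' h2').symm'
    exact ⟨N', (steps_app h1 h2).tail h3.step, h4.symm'⟩

theorem Par.ht {Γ : List TyExpr} {M N : Tm} {T : TyExpr} (h : Par M N) (hM : HT Γ M T) :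
    HT Γ N T := by
  obtain ⟨N', h1, h2⟩ := h.steps
  exact h2.ht (h1.ht hM)

theorem Root.ren' {M N : Tm} (h : Root M N) (r : ℕ → ℕ) : Root (ren r M) (ren r N) := by
  cases h with
  | beta => rw [ren_substTm]; exact .beta ..
  | _ => constructor

theorem Root.sub' {M N : Tm} (h : Root M N) (s : ℕ → Tm) : Root (sub s M) (sub s N) := by
  cases h with
  | beta => rw [sub_substTm]; exact .beta ..
  | _ => constructor

theorem Par.ren' {M N : Tm} (h : Par M N) (r : ℕ → ℕ) : Par (ren r M) (ren r N) := by
  induction h generalizing r with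
  | var n => exact .var _
  | const c => exact .const c
  | app _ _ h1 h2 => exact .app (h1 r) (h2 r)
  | lam σ _ h => exact .lam σ (h _)
  | root _ _ h h1 h2 => exact .root (h1 r) (h2 r) (h.ren' r)

theorem Par.sub' {M N : Tm} (h : Par M N) {s s' : ℕ → Tm} (hs : ∀ n, Par (s n) (s' n)) :
    Par (sub s M) (sub s' N) := by
  induction h generalizing s s' with
  | var n => exact hs n
  | const c => exact .const c
  | app _ _ h1 h2 => exact .app (h1 hs) (h2 hs)
  | lam σ _ h =>
    refine .lam σ (h fun n => ?_)
    cases n with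
    | zero => exact .var 0
    | succ n => exact (hs n).ren' _
  | root _ _ h h1 h2 => exact .root (h1 hs) (h2 hs) (h.sub' s')

theorem Par.subst {M M' N N' : Tm} (h : Par M M') (h' : Par N N') :
    Par (substTm M 0 N) (substTm M' 0 N') := by
  rw [substTm_zero, substTm_zero]
  refine h.sub' fun n => ?_
  cases n with
  | zero => exact h'
  | succ n => exact .var n

theorem par_pc0 {s t r s' t' : TyExpr} {x y z y' x0 : Tm} {z' : Tm}
    (hx : Par x (.app (.const (.czero s' t')) x0)) (hy : Par y y') (hz : Par z z') :
    Par (.app (.app (.app (.const (.cpcase s t r)) x) y) z) y' :=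
  .root (.app (.app (.rfl' _) hx) hy) hz (.pcaseZero ..)

theorem par_pc1 {s t r s' t' : TyExpr} {x y z y' x0 : Tm} {z' : Tm}
    (hx : Par x (.app (.const (.cone s' t')) x0)) (hy : Par y y') (hz : Par z z') :
    Par (.app (.app (.app (.const (.cpcase s t r)) x) y) z) z' :=
  .root (.app (.app (.rfl' _) hx) hy) hz (.pcaseOne ..)

theorem par_pc {s t r : TyExpr} {x y z x' y' z' : Tm}
    (hx : Par x x') (hy : Par y y') (hz : Par z z') :
    Par (.app (.app (.app (.const (.cpcase s t r)) x) y) z)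
      (.app (.app (.app (.const (.cpcase s t r)) x') y') z') :=
  .app (.app (.app (.rfl' _) hx) hy) hz

def Pri (L K : Tm) : Prop :=
  (∀ s t r s' t' x y z, L = .app (.app (.app (.const (.cpcase s t r))
      (.app (.const (.czero s' t')) x)) y) z → K = y) ∧
  (∀ s t r s' t' x y z, L = .app (.app (.app (.const (.cpcase s t r))
      (.app (.const (.cone s' t')) x)) y) z → K = z)

theorem Root.pri {L N : Tm} (h : Root L N) : ∃ K, Root L K ∧ Pri L K := by
  by_cases h0 : ∃ s t r s' t' x y z, L = .app (.app (.app (.const (.cpcase s t r))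
      (.app (.const (.czero s' t')) x)) y) z
  · obtain ⟨s, t, r, s', t', x, y, z, rfl⟩ := h0
    refine ⟨y, .pcaseZero .., ?_, ?_⟩
    · intro s t r s' t' x y z h; cases h; rfl
    · intro s t r s' t' x y z h; cases h
  by_cases h1 : ∃ s t r s' t' x y z, L = .app (.app (.app (.const (.cpcase s t r))
      (.app (.const (.cone s' t')) x)) y) z
  · obtain ⟨s, t, r, s', t', x, y, z, rfl⟩ := h1
    refine ⟨z, .pcaseOne .., ?_, ?_⟩
    · intro s t r s' t' x y z h; cases h
    · intro s t r s' t' x y z h; cases h; rfl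
  refine ⟨N, h, ?_, ?_⟩
  · intro s t r s' t' x y z h; exact absurd ⟨s, t, r, s', t', x, y, z, h⟩ h0
  · intro s t r s' t' x y z h; exact absurd ⟨s, t, r, s', t', x, y, z, h⟩ h1

theorem Par.lam_inv {σ : TyExpr} {M N : Tm} (h : Par (.lam σ M) N) :
    ∃ M', N = .lam σ M' ∧ Par M M' := by
  cases h with | lam _ h => exact ⟨_, rfl, h⟩

theorem Par.zero_inv {s t : TyExpr} {x N : Tm} (h : Par (.app (.const (.czero s t)) x) N) :
    ∃ s' t' x', N = .app (.const (.czero s' t')) x' ∧ TyEquiv s s' ∧ TyEquiv t t' ∧ Par x x' := by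
  cases h with
  | app h1 h2 => cases h1 with | const h1 => cases h1 with | zero h3 h4 =>
    exact ⟨_, _, _, rfl, h3, h4, h2⟩
  | root h1 h2 h3 => cases h1 with | const h1 => cases h1; cases h3

theorem Par.one_inv {s t : TyExpr} {x N : Tm} (h : Par (.app (.const (.cone s t)) x) N) :
    ∃ s' t' x', N = .app (.const (.cone s' t')) x' ∧ TyEquiv s s' ∧ TyEquiv t t' ∧ Par x x' := by
  cases h with
  | app h1 h2 => cases h1 with | const h1 => cases h1 with | one h3 h4 =>
    exact ⟨_, _, _, rfl, h3, h4, h2⟩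
  | root h1 h2 h3 => cases h1 with | const h1 => cases h1; cases h3

theorem Par.pair_inv {s t : TyExpr} {x y N : Tm}
    (h : Par (.app (.app (.const (.cpair s t)) x) y) N) :
    ∃ s' t' x' y', N = .app (.app (.const (.cpair s' t')) x') y' ∧ TyEquiv s s' ∧ TyEquiv t t' ∧
      Par x x' ∧ Par y y' := by
  have key : ∀ N, Par (.app (.const (.cpair s t)) x) N → ∃ s' t' x',
      N = .app (.const (.cpair s' t')) x' ∧ TyEquiv s s' ∧ TyEquiv t t' ∧ Par x x' := by
    intro N h
    cases h with
    | app h1 h2 => cases h1 with | const h1 => cases h1 with | pair h3 h4 =>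
      exact ⟨_, _, _, rfl, h3, h4, h2⟩
    | root h1 h2 h3 => cases h1 with | const h1 => cases h1; cases h3
  cases h with
  | app h1 h2 =>
    obtain ⟨s', t', x', rfl, h3, h4, h5⟩ := key _ h1
    exact ⟨_, _, _, _, rfl, h3, h4, h5, h2⟩
  | root h1 h2 h3 =>
    obtain ⟨s', t', x', rfl, h3', h4, h5⟩ := key _ h1
    cases h3

theorem Par.case2_inv {s t r : TyExpr} {x y N : Tm}
    (h : Par (.app (.app (.const (.ccase s t r)) x) y) N) :
    ∃ x' y', N = .app (.app (.const (.ccase s t r)) x') y' ∧ Par x x' ∧ Par y y' := by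
  have key : ∀ N, Par (.app (.const (.ccase s t r)) x) N → ∃ x',
      N = .app (.const (.ccase s t r)) x' ∧ Par x x' := by
    intro N h
    cases h with
    | app h1 h2 => cases h1 with | const h1 => cases h1; exact ⟨_, rfl, h2⟩
    | root h1 h2 h3 => cases h1 with | const h1 => cases h1; cases h3
  cases h with
  | app h1 h2 =>
    obtain ⟨x', rfl, h5⟩ := key _ h1
    exact ⟨_, _, rfl, h5, h2⟩
  | root h1 h2 h3 =>
    obtain ⟨x', rfl, h5⟩ := key _ h1
    cases h3

theorem Par.pcase2_inv {s t r : TyExpr} {x y N : Tm}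
    (h : Par (.app (.app (.const (.cpcase s t r)) x) y) N) :
    ∃ x' y', N = .app (.app (.const (.cpcase s t r)) x') y' ∧ Par x x' ∧ Par y y' := by
  have key : ∀ N, Par (.app (.const (.cpcase s t r)) x) N → ∃ x',
      N = .app (.const (.cpcase s t r)) x' ∧ Par x x' := by
    intro N h
    cases h with
    | app h1 h2 => cases h1 with | const h1 => cases h1; exact ⟨_, rfl, h2⟩
    | root h1 h2 h3 => cases h1 with | const h1 => cases h1; cases h3
  cases h with
  | app h1 h2 =>
    obtain ⟨x', rfl, h5⟩ := key _ h1
    exact ⟨_, _, rfl, h5, h2⟩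
  | root h1 h2 h3 =>
    obtain ⟨x', rfl, h5⟩ := key _ h1
    cases h3

theorem Par.constapp {c : Const} {N : Tm} (h : Par (.const c) N) : ∃ d, N = .const d ∧ CEq c d := by
  cases h with | const h => exact ⟨_, rfl, h⟩

/-- The key step of the triangle property. -/
theorem tri_root {Γ : List TyExpr} {T : TyExpr} {P Q Ps Qs N : Tm} (hT : HT Γ (.app P Q) T)
    (hP : Par P Ps) (hQ : Par Q Qs) (h : Root (.app P Q) N) :
    (∃ K, Root (.app Ps Qs) K ∧ ∀ K, Root (.app Ps Qs) K → Pri (.app Ps Qs) K → Par N K) ∨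
    (∀ K, (∀ P0 Q0, Par P0 Ps → Par Q0 Qs → Par (.app P0 Q0) K) → Par N K) := by
  cases h with
  | beta σ A B =>
    obtain ⟨A', rfl, hA⟩ := hP.lam_inv
    refine .inl ⟨_, .beta .., fun K hK _ => ?_⟩
    cases hK; exact hA.subst hQ
  | caseZero =>
    obtain ⟨x', y', rfl, hx, hy⟩ := hP.case2_inv
    obtain ⟨_, _, x', rfl, _, _, hx⟩ := hx.zero_inv
    refine .inl ⟨_, .caseZero .., fun K hK _ => ?_⟩
    cases hK; exact .app hy hx
  | caseOne =>
    obtain ⟨x', y', rfl, hx, hy⟩ := hP.case2_inv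
    obtain ⟨_, _, x', rfl, _, _, hx⟩ := hx.one_inv
    refine .inl ⟨_, .caseOne .., fun K hK _ => ?_⟩
    cases hK; exact .app hQ hx
  | fstPair =>
    obtain ⟨d, rfl, hd⟩ := hP.constapp
    cases hd
    obtain ⟨_, _, x', y', rfl, _, _, hx, hy⟩ := hQ.pair_inv
    refine .inl ⟨_, .fstPair .., fun K hK _ => ?_⟩
    cases hK; exact hx
  | sndPair =>
    obtain ⟨d, rfl, hd⟩ := hP.constapp
    cases hd
    obtain ⟨_, _, x', y', rfl, _, _, hx, hy⟩ := hQ.pair_inv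
    refine .inl ⟨_, .sndPair .., fun K hK _ => ?_⟩
    cases hK; exact hy
  | pcaseZero =>
    obtain ⟨x', y', rfl, hx, hy⟩ := hP.pcase2_inv
    obtain ⟨_, _, x', rfl, _, _, hx⟩ := hx.zero_inv
    refine .inl ⟨_, .pcaseZero .., fun K hK hp => ?_⟩
    rw [hp.1 _ _ _ _ _ _ _ _ rfl]; exact hy
  | pcaseOne =>
    obtain ⟨x', y', rfl, hx, hy⟩ := hP.pcase2_inv
    obtain ⟨_, _, x', rfl, _, _, hx⟩ := hx.one_inv
    refine .inl ⟨_, .pcaseOne .., fun K hK hp => ?_⟩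
    rw [hp.2 _ _ _ _ _ _ _ _ rfl]; exact hQ
  | pcaseZZ s t r0 r1 s1 t1 s2 t2 x y z =>
    obtain ⟨_, hy0, hz0, _⟩ := hT.pcase_inv
    have e1 := hy0.zero_inv.2.sum_inv
    have e2 := hz0.zero_inv.2.sum_inv
    obtain ⟨x', y', rfl, hx, hy⟩ := hP.pcase2_inv
    obtain ⟨_, _, y', rfl, e3, e4, hy⟩ := hy.zero_inv
    obtain ⟨_, _, z', rfl, e5, e6, hz⟩ := hQ.zero_inv
    refine .inl ⟨_, .pcaseZZ .., fun K hK hp => ?_⟩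
    cases hK with
    | pcaseZero =>
      exact .app (.const (.zero (e1.1.symm'.trans' e3) (e1.2.symm'.trans' e4))) (par_pc0 hx hy hz)
    | pcaseOne =>
      exact .app (.const (.zero (e2.1.symm'.trans' e5) (e2.2.symm'.trans' e6))) (par_pc1 hx hy hz)
    | pcaseZZ => exact .app (.rfl' _) (par_pc hx hy hz)
  | pcaseOO s t r0 r1 s1 t1 s2 t2 x y z =>
    obtain ⟨_, hy0, hz0, _⟩ := hT.pcase_inv
    have e1 := hy0.one_inv.2.sum_inv
    have e2 := hz0.one_inv.2.sum_inv
    obtain ⟨x', y', rfl, hx, hy⟩ := hP.pcase2_inv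
    obtain ⟨_, _, y', rfl, e3, e4, hy⟩ := hy.one_inv
    obtain ⟨_, _, z', rfl, e5, e6, hz⟩ := hQ.one_inv
    refine .inl ⟨_, .pcaseOO .., fun K hK hp => ?_⟩
    cases hK with
    | pcaseZero =>
      exact .app (.const (.one (e1.1.symm'.trans' e3) (e1.2.symm'.trans' e4))) (par_pc0 hx hy hz)
    | pcaseOne =>
      exact .app (.const (.one (e2.1.symm'.trans' e5) (e2.2.symm'.trans' e6))) (par_pc1 hx hy hz)
    | pcaseOO => exact .app (.rfl' _) (par_pc hx hy hz)
  | pcasePair s t r0 r1 s1 t1 s2 t2 x y1 y2 z1 z2 =>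
    obtain ⟨_, hy0, hz0, _⟩ := hT.pcase_inv
    have e1 := hy0.pair_inv.2.2.prod_inv
    have e2 := hz0.pair_inv.2.2.prod_inv
    obtain ⟨x', y', rfl, hx, hy⟩ := hP.pcase2_inv
    obtain ⟨_, _, y1', y2', rfl, e3, e4, hy1, hy2⟩ := hy.pair_inv
    obtain ⟨_, _, z1', z2', rfl, e5, e6, hz1, hz2⟩ := hQ.pair_inv
    refine .inl ⟨_, .pcasePair .., fun K hK hp => ?_⟩
    cases hK with
    | pcaseZero =>
      exact .app (.app (.const (.pair (e1.1.symm'.trans' e3) (e1.2.symm'.trans' e4)))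
        (par_pc0 hx hy1 hz1)) (par_pc0 hx hy2 hz2)
    | pcaseOne =>
      exact .app (.app (.const (.pair (e2.1.symm'.trans' e5) (e2.2.symm'.trans' e6)))
        (par_pc1 hx hy1 hz1)) (par_pc1 hx hy2 hz2)
    | pcasePair => exact .app (.app (.rfl' _) (par_pc hx hy1 hz1)) (par_pc hx hy2 hz2)
  | pcaseArrow s t r1 r2 x y z w =>
    cases hP with
    | app h1 hz =>
      obtain ⟨x', y', rfl, hx, hy⟩ := h1.pcase2_inv
      refine .inl ⟨_, .pcaseArrow .., fun K hK _ => ?_⟩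
      cases hK; exact par_pc hx (.app hy hQ) (.app hz hQ)
    | root h1 hz h2 =>
      obtain ⟨x', y', rfl, hx, hy⟩ := h1.pcase2_inv
      refine .inr fun K hK => ?_
      cases h2 with
      | pcaseZero => exact par_pc0 hx (hK _ _ hy hQ) (.rfl' _)
      | pcaseOne => exact par_pc1 hx (.rfl' _) (hK _ _ hz hQ)

theorem triangle {Γ : List TyExpr} {T : TyExpr} {M : Tm} (hT : HT Γ M T) :
    ∃ K, Par M K ∧ ∀ N, Par M N → Par N K := by
  induction M generalizing Γ T with
  | var n => exact ⟨_, .rfl' _, fun N h => by cases h; exact .rfl' _⟩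
  | const c => exact ⟨_, .rfl' _, fun N h => by cases h with | const h => exact .const h.symm'⟩
  | lam σ M ih =>
    obtain ⟨τ, h1, _⟩ := hT.lam_inv
    obtain ⟨K, h2, h3⟩ := ih h1
    refine ⟨_, .lam σ h2, fun N h => ?_⟩
    cases h with | lam _ h => exact .lam σ (h3 _ h)
  | app P Q ih1 ih2 =>
    obtain ⟨τ, h1, h2⟩ := hT.app_inv
    obtain ⟨Ps, hP, hPs⟩ := ih1 h1
    obtain ⟨Qs, hQ, hQs⟩ := ih2 h2
    by_cases hR : ∃ K, Root (.app Ps Qs) K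
    · obtain ⟨K, hR⟩ := hR
      obtain ⟨K, hR, hp⟩ := hR.pri
      refine ⟨K, .root hP hQ hR, fun N h => ?_⟩
      cases h with
      | app h3 h4 => exact .root (hPs _ h3) (hQs _ h4) hR
      | root h3 h4 h5 =>
        rcases tri_root (.app (h3.ht h1) (h4.ht h2)) (hPs _ h3) (hQs _ h4) h5 with ⟨_, _, h6⟩ | h6
        · exact h6 _ hR hp
        · exact h6 _ fun P0 Q0 h7 h8 => .root h7 h8 hR
    · refine ⟨_, .app hP hQ, fun N h => ?_⟩
      cases h with
      | app h3 h4 => exact .app (hPs _ h3) (hQs _ h4)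
      | root h3 h4 h5 =>
        rcases tri_root (.app (h3.ht h1) (h4.ht h2)) (hPs _ h3) (hQs _ h4) h5 with ⟨K, h6, _⟩ | h6
        · exact absurd ⟨K, h6⟩ hR
        · exact h6 _ fun P0 Q0 h7 h8 => .app h7 h8

def Pars : Tm → Tm → Prop := Relation.ReflTransGen Par

theorem Pars.ht {Γ : List TyExpr} {M N : Tm} {T : TyExpr} (h : Pars M N) (hM : HT Γ M T) :
    HT Γ N T := by
  induction h with
  | refl => exact hM
  | tail _ h ih => exact h.ht ih

theorem Steps.pars {M N : Tm} (h : Steps M N) : Pars M N := by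
  induction h with
  | refl => exact .refl
  | tail _ h ih => exact ih.tail h.par

theorem Pars.steps {M N : Tm} (h : Pars M N) : ∃ N', Steps M N' ∧ Sim N' N := by
  induction h with
  | refl => exact ⟨_, .refl, .rfl' _⟩
  | tail _ h ih =>
    obtain ⟨A, h1, h2⟩ := ih
    obtain ⟨B, h3, h4⟩ := h.steps
    obtain ⟨C, h5, h6⟩ := h3.sim h2.symm'
    exact ⟨C, h1.trans h5, h6.symm'.trans' h4⟩

theorem strip {Γ : List TyExpr} {T : TyExpr} {M N1 N2 : Tm} (hT : HT Γ M T) (h1 : Pars M N1)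
    (h2 : Par M N2) : ∃ K, Par N1 K ∧ Pars N2 K := by
  induction h1 with
  | refl => exact ⟨_, h2, .refl⟩
  | tail h0 h ih =>
    obtain ⟨K, h3, h4⟩ := ih
    obtain ⟨K', _, h5⟩ := triangle (Pars.ht h0 hT)
    exact ⟨K', h5 _ h, h4.tail (h5 _ h3)⟩

theorem pars_confl {Γ : List TyExpr} {T : TyExpr} {M N1 N2 : Tm} (hT : HT Γ M T) (h1 : Pars M N1)
    (h2 : Pars M N2) : ∃ K, Pars N1 K ∧ Pars N2 K := by
  induction h2 with
  | refl => exact ⟨_, .refl, h1⟩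
  | tail h0 h ih =>
    obtain ⟨K, h3, h4⟩ := ih
    obtain ⟨K', h5, h6⟩ := strip (Pars.ht h0 hT) h4 h
    exact ⟨K', h3.tail h5, h6⟩

theorem confl {Γ : List TyExpr} {T : TyExpr} {M N1 N2 : Tm} (hT : HT Γ M T) (h1 : Steps M N1)
    (h2 : Steps M N2) : ∃ K1 K2, Steps N1 K1 ∧ Steps N2 K2 ∧ Sim K1 K2 := by
  obtain ⟨K, h3, h4⟩ := pars_confl hT h1.pars h2.pars
  obtain ⟨K1, h5, h6⟩ := h3.steps
  obtain ⟨K2, h7, h8⟩ := h4.steps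
  exact ⟨K1, K2, h5, h7, h6.trans' h8.symm'⟩

end RecLam


set_option autoImplicit false
set_option linter.all false

namespace RecLam

/-! ### Part D: direct approximants and stuck terms -/

def RootStable (P Q : Tm) : Prop :=
  ∀ P' Q', Steps P P' → Steps Q Q' → ∀ N, ¬ Root (.app P' Q') N

open Classical in
noncomputable def dir : Tm → Tm
  | .var n => .var n
  | .const c => .const c
  | .lam σ M => .lam σ (dir M)
  | .app P Q => if RootStable P Q then .app (dir P) (dir Q) else .const (.comega .void)

theorem dir_app {P Q : Tm} (h : RootStable P Q) : dir (.app P Q) = .app (dir P) (dir Q) := by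
  simp [dir, h]

theorem dir_pre (M : Tm) : TmPre (dir M) M := by
  induction M with
  | var n => exact .var n
  | const c => exact .const c
  | lam σ M ih => exact .lam σ ih
  | app P Q ih1 ih2 =>
    by_cases h : RootStable P Q
    · rw [dir_app h]; exact .app ih1 ih2
    · simp only [dir, h, if_false]; exact .omega _ _

theorem TmPre.rfl' (M : Tm) : TmPre M M := by
  induction M with
  | var n => exact .var n
  | const c => exact .const c
  | lam σ M ih => exact .lam σ ih
  | app P Q ih1 ih2 => exact .app ih1 ih2

theorem TmPre.trans' {A B C : Tm} (h : TmPre A B) (h' : TmPre B C) : TmPre A C := by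
  induction h generalizing C with
  | omega σ M => exact .omega _ _
  | var n => exact h'
  | const c => exact h'
  | app _ _ ih1 ih2 => cases h' with | app h3 h4 => exact .app (ih1 h3) (ih2 h4)
  | lam σ _ ih => cases h' with | lam _ h3 => exact .lam σ (ih h3)

theorem RootStable.steps {P Q P' Q' : Tm} (h : RootStable P Q) (h1 : Steps P P') (h2 : Steps Q Q') :
    RootStable P' Q' := fun _ _ h3 h4 => h _ _ (h1.trans h3) (h2.trans h4)

theorem Step.dir {M N : Tm} (h : Step M N) : TmPre (dir M) (dir N) := by
  induction M generalizing N with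
  | var n => cases h
  | const c => cases h
  | lam σ M ih => cases h with | lamC _ h => exact .lam σ (ih h)
  | app P Q ih1 ih2 =>
    by_cases hs : RootStable P Q
    · rw [dir_app hs]
      rcases step_app_inv h with h0 | ⟨P', h0, rfl⟩ | ⟨Q', h0, rfl⟩
      · exact absurd h0 (hs _ _ .refl .refl _)
      · rw [dir_app (hs.steps (.single h0) .refl)]; exact .app (ih1 h0) (.rfl' _)
      · rw [dir_app (hs.steps .refl (.single h0))]; exact .app (.rfl' _) (ih2 h0)
    · simp only [RecLam.dir, hs, if_false]; exact .omega _ _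

theorem Steps.dir {M N : Tm} (h : Steps M N) : TmPre (dir M) (dir N) := by
  induction h with
  | refl => exact .rfl' _
  | tail _ h ih => exact ih.trans' h.dir

theorem Root.pre {A M N : Tm} (h : Root A N) (hs : TmPre A M) : ∃ N', Root M N' := by
  cases h with
  | beta σ A B =>
    cases hs with | app h1 h2 => cases h1 with | lam _ h1 => exact ⟨_, .beta ..⟩
  | caseZero =>
    cases hs with | app h1 hz => cases h1 with | app h1 hy => cases h1 with | app h1 hx =>
    cases h1; cases hx with | app h2 hx => cases h2; exact ⟨_, .caseZero ..⟩
  | caseOne =>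
    cases hs with | app h1 hz => cases h1 with | app h1 hy => cases h1 with | app h1 hx =>
    cases h1; cases hx with | app h2 hx => cases h2; exact ⟨_, .caseOne ..⟩
  | fstPair =>
    cases hs with | app h1 h2 => cases h1; cases h2 with | app h1 hy =>
    cases h1 with | app h1 hx => cases h1; exact ⟨_, .fstPair ..⟩
  | sndPair =>
    cases hs with | app h1 h2 => cases h1; cases h2 with | app h1 hy =>
    cases h1 with | app h1 hx => cases h1; exact ⟨_, .sndPair ..⟩
  | pcaseZero =>
    cases hs with | app h1 hz => cases h1 with | app h1 hy => cases h1 with | app h1 hx =>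
    cases h1; cases hx with | app h2 hx => cases h2; exact ⟨_, .pcaseZero ..⟩
  | pcaseOne =>
    cases hs with | app h1 hz => cases h1 with | app h1 hy => cases h1 with | app h1 hx =>
    cases h1; cases hx with | app h2 hx => cases h2; exact ⟨_, .pcaseOne ..⟩
  | pcaseZZ =>
    cases hs with | app h1 hz => cases h1 with | app h1 hy => cases h1 with | app h1 hx =>
    cases h1; cases hy with | app h2 hy => cases h2; cases hz with | app h2 hz => cases h2; exact ⟨_, .pcaseZZ ..⟩
  | pcaseOO =>
    cases hs with | app h1 hz => cases h1 with | app h1 hy => cases h1 with | app h1 hx =>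
    cases h1; cases hy with | app h2 hy => cases h2; cases hz with | app h2 hz => cases h2; exact ⟨_, .pcaseOO ..⟩
  | pcasePair =>
    cases hs with | app h1 hz => cases h1 with | app h1 hy => cases h1 with | app h1 hx =>
    cases h1; cases hy with | app h2 hy2 => cases h2 with | app h2 hy1 =>
    cases h2; cases hz with | app h2 hz2 => cases h2 with | app h2 hz1 =>
    cases h2; exact ⟨_, .pcasePair ..⟩
  | pcaseArrow =>
    cases hs with | app h1 hw => cases h1 with | app h1 hz => cases h1 with | app h1 hy =>
    cases h1 with | app h1 hx => cases h1; exact ⟨_, .pcaseArrow ..⟩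

theorem dir_normal (M : Tm) : Normal (dir M) := by
  induction M with
  | var n => intro N h; cases h
  | const c => intro N h; cases h
  | lam σ M ih => intro N h; cases h with | lamC _ h => exact ih _ h
  | app P Q ih1 ih2 =>
    intro N h
    by_cases hs : RootStable P Q
    · rw [dir_app hs] at h
      rcases step_app_inv h with h0 | ⟨P', h0, rfl⟩ | ⟨Q', h0, rfl⟩
      · obtain ⟨N', h1⟩ := h0.pre (TmPre.app (dir_pre P) (dir_pre Q))
        exact hs _ _ .refl .refl _ h1
      · exact ih1 _ h0
      · exact ih2 _ h0
    · simp only [RecLam.dir, hs, if_false] at h; cases h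

theorem dir_approx (M : Tm) : DirApprox (dir M) M :=
  ⟨dir_normal M, fun N h => (Steps.dir h).trans' (dir_pre N)⟩

theorem rootStable_ren {P Q : Tm} (r : ℕ → ℕ) :
    RootStable (ren r P) (ren r Q) ↔ RootStable P Q := by
  constructor
  · intro h P' Q' h1 h2 N h3
    exact h _ _ (Steps.ren' h1 r) (Steps.ren' h2 r) _ (h3.ren' r)
  · intro h P' Q' h1 h2 N h3
    obtain ⟨P', h4, rfl⟩ := Steps.ren_inv h1
    obtain ⟨Q', h5, rfl⟩ := Steps.ren_inv h2
    obtain ⟨N', h6, _⟩ := Root.ren_inv (M := .app P' Q') h3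
    exact h _ _ h4 h5 _ h6

theorem dir_ren (r : ℕ → ℕ) (M : Tm) : dir (ren r M) = ren r (dir M) := by
  induction M generalizing r with
  | var n => rfl
  | const c => rfl
  | lam σ M ih => simp only [ren, dir, ih]
  | app P Q ih1 ih2 =>
    by_cases hs : RootStable P Q
    · rw [dir_app hs]; simp only [ren]; rw [dir_app ((rootStable_ren r).2 hs), ih1, ih2]
    · simp only [ren, dir, rootStable_ren, hs, if_false]

theorem RootStable.sim {P Q P' Q' : Tm} (h : RootStable P Q) (h1 : Sim P P') (h2 : Sim Q Q') :
    RootStable P' Q' := by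
  intro P'' Q'' h3 h4 N h5
  obtain ⟨A, h6, h7⟩ := Steps.sim h3 h1.symm'
  obtain ⟨B, h8, h9⟩ := Steps.sim h4 h2.symm'
  obtain ⟨C, h10, _⟩ := h5.sim (.app h7 h9)
  exact h _ _ h6 h8 _ h10

theorem Sim.dir {M N : Tm} (h : Sim M N) : Sim (dir M) (dir N) := by
  induction h with
  | var n => exact .var n
  | const c => exact .const c
  | lam σ _ h => exact .lam σ h
  | @app M M' N N' h1 h2 ih1 ih2 =>
    by_cases hs : RootStable M N
    · rw [dir_app hs, dir_app (hs.sim h1 h2)]; exact .app ih1 ih2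
    · have : ¬ RootStable M' N' := fun h => hs (h.sim h1.symm' h2.symm')
      simp only [RecLam.dir, hs, this, if_false]; exact .rfl' _

theorem HT.dir {Γ : List TyExpr} {M : Tm} {T : TyExpr} (h : HT Γ M T) : HT Γ (dir M) T :=
  (dir_pre M).ht h

/-- (Partial) values. -/
inductive Val : Tm → Prop
  | lam (σ : TyExpr) (M : Tm) : Val (.lam σ M)
  | const (c : Const) : Val (.const c)
  | zero (s t : TyExpr) (x : Tm) : Val (.app (.const (.czero s t)) x)
  | one (s t : TyExpr) (x : Tm) : Val (.app (.const (.cone s t)) x)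
  | pair1 (s t : TyExpr) (x : Tm) : Val (.app (.const (.cpair s t)) x)
  | case1 (s t r : TyExpr) (x : Tm) : Val (.app (.const (.ccase s t r)) x)
  | pcase1 (s t r : TyExpr) (x : Tm) : Val (.app (.const (.cpcase s t r)) x)
  | pair2 (s t : TyExpr) (x y : Tm) : Val (.app (.app (.const (.cpair s t)) x) y)
  | case2 (s t r : TyExpr) (x y : Tm) : Val (.app (.app (.const (.ccase s t r)) x) y)
  | pcase2 (s t r : TyExpr) (x y : Tm) : Val (.app (.app (.const (.cpcase s t r)) x) y)
  | pcase3 (s t r r' : TyExpr) (x y z : Tm) :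
      Val (.app (.app (.app (.const (.cpcase s t (.arrow r r'))) x) y) z)

theorem Val.app {M N : Tm} (h : Val (.app M N)) : Val M := by
  cases h <;> constructor

theorem Root.val {M N K : Tm} (h : Root (.app M N) K) : Val M := by
  cases h <;> constructor

theorem Val.sim {M N : Tm} (h : Val M) (hs : Sim M N) : Val N := by
  cases h with
  | lam => cases hs; constructor
  | const => cases hs; constructor
  | pair2 => cases hs with | app h1 h2 => cases h1 with | app h1 h3 => cases h1 with | const h1 => cases h1; constructor
  | case2 => cases hs with | app h1 h2 => cases h1 with | app h1 h3 => cases h1 with | const h1 => cases h1; constructor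
  | pcase2 => cases hs with | app h1 h2 => cases h1 with | app h1 h3 => cases h1 with | const h1 => cases h1; constructor
  | pcase3 => cases hs with | app h1 h2 => cases h1 with | app h1 h3 => cases h1 with | app h1 h4 => cases h1 with | const h1 => cases h1; constructor
  | _ => cases hs with | app h1 h2 => cases h1 with | const h1 => cases h1; constructor

theorem Val.ren_inv {M : Tm} {r : ℕ → ℕ} (h : Val (ren r M)) : Val M := by
  generalize hL : ren r M = L at h
  cases h with
  | lam => obtain ⟨P, rfl, _⟩ := ren_eq_lam hL; constructor
  | const => cases ren_eq_const hL; constructor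
  | pair2 =>
    obtain ⟨P1, Q1, rfl, h1, _⟩ := ren_eq_app hL
    obtain ⟨P2, Q2, rfl, h2, _⟩ := ren_eq_app h1
    cases ren_eq_const h2; constructor
  | case2 =>
    obtain ⟨P1, Q1, rfl, h1, _⟩ := ren_eq_app hL
    obtain ⟨P2, Q2, rfl, h2, _⟩ := ren_eq_app h1
    cases ren_eq_const h2; constructor
  | pcase2 =>
    obtain ⟨P1, Q1, rfl, h1, _⟩ := ren_eq_app hL
    obtain ⟨P2, Q2, rfl, h2, _⟩ := ren_eq_app h1
    cases ren_eq_const h2; constructor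
  | pcase3 =>
    obtain ⟨P1, Q1, rfl, h1, _⟩ := ren_eq_app hL
    obtain ⟨P2, Q2, rfl, h2, _⟩ := ren_eq_app h1
    obtain ⟨P3, Q3, rfl, h3, _⟩ := ren_eq_app h2
    cases ren_eq_const h3; constructor
  | _ =>
    obtain ⟨P1, Q1, rfl, h1, _⟩ := ren_eq_app hL
    cases ren_eq_const h1; constructor

def Stuck (M : Tm) : Prop := ∀ M', Steps M M' → ¬ Val M' ∧ ∀ N, ¬ Root M' N

theorem Stuck.steps {M N : Tm} (h : Stuck M) (hs : Steps M N) : Stuck N :=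
  fun _ h1 => h _ (hs.trans h1)

theorem Stuck.sim {M N : Tm} (h : Stuck M) (hs : Sim M N) : Stuck N := by
  intro M' h1
  obtain ⟨K, h2, h3⟩ := Steps.sim h1 hs.symm'
  obtain ⟨h4, h5⟩ := h _ h2
  refine ⟨fun hv => h4 (hv.sim h3), fun L hL => ?_⟩
  obtain ⟨L', h6, _⟩ := hL.sim h3
  exact h5 _ h6

theorem Stuck.ren' {M : Tm} (h : Stuck M) (r : ℕ → ℕ) : Stuck (ren r M) := by
  intro M' h1
  obtain ⟨K, h2, rfl⟩ := Steps.ren_inv h1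
  obtain ⟨h4, h5⟩ := h _ h2
  refine ⟨fun hv => h4 hv.ren_inv, fun L hL => ?_⟩
  obtain ⟨L', h6, _⟩ := hL.ren_inv
  exact h5 _ h6

theorem stuck_var (n : ℕ) : Stuck (.var n) := by
  intro M' h
  have : M' = .var n := by
    induction h with
    | refl => rfl
    | tail _ h ih => subst ih; cases h
  subst this
  exact ⟨fun h => (by cases h), fun N h => (by cases h)⟩

theorem RootStable.steps_app {P Q K : Tm} (h : RootStable P Q) (hs : Steps (.app P Q) K) :
    ∃ P' Q', K = .app P' Q' ∧ Steps P P' ∧ Steps Q Q' := by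
  induction hs with
  | refl => exact ⟨_, _, rfl, .refl, .refl⟩
  | tail _ h1 ih =>
    obtain ⟨P', Q', rfl, h2, h3⟩ := ih
    rcases step_app_inv h1 with h0 | ⟨P'', h0, rfl⟩ | ⟨Q'', h0, rfl⟩
    · exact absurd h0 (h _ _ h2 h3 _)
    · exact ⟨_, _, rfl, h2.tail h0, h3⟩
    · exact ⟨_, _, rfl, h2, h3.tail h0⟩

theorem Stuck.rootStable {M : Tm} (h : Stuck M) (P : Tm) : RootStable M P :=
  fun _ _ h1 _ _ h3 => (h _ h1).1 h3.val

theorem Stuck.app {M : Tm} (h : Stuck M) (P : Tm) : Stuck (.app M P) := by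
  intro K hK
  obtain ⟨M', P', rfl, h1, h2⟩ := (h.rootStable P).steps_app hK
  exact ⟨fun hv => (h _ h1).1 hv.app, (h.rootStable P) _ _ h1 h2⟩

theorem Steps.const_eq {c : Const} {N : Tm} (h : Steps (.const c) N) : N = .const c := by
  induction h with
  | refl => rfl
  | tail _ h ih => subst ih; cases h

/-- `const c` applied to one argument is stable for non-projections. -/
theorem rs_const {c : Const} (x : Tm) (h1 : ∀ s t, c ≠ .cfst s t) (h2 : ∀ s t, c ≠ .csnd s t) :
    RootStable (.const c) x := by
  intro P' Q' h3 h4 N h5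
  cases Steps.const_eq h3
  cases h5 with
  | fstPair => exact h1 _ _ rfl
  | sndPair => exact h2 _ _ rfl

theorem rs_const2 {c : Const} (x y : Tm) (h1 : ∀ s t, c ≠ .cfst s t) (h2 : ∀ s t, c ≠ .csnd s t) :
    RootStable (.app (.const c) x) y := by
  intro P' Q' h3 h4 N h5
  obtain ⟨A, B, rfl, h6, h7⟩ := (rs_const x h1 h2).steps_app h3
  cases Steps.const_eq h6
  cases h5

theorem rs_case {s t r : TyExpr} {x y z : Tm} (h : Stuck x) :
    RootStable (.app (.app (.const (.ccase s t r)) x) y) z := by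
  intro P' Q' h3 h4 N h5
  obtain ⟨A, B, rfl, h6, h7⟩ := (rs_const2 x y (by simp) (by simp)).steps_app h3
  obtain ⟨A', B', rfl, h8, h9⟩ := (rs_const x (by simp) (by simp)).steps_app h6
  cases Steps.const_eq h8
  cases h5 with
  | caseZero => exact (h _ h9).1 (.zero ..)
  | caseOne => exact (h _ h9).1 (.one ..)

theorem stuck_case {s t r : TyExpr} {x y z : Tm} (h : Stuck x) :
    Stuck (.app (.app (.app (.const (.ccase s t r)) x) y) z) := by
  intro K hK
  have hr : RootStable (.app (.app (.const (.ccase s t r)) x) y) z := rs_case h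
  obtain ⟨M', P', rfl, h1, h2⟩ := hr.steps_app hK
  refine ⟨fun hv => ?_, hr _ _ h1 h2⟩
  obtain ⟨A, B, rfl, h6, h7⟩ := (rs_const2 x y (by simp) (by simp)).steps_app h1
  obtain ⟨A', B', rfl, h8, h9⟩ := (rs_const x (by simp) (by simp)).steps_app h6
  cases Steps.const_eq h8
  cases hv

theorem rs_fst {s t : TyExpr} {x : Tm} (h : Stuck x) : RootStable (.const (.cfst s t)) x := by
  intro P' Q' h3 h4 N h5
  cases Steps.const_eq h3
  cases h5 with
  | fstPair => exact (h _ h4).1 (.pair2 ..)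

theorem rs_snd {s t : TyExpr} {x : Tm} (h : Stuck x) : RootStable (.const (.csnd s t)) x := by
  intro P' Q' h3 h4 N h5
  cases Steps.const_eq h3
  cases h5 with
  | sndPair => exact (h _ h4).1 (.pair2 ..)

theorem stuck_fst {s t : TyExpr} {x : Tm} (h : Stuck x) : Stuck (.app (.const (.cfst s t)) x) := by
  intro K hK
  have hr : RootStable (.const (.cfst s t)) x := rs_fst h
  obtain ⟨M', P', rfl, h1, h2⟩ := hr.steps_app hK
  refine ⟨fun hv => ?_, hr _ _ h1 h2⟩
  cases Steps.const_eq h1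
  cases hv

theorem stuck_snd {s t : TyExpr} {x : Tm} (h : Stuck x) : Stuck (.app (.const (.csnd s t)) x) := by
  intro K hK
  have hr : RootStable (.const (.csnd s t)) x := rs_snd h
  obtain ⟨M', P', rfl, h1, h2⟩ := hr.steps_app hK
  refine ⟨fun hv => ?_, hr _ _ h1 h2⟩
  cases Steps.const_eq h1
  cases hv

/-- A `pcase` none of whose reducts is a root redex, with non-arrow subscript, is stuck. -/
theorem stuck_pcase {s t r : TyExpr} {x y z : Tm} (hr0 : ∀ a b, r ≠ .arrow a b)
    (hr : RootStable (.app (.app (.const (.cpcase s t r)) x) y) z) :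
    Stuck (.app (.app (.app (.const (.cpcase s t r)) x) y) z) := by
  intro K hK
  obtain ⟨M', P', rfl, h1, h2⟩ := hr.steps_app hK
  refine ⟨fun hv => ?_, hr _ _ h1 h2⟩
  obtain ⟨A, B, rfl, h6, h7⟩ := (rs_const2 x y (by simp) (by simp)).steps_app h1
  obtain ⟨A', B', rfl, h8, h9⟩ := (rs_const x (by simp) (by simp)).steps_app h6
  cases Steps.const_eq h8
  cases hv
  exact hr0 _ _ rfl

theorem steps_zero {s t : TyExpr} {x N : Tm} (h : Steps (.app (.const (.czero s t)) x) N) :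
    ∃ x', N = .app (.const (.czero s t)) x' ∧ Steps x x' := by
  obtain ⟨A, B, rfl, h6, h7⟩ := (rs_const x (by simp) (by simp)).steps_app h
  cases Steps.const_eq h6
  exact ⟨_, rfl, h7⟩

theorem steps_one {s t : TyExpr} {x N : Tm} (h : Steps (.app (.const (.cone s t)) x) N) :
    ∃ x', N = .app (.const (.cone s t)) x' ∧ Steps x x' := by
  obtain ⟨A, B, rfl, h6, h7⟩ := (rs_const x (by simp) (by simp)).steps_app h
  cases Steps.const_eq h6
  exact ⟨_, rfl, h7⟩

theorem steps_pair {s t : TyExpr} {x y N : Tm}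
    (h : Steps (.app (.app (.const (.cpair s t)) x) y) N) :
    ∃ x' y', N = .app (.app (.const (.cpair s t)) x') y' ∧ Steps x x' ∧ Steps y y' := by
  obtain ⟨A, B, rfl, h6, h7⟩ := (rs_const2 x y (by simp) (by simp)).steps_app h
  obtain ⟨A', B', rfl, h8, h9⟩ := (rs_const x (by simp) (by simp)).steps_app h6
  cases Steps.const_eq h8
  exact ⟨_, _, rfl, h9, h7⟩

end RecLam


set_option autoImplicit false
set_option linter.all false

namespace RecLam

/-! ### Part E: semantics -/

abbrev car (σ : TyExpr) : Set Pm := (tyInterp σ).carrier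
abbrev El (σ : TyExpr) (d : Set Pm) : Prop := (tyInterp σ).IsElem d
abbrev GoodL (σ : TyExpr) (X : List Pm) : Prop := goodList (tyInterp σ) X
abbrev dn (σ : TyExpr) (X : List Pm) : Set Pm := downListP (tyInterp σ) X

theorem GoodL_iff {σ : TyExpr} {X : List Pm} : GoodL σ X ↔ (∀ x ∈ X, x ∈ car σ) ∧ gl X :=
  (nice_ty σ).goodList X

theorem El_iff {σ : TyExpr} {d : Set Pm} : El σ d ↔ d ⊆ car σ ∧
    (∀ a b : Pm, a ∈ car σ → pmLe a b → b ∈ d → a ∈ d) ∧ ∀ a ∈ d, ∀ b ∈ d, pmCon a b := by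
  unfold El PData.IsElem
  constructor
  · rintro ⟨h1, h2, h3⟩
    exact ⟨h1, fun a b ha hl hb => h2 a b (((nice_ty σ).le _ _).2 ⟨ha, h1 hb, hl⟩) hb,
      fun a ha b hb => (((nice_ty σ).con _ _).1 (h3 a ha b hb)).2.2⟩
  · rintro ⟨h1, h2, h3⟩
    refine ⟨h1, fun a b hl hb => ?_, fun a ha b hb => ?_⟩
    · obtain ⟨h4, h5, h6⟩ := ((nice_ty σ).le _ _).1 hl
      exact h2 a b h4 h6 hb
    · exact ((nice_ty σ).con _ _).2 ⟨h1 ha, h1 hb, h3 a ha b hb⟩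

theorem mem_dn {σ : TyExpr} {X : List Pm} {a : Pm} :
    a ∈ dn σ X ↔ a ∈ car σ ∧ ∃ x ∈ X, x ∈ car σ ∧ pmLe a x := by
  unfold dn downListP
  constructor
  · rintro ⟨x, hx, hl⟩
    obtain ⟨h1, h2, h3⟩ := ((nice_ty σ).le _ _).1 hl
    exact ⟨h1, x, hx, h2, h3⟩
  · rintro ⟨h1, x, hx, h2, h3⟩
    exact ⟨x, hx, ((nice_ty σ).le _ _).2 ⟨h1, h2, h3⟩⟩

theorem pmCon_down2 {a a' b b' : Pm} (h : pmLe a' a) (h' : pmLe b' b) (hc : pmCon a b) :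
    pmCon a' b' :=
  pmCon_comm.1 (pmCon_down h' (pmCon_comm.1 (pmCon_down h hc)))

theorem El_dn {σ : TyExpr} {X : List Pm} (h : ∀ x ∈ X, ∀ y ∈ X, pmCon x y) : El σ (dn σ X) := by
  rw [El_iff]
  refine ⟨fun a ha => (mem_dn.1 ha).1, fun a b ha hl hb => ?_, fun a ha b hb => ?_⟩
  · obtain ⟨_, x, hx, h2, h3⟩ := mem_dn.1 hb
    exact mem_dn.2 ⟨ha, x, hx, h2, pmLe_trans hl h3⟩
  · obtain ⟨_, x, hx, h2, h3⟩ := mem_dn.1 ha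
    obtain ⟨_, y, hy, h4, h5⟩ := mem_dn.1 hb
    exact pmCon_down2 h3 h5 (h x hx y hy)

theorem El_GoodL {σ : TyExpr} {X : List Pm} (h : GoodL σ X) : El σ (dn σ X) :=
  El_dn fun x hx y hy => ((GoodL_iff.1 h).2 x hx y hy).1

theorem mem_dn_self {σ : TyExpr} {X : List Pm} {x : Pm} (hx : x ∈ X) (h : x ∈ car σ) :
    x ∈ dn σ X := mem_dn.2 ⟨h, x, hx, h, pmLe_refl x⟩

theorem mem_sum_stag {s t : TyExpr} (b : Bool) : Pm.stag b ∈ car (.sum s t) := by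
  unfold car; rw [tyInterp_sum]; cases b <;> simp [sumP, sumSideP]
theorem mem_sum_spr {s t : TyExpr} {b : Bool} {a : Pm} :
    Pm.spr b a ∈ car (.sum s t) ↔ a ∈ car (if b then t else s) := by
  unfold car; rw [tyInterp_sum]; cases b <;> simp [sumP, sumSideP]
theorem mem_sum {s t : TyExpr} {p : Pm} (h : p ∈ car (.sum s t)) :
    ∃ b, p = .stag b ∨ ∃ a ∈ car (if b then t else s), p = .spr b a := by
  unfold car at h; rw [tyInterp_sum] at h
  rcases h with h | h
  · exact ⟨false, h⟩
  · exact ⟨true, h⟩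
theorem mem_prod_ppr {s t : TyExpr} {b : Bool} {a : Pm} :
    Pm.ppr b a ∈ car (.prod s t) ↔ a ∈ car (if b then t else s) := by
  unfold car; rw [tyInterp_prod]; cases b <;> simp [prodP]
theorem mem_prod {s t : TyExpr} {p : Pm} (h : p ∈ car (.prod s t)) :
    ∃ b, ∃ a ∈ car (if b then t else s), p = .ppr b a := by
  unfold car at h; rw [tyInterp_prod] at h
  rcases h with h | h
  · exact ⟨false, h⟩
  · exact ⟨true, h⟩
theorem mem_arrow_fn {s t : TyExpr} {X : List Pm} {a : Pm} :
    Pm.fn X a ∈ car (.arrow s t) ↔ GoodL s X ∧ a ∈ car t := by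
  unfold car; rw [tyInterp_arrow]
  constructor
  · rintro ⟨Y, b, h, h1, h2⟩; cases h; exact ⟨h1, h2⟩
  · rintro ⟨h1, h2⟩; exact ⟨X, a, rfl, h1, h2⟩
theorem mem_arrow {s t : TyExpr} {p : Pm} (h : p ∈ car (.arrow s t)) :
    ∃ X a, p = .fn X a ∧ GoodL s X ∧ a ∈ car t := by
  unfold car at h; rw [tyInterp_arrow] at h
  exact h

theorem antichain (X : List Pm) : ∃ Y : List Pm, (∀ y ∈ Y, y ∈ X) ∧ (∀ x ∈ X, ∃ y ∈ Y, pmLe x y) ∧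
    ∀ x ∈ Y, ∀ y ∈ Y, pmLe x y → x = y := by
  classical
  induction X with
  | nil => exact ⟨[], by simp⟩
  | cons a X ih =>
    obtain ⟨Y, h1, h2, h3⟩ := ih
    by_cases h : ∃ y ∈ Y, pmLe a y
    · refine ⟨Y, fun y hy => List.mem_cons_of_mem _ (h1 y hy), fun x hx => ?_, h3⟩
      rcases List.mem_cons.1 hx with rfl | hx
      · exact h
      · exact h2 x hx
    · push Not at h
      refine ⟨a :: Y.filter fun y => ¬ pmLe y a, ?_, ?_, ?_⟩
      · intro y hy
        rcases List.mem_cons.1 hy with rfl | hy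
        · exact List.mem_cons_self
        · exact List.mem_cons_of_mem _ (h1 y (List.mem_filter.1 hy).1)
      · intro x hx
        rcases List.mem_cons.1 hx with rfl | hx
        · exact ⟨_, List.mem_cons_self, pmLe_refl _⟩
        · obtain ⟨y, hy, hl⟩ := h2 x hx
          by_cases hya : pmLe y a
          · exact ⟨a, List.mem_cons_self, pmLe_trans hl hya⟩
          · exact ⟨y, List.mem_cons_of_mem _ (List.mem_filter.2 ⟨hy, by simpa using hya⟩), hl⟩
      · intro x hx y hy hl
        rcases List.mem_cons.1 hx with rfl | hx <;> rcases List.mem_cons.1 hy with rfl | hy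
        · rfl
        · exact absurd hl (h y (List.mem_filter.1 hy).1)
        · have := (List.mem_filter.1 hx).2
          simp at this; exact absurd hl this
        · exact h3 x (List.mem_filter.1 hx).1 y (List.mem_filter.1 hy).1 hl

/-- A finite subset of an element is dominated by a good list of the element. -/
theorem El.pick {σ : TyExpr} {d : Set Pm} (h : El σ d) (X : List Pm) (hX : ∀ x ∈ X, x ∈ d) :
    ∃ Y, GoodL σ Y ∧ (∀ y ∈ Y, y ∈ d) ∧ (∀ x ∈ X, ∃ y ∈ Y, pmLe x y) := by
  obtain ⟨Y, h1, h2, h3⟩ := antichain X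
  have hE := El_iff.1 h
  exact ⟨Y, GoodL_iff.2 ⟨fun y hy => hE.1 (hX _ (h1 y hy)), fun x hx y hy =>
    ⟨hE.2.2 _ (hX _ (h1 x hx)) _ (hX _ (h1 y hy)), h3 x hx y hy⟩⟩, fun y hy => hX _ (h1 y hy), h2⟩

structure MF (f : Set Pm → Set Pm) : Prop where
  mono : ∀ d e, d ⊆ e → f d ⊆ f e
  fin : ∀ d a, a ∈ f d → ∃ X : List Pm, (∀ x ∈ X, x ∈ d) ∧ a ∈ f {x | x ∈ X}

theorem MF.prOf {A : PData} {f : Set Pm → Set Pm → Set Pm} (h : ∀ e, MF fun d => f d e) :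
    MF fun d => PrOf A (f d) := by
  constructor
  · rintro d e hde _ ⟨X, a, rfl, h1, h2⟩
    exact ⟨X, a, rfl, h1, (h _).mono d e hde h2⟩
  · rintro d _ ⟨X, a, rfl, h1, h2⟩
    obtain ⟨Y, h3, h4⟩ := (h _).fin d a h2
    exact ⟨Y, h3, X, a, rfl, h1, h4⟩

theorem aps_mono {r r' d d' : Set Pm} (h : r ⊆ r') (h' : d ⊆ d') : aps r d ⊆ aps r' d' :=
  fun _ ⟨X, h1, h2⟩ => ⟨X, fun x hx => h' (h1 x hx), h h2⟩

theorem PrOf_mono {A : PData} {f g : Set Pm → Set Pm} (h : ∀ d, f d ⊆ g d) :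
    PrOf A f ⊆ PrOf A g := by
  rintro _ ⟨X, a, rfl, h1, h2⟩
  exact ⟨X, a, rfl, h1, h _ h2⟩

theorem aps_PrOf {σ : TyExpr} {f : Set Pm → Set Pm} (hf : MF f) {d : Set Pm} (hd : El σ d) :
    aps (PrOf (tyInterp σ) f) d = f d := by
  have hE := El_iff.1 hd
  ext a
  constructor
  · rintro ⟨X, h1, Y, b, h, h2, h3⟩
    cases h
    refine hf.mono _ _ ?_ h3
    intro a ha
    obtain ⟨h4, x, hx, _, h5⟩ := mem_dn.1 ha
    exact hE.2.1 a x h4 h5 (h1 x hx)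
  · intro ha
    obtain ⟨X, h1, h2⟩ := hf.fin d a ha
    obtain ⟨Y, h3, h4, h5⟩ := hd.pick X h1
    refine ⟨Y, h4, Y, a, rfl, h3, hf.mono _ _ ?_ h2⟩
    intro x hx
    obtain ⟨y, hy, hl⟩ := h5 x hx
    exact mem_dn.2 ⟨hE.1 (h1 x hx), y, hy, hE.1 (h4 y hy), hl⟩

theorem El_PrOf {σ τ : TyExpr} {f : Set Pm → Set Pm} (hf : ∀ d e, d ⊆ e → f d ⊆ f e)
    (h : ∀ d, El σ d → El τ (f d)) : El (.arrow σ τ) (PrOf (tyInterp σ) f) := by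
  rw [El_iff]
  refine ⟨?_, ?_, ?_⟩
  · rintro _ ⟨X, a, rfl, h1, h2⟩
    exact mem_arrow_fn.2 ⟨h1, (h _ (El_GoodL h1)).1 h2⟩
  · rintro p _ hp hl ⟨X, a, rfl, h1, h2⟩
    obtain ⟨Y, b, rfl, h3, h4⟩ := mem_arrow hp
    simp only [pmLe] at hl
    refine ⟨Y, b, rfl, h3, ?_⟩
    refine (El_iff.1 (h _ (El_GoodL h3))).2.1 b a h4 hl.2 (hf _ _ ?_ h2)
    intro c hc
    obtain ⟨h5, x, hx, _, h6⟩ := mem_dn.1 hc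
    obtain ⟨y, hy, h7⟩ := hl.1 x hx
    exact mem_dn.2 ⟨h5, y, hy, (GoodL_iff.1 h3).1 y hy, pmLe_trans h6 h7⟩
  · rintro _ ⟨X, a, rfl, h1, h2⟩ _ ⟨Y, b, rfl, h3, h4⟩
    simp only [pmCon]
    intro hc
    have hd : El σ (dn σ (X ++ Y)) := by
      refine El_dn ?_
      intro x hx y hy
      rcases List.mem_append.1 hx with hx | hx <;> rcases List.mem_append.1 hy with hy | hy
      · exact ((GoodL_iff.1 h1).2 x hx y hy).1
      · exact hc x hx y hy
      · exact pmCon_comm.1 (hc y hy x hx)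
      · exact ((GoodL_iff.1 h3).2 x hx y hy).1
    refine (El_iff.1 (h _ hd)).2.2 a (hf _ _ ?_ h2) b (hf _ _ ?_ h4)
    · intro c hc
      obtain ⟨h5, x, hx, h6⟩ := mem_dn.1 hc
      exact mem_dn.2 ⟨h5, x, List.mem_append_left _ hx, h6⟩
    · intro c hc
      obtain ⟨h5, x, hx, h6⟩ := mem_dn.1 hc
      exact mem_dn.2 ⟨h5, x, List.mem_append_right _ hx, h6⟩

theorem El_aps {σ τ : TyExpr} {r d : Set Pm} (hr : El (.arrow σ τ) r) (hd : El σ d) :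
    El τ (aps r d) := by
  have hr := El_iff.1 hr
  have hd := El_iff.1 hd
  rw [El_iff]
  refine ⟨?_, ?_, ?_⟩
  · rintro a ⟨X, h1, h2⟩
    exact (mem_arrow_fn.1 (hr.1 h2)).2
  · rintro a b ha hl ⟨X, h1, h2⟩
    refine ⟨X, h1, hr.2.1 _ _ (mem_arrow_fn.2 ⟨(mem_arrow_fn.1 (hr.1 h2)).1, ha⟩) ?_ h2⟩
    simp only [pmLe]
    exact ⟨fun v hv => ⟨v, hv, pmLe_refl v⟩, hl⟩
  · rintro a ⟨X, h1, h2⟩ b ⟨Y, h3, h4⟩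
    have := hr.2.2 _ h2 _ h4
    simp only [pmCon] at this
    exact this fun u hu v hv => hd.2.2 _ (h1 u hu) _ (h3 v hv)

theorem El_inj0 {s t : TyExpr} {d : Set Pm} (h : El s d) : El (.sum s t) (inj0 d) := by
  have h := El_iff.1 h
  rw [El_iff]
  refine ⟨?_, ?_, ?_⟩
  · rintro _ (rfl | ⟨a, ha, rfl⟩)
    · exact mem_sum_stag _
    · exact mem_sum_spr.2 (h.1 ha)
  · rintro p _ hp hl hb
    obtain ⟨c, rfl | ⟨a, ha, rfl⟩⟩ := mem_sum hp
    · rcases hb with rfl | ⟨a, ha, rfl⟩ <;> simp [pmLe] at hl <;> subst hl <;> exact .inl rfl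
    · rcases hb with rfl | ⟨b, hb, rfl⟩
      · simp [pmLe] at hl
      · simp only [pmLe] at hl
        obtain ⟨rfl, hl⟩ := hl
        exact .inr ⟨a, h.2.1 a b ha hl hb, rfl⟩
  · rintro _ (rfl | ⟨a, ha, rfl⟩) _ (rfl | ⟨b, hb, rfl⟩) <;> simp [pmCon]
    exact h.2.2 a ha b hb

theorem El_inj1 {s t : TyExpr} {d : Set Pm} (h : El t d) : El (.sum s t) (inj1 d) := by
  have h := El_iff.1 h
  rw [El_iff]
  refine ⟨?_, ?_, ?_⟩
  · rintro _ (rfl | ⟨a, ha, rfl⟩)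
    · exact mem_sum_stag _
    · exact mem_sum_spr.2 (h.1 ha)
  · rintro p _ hp hl hb
    obtain ⟨c, rfl | ⟨a, ha, rfl⟩⟩ := mem_sum hp
    · rcases hb with rfl | ⟨a, ha, rfl⟩ <;> simp [pmLe] at hl <;> subst hl <;> exact .inl rfl
    · rcases hb with rfl | ⟨b, hb, rfl⟩
      · simp [pmLe] at hl
      · simp only [pmLe] at hl
        obtain ⟨rfl, hl⟩ := hl
        exact .inr ⟨a, h.2.1 a b ha hl hb, rfl⟩
  · rintro _ (rfl | ⟨a, ha, rfl⟩) _ (rfl | ⟨b, hb, rfl⟩) <;> simp [pmCon]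
    exact h.2.2 a ha b hb

theorem El_pairS {s t : TyExpr} {d e : Set Pm} (h : El s d) (h' : El t e) :
    El (.prod s t) (pairS d e) := by
  have h := El_iff.1 h
  have h' := El_iff.1 h'
  rw [El_iff]
  refine ⟨?_, ?_, ?_⟩
  · rintro _ (⟨a, ha, rfl⟩ | ⟨a, ha, rfl⟩)
    · exact mem_prod_ppr.2 (h.1 ha)
    · exact mem_prod_ppr.2 (h'.1 ha)
  · rintro p _ hp hl hb
    obtain ⟨c, a, ha, rfl⟩ := mem_prod hp
    rcases hb with ⟨b, hb, rfl⟩ | ⟨b, hb, rfl⟩ <;> simp only [pmLe] at hl <;> obtain ⟨rfl, hl⟩ := hl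
    · exact .inl ⟨a, h.2.1 a b ha hl hb, rfl⟩
    · exact .inr ⟨a, h'.2.1 a b ha hl hb, rfl⟩
  · rintro _ (⟨a, ha, rfl⟩ | ⟨a, ha, rfl⟩) _ (⟨b, hb, rfl⟩ | ⟨b, hb, rfl⟩) <;> simp [pmCon]
    · exact h.2.2 a ha b hb
    · exact h'.2.2 a ha b hb

theorem El_fstS {s t : TyExpr} {d : Set Pm} (h : El (.prod s t) d) : El s (fstS d) := by
  have h := El_iff.1 h
  rw [El_iff]
  refine ⟨fun a ha => mem_prod_ppr.1 (h.1 ha), fun a b ha hl hb => ?_, fun a ha b hb => ?_⟩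
  · refine h.2.1 (.ppr false a) (.ppr false b) (mem_prod_ppr.2 ha) ?_ hb
    simp [pmLe, hl]
  · simpa [pmCon] using h.2.2 _ ha _ hb

theorem El_sndS {s t : TyExpr} {d : Set Pm} (h : El (.prod s t) d) : El t (sndS d) := by
  have h := El_iff.1 h
  rw [El_iff]
  refine ⟨fun a ha => mem_prod_ppr.1 (h.1 ha), fun a b ha hl hb => ?_, fun a ha b hb => ?_⟩
  · refine h.2.1 (.ppr true a) (.ppr true b) (mem_prod_ppr.2 ha) ?_ hb
    simp [pmLe, hl]
  · simpa [pmCon] using h.2.2 _ ha _ hb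

theorem El_prj0 {s t : TyExpr} {d : Set Pm} (h : El (.sum s t) d) : El s (prj0 d) := by
  have h := El_iff.1 h
  rw [El_iff]
  refine ⟨fun a ha => mem_sum_spr.1 (h.1 ha), fun a b ha hl hb => ?_, fun a ha b hb => ?_⟩
  · refine h.2.1 (.spr false a) (.spr false b) (mem_sum_spr.2 ha) ?_ hb
    simp [pmLe, hl]
  · simpa [pmCon] using h.2.2 _ ha _ hb

theorem El_prj1 {s t : TyExpr} {d : Set Pm} (h : El (.sum s t) d) : El t (prj1 d) := by
  have h := El_iff.1 h
  rw [El_iff]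
  refine ⟨fun a ha => mem_sum_spr.1 (h.1 ha), fun a b ha hl hb => ?_, fun a ha b hb => ?_⟩
  · refine h.2.1 (.spr true a) (.spr true b) (mem_sum_spr.2 ha) ?_ hb
    simp [pmLe, hl]
  · simpa [pmCon] using h.2.2 _ ha _ hb

theorem El_tags {s t : TyExpr} {d : Set Pm} (h : El (.sum s t) d) (h0 : Pm.stag false ∈ d)
    (h1 : Pm.stag true ∈ d) : False := by
  have h := (El_iff.1 h).2.2 _ h0 _ h1
  simp [pmCon] at h

theorem caseS_zero {d f g : Set Pm} (h0 : Pm.stag false ∈ d) (h1 : Pm.stag true ∉ d) :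
    caseS d f g = aps f (prj0 d) := by
  ext a; simp [caseS, h0, h1]
theorem caseS_one {d f g : Set Pm} (h0 : Pm.stag false ∉ d) (h1 : Pm.stag true ∈ d) :
    caseS d f g = aps g (prj1 d) := by
  ext a; simp [caseS, h0, h1]

theorem El_empty (s : TyExpr) : El s ∅ := by
  rw [El_iff]; simp

theorem El_caseS {s t r : TyExpr} {d f g : Set Pm} (h : El (.sum s t) d) (hf : El (.arrow s r) f)
    (hg : El (.arrow t r) g) : El r (caseS d f g) := by
  by_cases h0 : Pm.stag false ∈ d
  · rw [caseS_zero h0 fun h1 => El_tags h h0 h1]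
    exact El_aps hf (El_prj0 h)
  · by_cases h1 : Pm.stag true ∈ d
    · rw [caseS_one h0 h1]
      exact El_aps hg (El_prj1 h)
    · have : caseS d f g = ∅ := by ext a; simp [caseS, h0, h1]
      rw [this]; exact El_empty r

theorem mem_pcaseS {a b c : Set Pm} {p : Pm} : p ∈ pcaseS a b c ↔
    (p ∈ b ∧ p ∈ c) ∨ (Pm.stag false ∈ a ∧ p ∈ b) ∨ (Pm.stag true ∈ a ∧ p ∈ c) := by
  simp only [pcaseS, Set.mem_setOf_eq, Set.mem_inter_iff]
  tauto

theorem El_inter {s : TyExpr} {d e : Set Pm} (h : El s d) (h' : El s e) : El s (d ∩ e) := by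
  have h := El_iff.1 h
  have h' := El_iff.1 h'
  rw [El_iff]
  exact ⟨fun a ha => h.1 ha.1, fun a b ha hl hb => ⟨h.2.1 a b ha hl hb.1, h'.2.1 a b ha hl hb.2⟩,
    fun a ha b hb => h.2.2 a ha.1 b hb.1⟩

theorem El_pcaseS {s t r : TyExpr} {d f g : Set Pm} (h : El (.sum s t) d) (hf : El r f)
    (hg : El r g) : El r (pcaseS d f g) := by
  by_cases h0 : Pm.stag false ∈ d
  · have h1 : Pm.stag true ∉ d := fun h1 => El_tags h h0 h1
    have : pcaseS d f g = f := by ext a; simp [pcaseS, h0, h1]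
    rw [this]; exact hf
  · by_cases h1 : Pm.stag true ∈ d
    · have : pcaseS d f g = g := by ext a; simp [pcaseS, h0, h1]
      rw [this]; exact hg
    · have : pcaseS d f g = f ∩ g := by ext a; simp [pcaseS, h0, h1]
      rw [this]; exact El_inter hf hg

theorem MF.of {f : Set Pm → Set Pm}
    (h : ∀ d a, a ∈ f d → ∃ X : List Pm, (∀ x ∈ X, x ∈ d) ∧ ∀ e, (∀ x ∈ X, x ∈ e) → a ∈ f e) :
    MF f := by
  constructor
  · intro d e hde a ha
    obtain ⟨X, h1, h2⟩ := h d a ha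
    exact h2 e fun x hx => hde (h1 x hx)
  · intro d a ha
    obtain ⟨X, h1, h2⟩ := h d a ha
    exact ⟨X, h1, h2 _ fun x hx => hx⟩

theorem MF_inj0 : MF inj0 := by
  refine .of ?_
  rintro d _ (rfl | ⟨a, ha, rfl⟩)
  · exact ⟨[], by simp, fun e _ => .inl rfl⟩
  · exact ⟨[a], by simpa using ha, fun e he => .inr ⟨a, he a (by simp), rfl⟩⟩
theorem MF_inj1 : MF inj1 := by
  refine .of ?_
  rintro d _ (rfl | ⟨a, ha, rfl⟩)
  · exact ⟨[], by simp, fun e _ => .inl rfl⟩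
  · exact ⟨[a], by simpa using ha, fun e he => .inr ⟨a, he a (by simp), rfl⟩⟩
theorem MF_fstS : MF fstS :=
  .of fun d a ha => ⟨[.ppr false a], by intro x hx; simp at hx; subst hx; exact ha, fun e he => he _ (by simp)⟩
theorem MF_sndS : MF sndS :=
  .of fun d a ha => ⟨[.ppr true a], by intro x hx; simp at hx; subst hx; exact ha, fun e he => he _ (by simp)⟩
theorem MF_pairS1 (e : Set Pm) : MF fun d => pairS d e := by
  refine .of ?_
  rintro d _ (⟨a, ha, rfl⟩ | ⟨a, ha, rfl⟩)
  · exact ⟨[a], by simpa using ha, fun e he => .inl ⟨a, he a (by simp), rfl⟩⟩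
  · exact ⟨[], by simp, fun e he => .inr ⟨a, ha, rfl⟩⟩
theorem MF_pairS2 (d : Set Pm) : MF fun e => pairS d e := by
  refine .of ?_
  rintro d _ (⟨a, ha, rfl⟩ | ⟨a, ha, rfl⟩)
  · exact ⟨[], by simp, fun e he => .inl ⟨a, ha, rfl⟩⟩
  · exact ⟨[a], by simpa using ha, fun e he => .inr ⟨a, he a (by simp), rfl⟩⟩
theorem MF_caseS1 (f g : Set Pm) : MF fun d => caseS d f g := by
  refine .of ?_
  rintro d b (⟨h0, X, h1, h2⟩ | ⟨h0, X, h1, h2⟩)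
  · refine ⟨.stag false :: X.map (.spr false), ?_, fun e he => .inl ⟨he _ (by simp), X, ?_, h2⟩⟩
    · intro x hx; simp at hx; rcases hx with rfl | ⟨a, ha, rfl⟩
      · exact h0
      · exact h1 a ha
    · intro x hx; exact he (.spr false x) (by simp [hx])
  · refine ⟨.stag true :: X.map (.spr true), ?_, fun e he => .inr ⟨he _ (by simp), X, ?_, h2⟩⟩
    · intro x hx; simp at hx; rcases hx with rfl | ⟨a, ha, rfl⟩
      · exact h0
      · exact h1 a ha
    · intro x hx; exact he (.spr true x) (by simp [hx])
theorem MF_caseS2 (d g : Set Pm) : MF fun f => caseS d f g := by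
  refine .of ?_
  rintro f b (⟨h0, X, h1, h2⟩ | h)
  · exact ⟨[.fn X b], by simpa using h2, fun e he => .inl ⟨h0, X, h1, he _ (by simp)⟩⟩
  · exact ⟨[], by simp, fun e he => .inr h⟩
theorem MF_caseS3 (d f : Set Pm) : MF fun g => caseS d f g := by
  refine .of ?_
  rintro g b (h | ⟨h0, X, h1, h2⟩)
  · exact ⟨[], by simp, fun e he => .inl h⟩
  · exact ⟨[.fn X b], by simpa using h2, fun e he => .inr ⟨h0, X, h1, he _ (by simp)⟩⟩
theorem MF_pcaseS1 (f g : Set Pm) : MF fun d => pcaseS d f g := by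
  refine .of ?_
  intro d b h
  rcases mem_pcaseS.1 h with h | ⟨h, h'⟩ | ⟨h, h'⟩
  · exact ⟨[], by simp, fun e he => mem_pcaseS.2 (.inl h)⟩
  · exact ⟨[.stag false], by simpa using h, fun e he => mem_pcaseS.2 (.inr (.inl ⟨he _ (by simp), h'⟩))⟩
  · exact ⟨[.stag true], by simpa using h, fun e he => mem_pcaseS.2 (.inr (.inr ⟨he _ (by simp), h'⟩))⟩
theorem MF_pcaseS2 (d g : Set Pm) : MF fun f => pcaseS d f g := by
  refine .of ?_
  intro f b h
  rcases mem_pcaseS.1 h with ⟨h, h'⟩ | ⟨h, h'⟩ | h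
  · exact ⟨[b], by simpa using h, fun e he => mem_pcaseS.2 (.inl ⟨he _ (by simp), h'⟩)⟩
  · exact ⟨[b], by simpa using h', fun e he => mem_pcaseS.2 (.inr (.inl ⟨h, he _ (by simp)⟩))⟩
  · exact ⟨[], by simp, fun e he => mem_pcaseS.2 (.inr (.inr h))⟩
theorem MF_pcaseS3 (d f : Set Pm) : MF fun g => pcaseS d f g := by
  refine .of ?_
  intro g b h
  rcases mem_pcaseS.1 h with ⟨h, h'⟩ | h | ⟨h, h'⟩
  · exact ⟨[b], by simpa using h', fun e he => mem_pcaseS.2 (.inl ⟨h, he _ (by simp)⟩)⟩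
  · exact ⟨[], by simp, fun e he => mem_pcaseS.2 (.inr (.inl h))⟩
  · exact ⟨[b], by simpa using h', fun e he => mem_pcaseS.2 (.inr (.inr ⟨h, he _ (by simp)⟩))⟩

theorem cs_zero {s t : TyExpr} {d : Set Pm} (hd : El s d) : aps (constSem (.czero s t)) d = inj0 d :=
  aps_PrOf MF_inj0 hd
theorem cs_one {s t : TyExpr} {d : Set Pm} (hd : El t d) : aps (constSem (.cone s t)) d = inj1 d :=
  aps_PrOf MF_inj1 hd
theorem cs_fst {s t : TyExpr} {d : Set Pm} (hd : El (.prod s t) d) :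
    aps (constSem (.cfst s t)) d = fstS d :=
  aps_PrOf MF_fstS hd
theorem cs_snd {s t : TyExpr} {d : Set Pm} (hd : El (.prod s t) d) :
    aps (constSem (.csnd s t)) d = sndS d :=
  aps_PrOf MF_sndS hd
theorem cs_pair {s t : TyExpr} {d e : Set Pm} (hd : El s d) (he : El t e) :
    aps (aps (constSem (.cpair s t)) d) e = pairS d e := by
  simp only [constSem]
  rw [aps_PrOf (MF.prOf fun e => MF_pairS1 e) hd, aps_PrOf (MF_pairS2 d) he]
theorem cs_case {s t r : TyExpr} {d f g : Set Pm} (h : El (.sum s t) d) (hf : El (.arrow s r) f)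
    (hg : El (.arrow t r) g) :
    aps (aps (aps (constSem (.ccase s t r)) d) f) g = caseS d f g := by
  simp only [constSem]
  rw [aps_PrOf (MF.prOf fun f => MF.prOf fun g => MF_caseS1 f g) h,
    aps_PrOf (MF.prOf fun g => MF_caseS2 d g) hf, aps_PrOf (MF_caseS3 d f) hg]
theorem cs_pcase {s t r : TyExpr} {d f g : Set Pm} (h : El (.sum s t) d) (hf : El r f)
    (hg : El r g) :
    aps (aps (aps (constSem (.cpcase s t r)) d) f) g = pcaseS d f g := by
  simp only [constSem]
  rw [aps_PrOf (MF.prOf fun f => MF.prOf fun g => MF_pcaseS1 f g) h,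
    aps_PrOf (MF.prOf fun g => MF_pcaseS2 d g) hf, aps_PrOf (MF_pcaseS3 d f) hg]

theorem El_const (c : Const) : El (constType c) (constSem c) := by
  cases c with
  | czero s t => exact El_PrOf MF_inj0.mono fun d hd => El_inj0 hd
  | cone s t => exact El_PrOf MF_inj1.mono fun d hd => El_inj1 hd
  | cfst s t => exact El_PrOf MF_fstS.mono fun d hd => El_fstS hd
  | csnd s t => exact El_PrOf MF_sndS.mono fun d hd => El_sndS hd
  | comega s => exact El_empty s
  | cpair s t =>
    exact El_PrOf (MF.prOf fun e => MF_pairS1 e).mono fun d hd =>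
      El_PrOf (MF_pairS2 d).mono fun e he => El_pairS hd he
  | ccase s t r =>
    exact El_PrOf (MF.prOf fun f => MF.prOf fun g => MF_caseS1 f g).mono fun d hd =>
      El_PrOf (MF.prOf fun g => MF_caseS2 d g).mono fun f hf =>
      El_PrOf (MF_caseS3 d f).mono fun g hg => El_caseS hd hf hg
  | cpcase s t r =>
    exact El_PrOf (MF.prOf fun f => MF.prOf fun g => MF_pcaseS1 f g).mono fun d hd =>
      El_PrOf (MF.prOf fun g => MF_pcaseS2 d g).mono fun f hf =>
      El_PrOf (MF_pcaseS3 d f).mono fun g hg => El_pcaseS hd hf hg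

theorem sem_mono (M : Tm) {ε ε' : Env} (h : ∀ n, ε n ⊆ ε' n) : sem M ε ⊆ sem M ε' := by
  induction M generalizing ε ε' with
  | var n => exact h n
  | const c => exact subset_rfl
  | app P Q ih1 ih2 => exact aps_mono (ih1 h) (ih2 h)
  | lam σ M ih =>
    refine PrOf_mono fun d => ih fun n => ?_
    cases n with
    | zero => exact subset_rfl
    | succ n => exact h n

theorem sem_fin (M : Tm) {ε : Env} {a : Pm} (h : a ∈ sem M ε) :
    ∃ η : ℕ → List Pm, (∀ n, ∀ x ∈ η n, x ∈ ε n) ∧ a ∈ sem M (fun n => {x | x ∈ η n}) := by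
  induction M generalizing ε a with
  | var n =>
    refine ⟨fun m => if m = n then [a] else [], fun m x hx => ?_, ?_⟩
    · by_cases hm : m = n
      · subst hm; simp at hx; subst hx; exact h
      · simp [hm] at hx
    · simp [sem]
  | const c => exact ⟨fun _ => [], by simp, h⟩
  | app P Q ih1 ih2 =>
    obtain ⟨X, h1, h2⟩ := h
    obtain ⟨η, h3, h4⟩ := ih1 h2
    have : ∃ η' : ℕ → List Pm, (∀ n, ∀ x ∈ η' n, x ∈ ε n) ∧
        ∀ x ∈ X, x ∈ sem Q (fun n => {x | x ∈ η' n}) := by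
      clear h2 h4
      induction X with
      | nil => exact ⟨fun _ => [], by simp, by simp⟩
      | cons b X ih =>
        obtain ⟨η1, h5, h6⟩ := ih fun x hx => h1 x (List.mem_cons_of_mem _ hx)
        obtain ⟨η2, h7, h8⟩ := ih2 (h1 b List.mem_cons_self)
        refine ⟨fun n => η1 n ++ η2 n, fun n x hx => ?_, fun x hx => ?_⟩
        · rcases List.mem_append.1 hx with hx | hx
          · exact h5 n x hx
          · exact h7 n x hx
        · rcases List.mem_cons.1 hx with rfl | hx
          · exact sem_mono Q (fun n y hy => List.mem_append_right _ hy) h8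
          · exact sem_mono Q (fun n y hy => List.mem_append_left _ hy) (h6 x hx)
    obtain ⟨η', h5, h6⟩ := this
    refine ⟨fun n => η n ++ η' n, fun n x hx => ?_, X, fun x hx => ?_, ?_⟩
    · rcases List.mem_append.1 hx with hx | hx
      · exact h3 n x hx
      · exact h5 n x hx
    · exact sem_mono Q (fun n y hy => List.mem_append_right _ hy) (h6 x hx)
    · exact sem_mono P (fun n y hy => List.mem_append_left _ hy) h4
  | lam σ M ih =>
    obtain ⟨X, b, rfl, h1, h2⟩ := h
    obtain ⟨η, h3, h4⟩ := ih h2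
    refine ⟨fun n => η (n + 1), fun n x hx => h3 (n + 1) x hx, X, b, rfl, h1, ?_⟩
    refine sem_mono M (fun n => ?_) h4
    cases n with
    | zero => exact fun x hx => h3 0 x hx
    | succ n => exact subset_rfl

theorem MF_sem (M : Tm) (ε : Env) : MF fun d => sem M (envCons d ε) := by
  refine .of fun d a ha => ?_
  obtain ⟨η, h1, h2⟩ := sem_fin M ha
  refine ⟨η 0, h1 0, fun e he => sem_mono M (fun n => ?_) h2⟩
  cases n with
  | zero => exact he
  | succ n => exact h1 (n + 1)

theorem TmPre.sem {A M : Tm} (h : TmPre A M) (ε : Env) : sem A ε ⊆ sem M ε := by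
  induction h generalizing ε with
  | omega σ M => intro x hx; exact hx.elim
  | var n => exact subset_rfl
  | const c => exact subset_rfl
  | app _ _ h1 h2 => exact aps_mono (h1 ε) (h2 ε)
  | lam σ _ h => exact PrOf_mono fun d => h _

theorem sem_ren (r : ℕ → ℕ) (M : Tm) (ε : Env) : sem (ren r M) ε = sem M (fun n => ε (r n)) := by
  induction M generalizing r ε with
  | var n => rfl
  | const c => rfl
  | app P Q h1 h2 => simp only [ren, sem, h1, h2]
  | lam σ M h =>
    simp only [ren, sem, h]
    congr 1; funext d; congr 1; funext n; cases n <;> rfl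

theorem sem_sub (s : ℕ → Tm) (M : Tm) (ε : Env) :
    sem (sub s M) ε = sem M (fun n => sem (s n) ε) := by
  induction M generalizing s ε with
  | var n => rfl
  | const c => rfl
  | app P Q h1 h2 => simp only [sub, sem, h1, h2]
  | lam σ M h =>
    simp only [sub, sem, h]
    congr 1; funext d; congr 1; funext n
    cases n with
    | zero => rfl
    | succ n => simp only [ups, consS, sem_ren]; rfl

theorem sem_substTm (M N : Tm) (ε : Env) : sem (substTm M 0 N) ε = sem M (envCons (sem N ε) ε) := by
  rw [substTm_zero, sem_sub]; congr 1; funext n; cases n <;> rfl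

theorem GoodEnv.cons {Γ : List TyExpr} {ε : Env} {σ : TyExpr} {d : Set Pm} (h : GoodEnv Γ ε)
    (hd : El σ d) : GoodEnv (σ :: Γ) (envCons d ε) := by
  intro n τ hn
  cases n with
  | zero => cases hn; exact hd
  | succ n => exact h n τ hn

theorem HT.el {Γ : List TyExpr} {M : Tm} {σ : TyExpr} (h : HT Γ M σ) {ε : Env}
    (hε : GoodEnv Γ ε) : El σ (sem M ε) := by
  induction h generalizing ε with
  | var h => exact hε _ _ h
  | const c => exact El_const c
  | om τ σ => exact El_empty σ
  | app _ _ h1 h2 => exact El_aps (h1 hε) (h2 hε)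
  | @lam Γ M σ τ _ ih => exact El_PrOf (MF_sem M ε).mono fun d hd => ih (hε.cons hd)
  | equiv _ h2 ih => have := ih hε; unfold El at this ⊢; rw [← h2.interp]; exact this

theorem aps_inter {σ τ : TyExpr} {f g d : Set Pm} (hf : El (.arrow σ τ) f) (hg : El (.arrow σ τ) g)
    (hd : El σ d) {a : Pm} (h1 : a ∈ aps f d) (h2 : a ∈ aps g d) : a ∈ aps (f ∩ g) d := by
  obtain ⟨X, hX, h1⟩ := h1
  obtain ⟨Y, hY, h2⟩ := h2
  obtain ⟨Z, h3, h4, h5⟩ := hd.pick (X ++ Y) (fun x hx => by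
    rcases List.mem_append.1 hx with hx | hx
    · exact hX x hx
    · exact hY x hx)
  have hf := El_iff.1 hf
  have hg := El_iff.1 hg
  have hc : Pm.fn Z a ∈ car (.arrow σ τ) := mem_arrow_fn.2 ⟨h3, (mem_arrow_fn.1 (hf.1 h1)).2⟩
  refine ⟨Z, h4, hf.2.1 _ _ hc ?_ h1, hg.2.1 _ _ hc ?_ h2⟩
  · simp only [pmLe]
    exact ⟨fun v hv => by simpa using h5 v (List.mem_append_left _ hv), pmLe_refl a⟩
  · simp only [pmLe]
    exact ⟨fun v hv => by simpa using h5 v (List.mem_append_right _ hv), pmLe_refl a⟩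

theorem aps_pcaseS {σ τ : TyExpr} {c f g d : Set Pm} (hf : El (.arrow σ τ) f)
    (hg : El (.arrow σ τ) g) (hd : El σ d) :
    aps (pcaseS c f g) d = pcaseS c (aps f d) (aps g d) := by
  ext a
  constructor
  · rintro ⟨X, hX, h⟩
    rw [mem_pcaseS] at h ⊢
    rcases h with ⟨h, h'⟩ | ⟨h, h'⟩ | ⟨h, h'⟩
    · exact .inl ⟨⟨X, hX, h⟩, ⟨X, hX, h'⟩⟩
    · exact .inr (.inl ⟨h, ⟨X, hX, h'⟩⟩)
    · exact .inr (.inr ⟨h, ⟨X, hX, h'⟩⟩)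
  · intro h
    rcases mem_pcaseS.1 h with ⟨h, h'⟩ | ⟨h, X, hX, h'⟩ | ⟨h, X, hX, h'⟩
    · exact aps_mono (fun p hp => mem_pcaseS.2 (.inl hp)) subset_rfl (aps_inter hf hg hd h h')
    · exact ⟨X, hX, mem_pcaseS.2 (.inr (.inl ⟨h, h'⟩))⟩
    · exact ⟨X, hX, mem_pcaseS.2 (.inr (.inr ⟨h, h'⟩))⟩

theorem sem_zero {Γ : List TyExpr} {ε : Env} {T s t : TyExpr} {x : Tm} (hε : GoodEnv Γ ε)
    (h : HT Γ (.app (.const (.czero s t)) x) T) :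
    sem (.app (.const (.czero s t)) x) ε = inj0 (sem x ε) := cs_zero (h.zero_inv.1.el hε)
theorem sem_one {Γ : List TyExpr} {ε : Env} {T s t : TyExpr} {x : Tm} (hε : GoodEnv Γ ε)
    (h : HT Γ (.app (.const (.cone s t)) x) T) :
    sem (.app (.const (.cone s t)) x) ε = inj1 (sem x ε) := cs_one (h.one_inv.1.el hε)
theorem sem_fst {Γ : List TyExpr} {ε : Env} {T s t : TyExpr} {x : Tm} (hε : GoodEnv Γ ε)
    (h : HT Γ (.app (.const (.cfst s t)) x) T) :
    sem (.app (.const (.cfst s t)) x) ε = fstS (sem x ε) := cs_fst (h.fst_inv.1.el hε)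
theorem sem_snd {Γ : List TyExpr} {ε : Env} {T s t : TyExpr} {x : Tm} (hε : GoodEnv Γ ε)
    (h : HT Γ (.app (.const (.csnd s t)) x) T) :
    sem (.app (.const (.csnd s t)) x) ε = sndS (sem x ε) := cs_snd (h.snd_inv.1.el hε)
theorem sem_pair {Γ : List TyExpr} {ε : Env} {T s t : TyExpr} {x y : Tm} (hε : GoodEnv Γ ε)
    (h : HT Γ (.app (.app (.const (.cpair s t)) x) y) T) :
    sem (.app (.app (.const (.cpair s t)) x) y) ε = pairS (sem x ε) (sem y ε) :=
  cs_pair (h.pair_inv.1.el hε) (h.pair_inv.2.1.el hε)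
theorem sem_case {Γ : List TyExpr} {ε : Env} {T s t r : TyExpr} {x y z : Tm} (hε : GoodEnv Γ ε)
    (h : HT Γ (.app (.app (.app (.const (.ccase s t r)) x) y) z) T) :
    sem (.app (.app (.app (.const (.ccase s t r)) x) y) z) ε =
      caseS (sem x ε) (sem y ε) (sem z ε) :=
  cs_case (h.case_inv.1.el hε) (h.case_inv.2.1.el hε) (h.case_inv.2.2.1.el hε)
theorem sem_pcase {Γ : List TyExpr} {ε : Env} {T s t r : TyExpr} {x y z : Tm} (hε : GoodEnv Γ ε)
    (h : HT Γ (.app (.app (.app (.const (.cpcase s t r)) x) y) z) T) :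
    sem (.app (.app (.app (.const (.cpcase s t r)) x) y) z) ε =
      pcaseS (sem x ε) (sem y ε) (sem z ε) :=
  cs_pcase (h.pcase_inv.1.el hε) (h.pcase_inv.2.1.el hε) (h.pcase_inv.2.2.1.el hε)

theorem sem_beta {Γ : List TyExpr} {ε : Env} {σ : TyExpr} {M N : Tm} (hε : GoodEnv Γ ε)
    (h : HT Γ N σ) : sem (.app (.lam σ M) N) ε = sem M (envCons (sem N ε) ε) :=
  aps_PrOf (MF_sem M ε) (h.el hε)

theorem pcaseS_inj0 (c y z : Set Pm) : pcaseS c (inj0 y) (inj0 z) = inj0 (pcaseS c y z) := by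
  ext a
  rw [mem_pcaseS]
  rcases a with b | ⟨b, a⟩ | ⟨b, a⟩ | ⟨X, a⟩ <;> simp [inj0]
  · tauto
  · rw [mem_pcaseS]; tauto
theorem pcaseS_inj1 (c y z : Set Pm) : pcaseS c (inj1 y) (inj1 z) = inj1 (pcaseS c y z) := by
  ext a
  rw [mem_pcaseS]
  rcases a with b | ⟨b, a⟩ | ⟨b, a⟩ | ⟨X, a⟩ <;> simp [inj1]
  · tauto
  · rw [mem_pcaseS]; tauto
theorem pcaseS_pairS (c y z y' z' : Set Pm) :
    pcaseS c (pairS y y') (pairS z z') = pairS (pcaseS c y z) (pcaseS c y' z') := by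
  ext a
  rw [mem_pcaseS]
  rcases a with b | ⟨b, a⟩ | ⟨b, a⟩ | ⟨X, a⟩ <;> simp [pairS]
  rw [mem_pcaseS, mem_pcaseS]; cases b <;> simp

theorem Root.sound {Γ : List TyExpr} {ε : Env} {M N : Tm} {T : TyExpr} (h : Root M N)
    (hM : HT Γ M T) (hε : GoodEnv Γ ε) : sem M ε = sem N ε := by
  have hN := h.ht hM
  cases h with
  | beta σ M N =>
    obtain ⟨τ, h1, h2⟩ := hM.app_inv
    obtain ⟨τ', h3, h4⟩ := h1.lam_inv
    rw [sem_beta hε (.equiv h2 h4.arrow_inv.1.symm'), sem_substTm]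
  | caseZero =>
    rw [sem_case hε hM, sem_zero hε hM.case_inv.1, caseS_zero (.inl rfl) (by simp [inj0])]
    simp [sem, prj0, inj0]
  | caseOne =>
    rw [sem_case hε hM, sem_one hε hM.case_inv.1, caseS_one (by simp [inj1]) (.inl rfl)]
    simp [sem, prj1, inj1]
  | fstPair => rw [sem_fst hε hM, sem_pair hε hM.fst_inv.1]; simp [fstS, pairS]
  | sndPair => rw [sem_snd hε hM, sem_pair hε hM.snd_inv.1]; simp [sndS, pairS]
  | pcaseZero =>
    rw [sem_pcase hε hM, sem_zero hε hM.pcase_inv.1]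
    ext a; simp [pcaseS, inj0]
  | pcaseOne =>
    rw [sem_pcase hε hM, sem_one hε hM.pcase_inv.1]
    ext a; simp [pcaseS, inj1]
  | pcaseZZ =>
    rw [sem_pcase hε hM, sem_zero hε hM.pcase_inv.2.1, sem_zero hε hM.pcase_inv.2.2.1,
      sem_zero hε hN, sem_pcase hε hN.zero_inv.1, pcaseS_inj0]
  | pcaseOO =>
    rw [sem_pcase hε hM, sem_one hε hM.pcase_inv.2.1, sem_one hε hM.pcase_inv.2.2.1,
      sem_one hε hN, sem_pcase hε hN.one_inv.1, pcaseS_inj1]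
  | pcasePair =>
    rw [sem_pcase hε hM, sem_pair hε hM.pcase_inv.2.1, sem_pair hε hM.pcase_inv.2.2.1,
      sem_pair hε hN, sem_pcase hε hN.pair_inv.1, sem_pcase hε hN.pair_inv.2.1]
    rw [pcaseS_pairS]
  | pcaseArrow =>
    obtain ⟨τ, h1, hw⟩ := hM.app_inv
    obtain ⟨hx, hy, hz, hT⟩ := h1.pcase_inv
    have hw := HT.equiv hw hT.arrow_inv.1.symm'
    rw [sem_pcase hε hN, sem, sem_pcase hε h1, aps_pcaseS (hy.el hε) (hz.el hε) (hw.el hε)]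
    rfl

theorem Step.sound {Γ : List TyExpr} {ε : Env} {M N : Tm} {T : TyExpr} (h : Step M N)
    (hM : HT Γ M T) (hε : GoodEnv Γ ε) : sem M ε = sem N ε := by
  induction h generalizing Γ ε T with
  | appL N h ih =>
    obtain ⟨τ, h1, h2⟩ := hM.app_inv
    simp only [sem, ih h1 hε]
  | appR N h ih =>
    obtain ⟨τ, h1, h2⟩ := hM.app_inv
    simp only [sem, ih h2 hε]
  | lamC σ h ih =>
    obtain ⟨τ, h1, h2⟩ := hM.lam_inv
    simp only [sem]
    have : ∀ X, GoodL σ X → sem _ (envCons (downListP (tyInterp σ) X) ε) =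
        sem _ (envCons (downListP (tyInterp σ) X) ε) :=
      fun X hX => ih h1 (hε.cons (El_GoodL hX))
    ext p
    constructor
    · rintro ⟨X, a, rfl, h3, h4⟩; refine ⟨X, a, rfl, h3, ?_⟩; dsimp only at h4 ⊢; rw [← this X h3]; exact h4
    · rintro ⟨X, a, rfl, h3, h4⟩; refine ⟨X, a, rfl, h3, ?_⟩; dsimp only at h4 ⊢; rw [this X h3]; exact h4
  | _ => exact Root.sound (by constructor) hM hε

theorem Steps.sound {Γ : List TyExpr} {ε : Env} {M N : Tm} {T : TyExpr} (h : Steps M N)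
    (hM : HT Γ M T) (hε : GoodEnv Γ ε) : sem M ε = sem N ε := by
  induction h with
  | refl => rfl
  | tail h0 h ih => exact ih.trans (h.sound (Steps.ht h0 hM) hε)

end RecLam


set_option autoImplicit false
set_option linter.all false

namespace RecLam

/-! ### Part F: the logical relation -/

def injT (b : Bool) (s t : TyExpr) (x : Tm) : Tm :=
  .app (.const (if b then .cone s t else .czero s t)) x
def pairT (s t : TyExpr) (x y : Tm) : Tm := .app (.app (.const (.cpair s t)) x) y
def injS (b : Bool) (d : Set Pm) : Set Pm := if b then inj1 d else inj0 d

theorem injT_ht {Γ : List TyExpr} {b : Bool} {s t T : TyExpr} {x : Tm} (h : HT Γ (injT b s t x) T) :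
    HT Γ x (if b then t else s) ∧ TyEquiv (.sum s t) T := by
  cases b
  · exact HT.zero_inv h
  · exact HT.one_inv h
theorem pairT_ht {Γ : List TyExpr} {s t T : TyExpr} {x y : Tm} (h : HT Γ (pairT s t x y) T)
    (b : Bool) : HT Γ (if b then y else x) (if b then t else s) ∧ TyEquiv (.prod s t) T := by
  have := HT.pair_inv h
  cases b
  · exact ⟨this.1, this.2.2⟩
  · exact this.2
theorem injT_steps {b : Bool} {s t : TyExpr} {x N : Tm} (h : Steps (injT b s t x) N) :
    ∃ x', N = injT b s t x' ∧ Steps x x' := by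
  cases b
  · exact steps_zero h
  · exact steps_one h
theorem steps_injT (b : Bool) (s t : TyExpr) {x x' : Tm} (h : Steps x x') :
    Steps (injT b s t x) (injT b s t x') := steps_app .refl h
theorem steps_pairT (s t : TyExpr) {x x' y y' : Tm} (h : Steps x x') (h' : Steps y y') :
    Steps (pairT s t x y) (pairT s t x' y') := steps_app (steps_app .refl h) h'
theorem injT_val (b : Bool) (s t : TyExpr) (x : Tm) : Val (injT b s t x) := by
  cases b
  · exact .zero ..
  · exact .one ..
theorem pairT_val (s t : TyExpr) (x y : Tm) : Val (pairT s t x y) := .pair2 ..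
theorem injT_sim {b : Bool} {s t : TyExpr} {x N : Tm} (h : Sim (injT b s t x) N) :
    ∃ s' t' x', N = injT b s' t' x' ∧ Sim x x' ∧ TyEquiv s s' ∧ TyEquiv t t' := by
  cases b
  · cases h with | app h1 h2 => cases h1 with | const h1 => cases h1 with | zero h3 h4 => exact ⟨_, _, _, rfl, h2, h3, h4⟩
  · cases h with | app h1 h2 => cases h1 with | const h1 => cases h1 with | one h3 h4 => exact ⟨_, _, _, rfl, h2, h3, h4⟩
theorem pairT_sim {s t : TyExpr} {x y N : Tm} (h : Sim (pairT s t x y) N) :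
    ∃ s' t' x' y', N = pairT s' t' x' y' ∧ Sim x x' ∧ Sim y y' ∧ TyEquiv s s' ∧ TyEquiv t t' := by
  cases h with | app h1 h2 => cases h1 with | app h1 h0 => cases h1 with | const h1 => cases h1 with | pair h3 h4 => exact ⟨_, _, _, _, rfl, h0, h2, h3, h4⟩
theorem injT_inj {b b' : Bool} {s t s' t' : TyExpr} {x x' : Tm}
    (h : injT b s t x = injT b' s' t' x') : b = b' ∧ s = s' ∧ t = t' ∧ x = x' := by
  cases b <;> cases b' <;> simpa [injT, and_assoc] using h
theorem dir_injT (b : Bool) (s t : TyExpr) (x : Tm) : dir (injT b s t x) = injT b s t (dir x) := by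
  cases b <;> exact dir_app (rs_const x (by simp) (by simp))
theorem dir_pairT (s t : TyExpr) (x y : Tm) : dir (pairT s t x y) = pairT s t (dir x) (dir y) := by
  unfold pairT
  rw [dir_app (rs_const2 x y (by simp) (by simp)), dir_app (rs_const x (by simp) (by simp))]; rfl
theorem sem_injT {Γ : List TyExpr} {ε : Env} {b : Bool} {T s t : TyExpr} {x : Tm}
    (hε : GoodEnv Γ ε) (h : HT Γ (injT b s t x) T) : sem (injT b s t x) ε = injS b (sem x ε) := by
  cases b
  · exact sem_zero hε h
  · exact sem_one hε h
theorem stag_injS (b : Bool) (d : Set Pm) : Pm.stag b ∈ injS b d := by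
  cases b <;> simp [injS, inj0, inj1]
theorem spr_injS {b : Bool} {d : Set Pm} {a : Pm} (h : a ∈ d) : Pm.spr b a ∈ injS b d := by
  cases b <;> simp [injS, inj0, inj1, h]
theorem ren_injT (r : ℕ → ℕ) (b : Bool) (s t : TyExpr) (x : Tm) :
    ren r (injT b s t x) = injT b s t (ren r x) := by
  cases b <;> rfl

/-! Joinability -/

def Jn (M N : Tm) : Prop := ∃ K L, Steps M K ∧ Steps N L ∧ Sim K L

theorem Jn.symm {M N : Tm} (h : Jn M N) : Jn N M := by
  obtain ⟨K, L, h1, h2, h3⟩ := h; exact ⟨L, K, h2, h1, h3.symm'⟩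
theorem Jn.of {M N : Tm} (h : Steps M N) : Jn M N := ⟨N, N, h, .refl, .rfl' N⟩
theorem Jn.sim {M N : Tm} (h : Sim M N) : Jn M N := ⟨M, N, .refl, .refl, h⟩
theorem Jn.trans {Γ : List TyExpr} {T : TyExpr} {M N P : Tm} (hN : HT Γ N T) (h : Jn M N)
    (h' : Jn N P) : Jn M P := by
  obtain ⟨K, L, h1, h2, h3⟩ := h
  obtain ⟨K', L', h1', h2', h3'⟩ := h'
  obtain ⟨A, B, h4, h5, h6⟩ := confl hN h2 h1'
  obtain ⟨A', h7, h8⟩ := Steps.sim h4 h3.symm'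
  obtain ⟨B', h9, h10⟩ := Steps.sim h5 h3'
  exact ⟨A', B', h1.trans h7, h2'.trans h9, h8.symm'.trans' (h6.trans' h10)⟩
theorem Jn.ren' {M N : Tm} (h : Jn M N) (r : ℕ → ℕ) : Jn (ren r M) (ren r N) := by
  obtain ⟨K, L, h1, h2, h3⟩ := h; exact ⟨_, _, h1.ren' r, h2.ren' r, h3.ren' r⟩
theorem Jn.appL {M N : Tm} (h : Jn M N) (P : Tm) : Jn (.app M P) (.app N P) := by
  obtain ⟨K, L, h1, h2, h3⟩ := h
  exact ⟨_, _, steps_app h1 .refl, steps_app h2 .refl, .app h3 (.rfl' _)⟩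



def Ap (ε : Env) (a : Pm) (M : Tm) : Prop := ∃ N, Steps M N ∧ a ∈ sem (dir N) ε

theorem Ap.expand {ε : Env} {a : Pm} {M N : Tm} (h : Ap ε a N) (hs : Steps M N) : Ap ε a M := by
  obtain ⟨K, h1, h2⟩ := h; exact ⟨K, hs.trans h1, h2⟩

theorem sem_dir_steps {ε : Env} {a : Pm} {M N : Tm} (h : a ∈ sem (dir M) ε) (hs : Steps M N) :
    a ∈ sem (dir N) ε := (Steps.dir hs).sem ε h

theorem Ap.jn {Γ : List TyExpr} {T : TyExpr} {ε : Env} {a : Pm} {M N : Tm} (hM : HT Γ M T)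
    (h : Ap ε a M) (hj : Jn M N) : Ap ε a N := by
  obtain ⟨K, h1, h2⟩ := h
  obtain ⟨A, B, h3, h4, h5⟩ := Jn.trans hM (Jn.of h1).symm hj
  exact ⟨B, h4, by rw [← (h5.dir).sem ε]; exact sem_dir_steps h2 h3⟩

theorem Ap.all {Γ : List TyExpr} {T : TyExpr} {ε : Env} {M : Tm} (hM : HT Γ M T) (X : List Pm)
    (h : ∀ x ∈ X, Ap ε x M) : ∃ N, Steps M N ∧ ∀ x ∈ X, x ∈ sem (dir N) ε := by
  induction X with
  | nil => exact ⟨M, .refl, by simp⟩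
  | cons a X ih =>
    obtain ⟨N, h1, h2⟩ := ih fun x hx => h x (List.mem_cons_of_mem _ hx)
    obtain ⟨K, h3, h4⟩ := h a (by simp)
    obtain ⟨A, B, h5, h6, h7⟩ := confl hM h1 h3
    refine ⟨A, h1.trans h5, fun x hx => ?_⟩
    rcases List.mem_cons.1 hx with rfl | hx
    · rw [(h7.dir).sem ε]; exact sem_dir_steps h4 h6
    · exact sem_dir_steps (h2 x hx) h5

theorem Ap.car {Γ : List TyExpr} {T : TyExpr} {ε : Env} {a : Pm} {M : Tm} (hM : HT Γ M T)
    (hε : GoodEnv Γ ε) (h : Ap ε a M) : a ∈ car T := by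
  obtain ⟨K, h1, h2⟩ := h
  exact (El_iff.1 (HT.el (HT.dir (Steps.ht h1 hM)) hε)).1 h2

theorem Ap.down {Γ : List TyExpr} {T : TyExpr} {ε : Env} {a a' : Pm} {M : Tm} (hM : HT Γ M T)
    (hε : GoodEnv Γ ε) (h : Ap ε a M) (ha : a' ∈ RecLam.car T) (hl : pmLe a' a) : Ap ε a' M := by
  obtain ⟨K, h1, h2⟩ := h
  exact ⟨K, h1, (El_iff.1 (HT.el (HT.dir (Steps.ht h1 hM)) hε)).2.1 _ _ ha hl h2⟩

theorem Ap.ren' {ε ε' : Env} {a : Pm} {M : Tm} {r : ℕ → ℕ} (h : Ap ε a M)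
    (hr : ∀ n, ε' (r n) = ε n) : Ap ε' a (ren r M) := by
  obtain ⟨K, h1, h2⟩ := h
  refine ⟨_, h1.ren' r, ?_⟩
  rw [dir_ren, sem_ren, show (fun n => ε' (r n)) = ε from funext hr]; exact h2

theorem Ap.app {Γ : List TyExpr} {T : TyExpr} {ε : Env} {X : List Pm} {b : Pm} {M P : Tm}
    (hP : HT Γ P T) (h : Ap ε (.fn X b) M) (hX : ∀ x ∈ X, Ap ε x P) (hs : RootStable M P) :
    Ap ε b (.app M P) := by
  obtain ⟨M', h1, h2⟩ := h
  obtain ⟨P', h3, h4⟩ := Ap.all hP X hX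
  refine ⟨_, steps_app h1 h3, ?_⟩
  rw [dir_app (hs.steps h1 h3)]
  exact ⟨X, h4, h2⟩

/-! The relation -/

def R (Γ : List TyExpr) (ε : Env) (σ : TyExpr) (p : Pm) (M : Tm) : Prop :=
  match p with
  | .stag b => (∃ s t P, Steps M (injT b s t P)) ∨ (∃ M', Steps M M' ∧ Stuck M' ∧ Ap ε (.stag b) M')
  | .spr b a => (∃ s t P, Steps M (injT b s t P) ∧ R Γ ε (if b then t else s) a P) ∨
      (∃ M', Steps M M' ∧ Stuck M' ∧ Ap ε (.spr b a) M')
  | .ppr b a => (∃ s t P Q, Steps M (pairT s t P Q) ∧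
        R Γ ε (if b then t else s) a (if b then Q else P)) ∨
      (∃ M', Steps M M' ∧ Stuck M' ∧ Ap ε (.ppr b a) M')
  | .fn X b => Ap ε (.fn X b) M ∧ ∀ (r : ℕ → ℕ) (Δ : List TyExpr) (δ : Env), GoodEnv Δ δ →
      (∀ n τ, Γ[n]? = some τ → Δ[r n]? = some τ) → (∀ n, δ (r n) = ε n) →
      ∀ σ' τ', TyEquiv σ (.arrow σ' τ') → ∀ P, HT Δ P σ' → (∀ x, ∀ _ : x ∈ X, R Δ δ σ' x P) →
      R Δ δ τ' b (.app (ren r M) P)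
termination_by sizeOf p
decreasing_by
  all_goals simp_wf
  all_goals try have := List.sizeOf_lt_of_mem ‹_ ∈ X›
  all_goals omega

theorem R_stag {Γ : List TyExpr} {ε : Env} {σ : TyExpr} {b : Bool} {M : Tm} :
    R Γ ε σ (.stag b) M ↔ (∃ s t P, Steps M (injT b s t P)) ∨
      (∃ M', Steps M M' ∧ Stuck M' ∧ Ap ε (.stag b) M') := by rw [R]
theorem R_spr {Γ : List TyExpr} {ε : Env} {σ : TyExpr} {b : Bool} {a : Pm} {M : Tm} :
    R Γ ε σ (.spr b a) M ↔ (∃ s t P, Steps M (injT b s t P) ∧ R Γ ε (if b then t else s) a P) ∨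
      (∃ M', Steps M M' ∧ Stuck M' ∧ Ap ε (.spr b a) M') := by rw [R]
theorem R_ppr {Γ : List TyExpr} {ε : Env} {σ : TyExpr} {b : Bool} {a : Pm} {M : Tm} :
    R Γ ε σ (.ppr b a) M ↔ (∃ s t P Q, Steps M (pairT s t P Q) ∧
        R Γ ε (if b then t else s) a (if b then Q else P)) ∨
      (∃ M', Steps M M' ∧ Stuck M' ∧ Ap ε (.ppr b a) M') := by rw [R]
theorem R_fn {Γ : List TyExpr} {ε : Env} {σ : TyExpr} {X : List Pm} {b : Pm} {M : Tm} :
    R Γ ε σ (.fn X b) M ↔ Ap ε (.fn X b) M ∧ ∀ (r : ℕ → ℕ) (Δ : List TyExpr) (δ : Env),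
      GoodEnv Δ δ →
      (∀ n τ, Γ[n]? = some τ → Δ[r n]? = some τ) → (∀ n, δ (r n) = ε n) →
      ∀ σ' τ', TyEquiv σ (.arrow σ' τ') → ∀ P, HT Δ P σ' → (∀ x ∈ X, R Δ δ σ' x P) →
      R Δ δ τ' b (.app (ren r M) P) := by rw [R]

theorem R.equiv {Γ : List TyExpr} {ε : Env} {σ τ : TyExpr} {p : Pm} {M : Tm} (h : R Γ ε σ p M)
    (he : TyEquiv σ τ) : R Γ ε τ p M := by
  cases p with
  | stag b => rw [R_stag] at h ⊢; exact h
  | spr b a => rw [R_spr] at h ⊢; exact h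
  | ppr b a => rw [R_ppr] at h ⊢; exact h
  | fn X b =>
    rw [R_fn] at h ⊢
    exact ⟨h.1, fun r Δ δ h1 h2 h3 σ' τ' h4 => h.2 r Δ δ h1 h2 h3 σ' τ' (he.trans' h4)⟩


theorem R.ap {p : Pm} : ∀ {Γ : List TyExpr} {ε : Env} {σ : TyExpr} {M : Tm}, HT Γ M σ → GoodEnv Γ ε →
    R Γ ε σ p M → Ap ε p M := by
  induction p using Pm.ind with
  | h1 b =>
    intro Γ ε σ M hM hε h
    rcases R_stag.1 h with ⟨s, t, P, h1⟩ | ⟨M', h1, _, h2⟩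
    · refine ⟨_, h1, ?_⟩
      have := (Steps.ht h1 hM).dir
      rw [dir_injT] at this ⊢
      rw [sem_injT hε this]; exact stag_injS _ _
    · exact h2.expand h1
  | h2 b a ih =>
    intro Γ ε σ M hM hε h
    rcases R_spr.1 h with ⟨s, t, P, h1, h2⟩ | ⟨M', h1, _, h2⟩
    · have h3 := Steps.ht h1 hM
      obtain ⟨P', h4, h5⟩ := ih (injT_ht h3).1 hε h2
      have h6 := steps_injT b s t h4
      have := (Steps.ht h6 h3).dir
      refine ⟨_, h1.trans h6, ?_⟩
      rw [dir_injT] at this ⊢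
      rw [sem_injT hε this]; exact spr_injS h5
    · exact h2.expand h1
  | h3 b a ih =>
    intro Γ ε σ M hM hε h
    rcases R_ppr.1 h with ⟨s, t, P, Q, h1, h2⟩ | ⟨M', h1, _, h2⟩
    · have h3 := Steps.ht h1 hM
      obtain ⟨P', h4, h5⟩ := ih (pairT_ht h3 b).1 hε h2
      cases b
      · have h6 := steps_pairT s t h4 (.refl : Steps Q Q)
        have := (Steps.ht h6 h3).dir
        refine ⟨_, h1.trans h6, ?_⟩
        rw [dir_pairT] at this ⊢
        rw [pairT, sem_pair hε this]; exact .inl ⟨a, h5, rfl⟩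
      · have h6 := steps_pairT s t (.refl : Steps P P) h4
        have := (Steps.ht h6 h3).dir
        refine ⟨_, h1.trans h6, ?_⟩
        rw [dir_pairT] at this ⊢
        rw [pairT, sem_pair hε this]; exact .inr ⟨a, h5, rfl⟩
    · exact h2.expand h1
  | h4 X b ihX ih =>
    intro Γ ε σ M hM hε h
    exact (R_fn.1 h).1

theorem stuck_jn {Γ : List TyExpr} {σ : TyExpr} {ε : Env} {p : Pm} {M N : Tm} (hM : HT Γ M σ)
    (hj : Jn M N) (h : ∃ M', Steps M M' ∧ Stuck M' ∧ Ap ε p M') :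
    ∃ M', Steps N M' ∧ Stuck M' ∧ Ap ε p M' := by
  obtain ⟨M', h1, h2, h3⟩ := h
  obtain ⟨A, B, h4, h5, h6⟩ := Jn.trans hM (Jn.of h1).symm hj
  exact ⟨B, h5, (h2.steps h4).sim h6, h3.jn (Steps.ht h1 hM) ⟨A, B, h4, .refl, h6⟩⟩

theorem injT_jn {Γ : List TyExpr} {σ s t : TyExpr} {b : Bool} {P M N : Tm} (hM : HT Γ M σ)
    (hj : Jn M N) (h : Steps M (injT b s t P)) :
    ∃ s' t' P', Steps N (injT b s' t' P') ∧ Jn P P' ∧ TyEquiv s s' ∧ TyEquiv t t' := by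
  obtain ⟨A, B, h4, h5, h6⟩ := Jn.trans hM (Jn.of h).symm hj
  obtain ⟨P1, rfl, h7⟩ := injT_steps h4
  obtain ⟨s', t', P2, rfl, h8, h9, h10⟩ := injT_sim h6
  exact ⟨s', t', P2, h5, ⟨_, _, h7, .refl, h8⟩, h9, h10⟩

theorem pairT_jn {Γ : List TyExpr} {σ s t : TyExpr} {P Q M N : Tm} (hM : HT Γ M σ)
    (hj : Jn M N) (h : Steps M (pairT s t P Q)) :
    ∃ s' t' P' Q', Steps N (pairT s' t' P' Q') ∧ Jn P P' ∧ Jn Q Q' ∧ TyEquiv s s' ∧ TyEquiv t t' := by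
  obtain ⟨A, B, h4, h5, h6⟩ := Jn.trans hM (Jn.of h).symm hj
  obtain ⟨P1, Q1, rfl, h7, h7'⟩ := steps_pair h4
  obtain ⟨s', t', P2, Q2, rfl, h8, h8', h9, h10⟩ := pairT_sim h6
  exact ⟨s', t', P2, Q2, h5, ⟨_, _, h7, .refl, h8⟩, ⟨_, _, h7', .refl, h8'⟩, h9, h10⟩

theorem TyEquiv.ite {b : Bool} {s t s' t' : TyExpr} (h : TyEquiv s s') (h' : TyEquiv t t') :
    TyEquiv (if b then t else s) (if b then t' else s') := by
  cases b
  · exact h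
  · exact h'


theorem R.jn {p : Pm} : ∀ {Γ : List TyExpr} {ε : Env} {σ : TyExpr} {M N : Tm}, HT Γ M σ → HT Γ N σ →
    Jn M N → R Γ ε σ p M → R Γ ε σ p N := by
  induction p using Pm.ind with
  | h1 b =>
    intro Γ ε σ M N hM hN hj h
    rw [R_stag]
    rcases R_stag.1 h with ⟨s, t, P, h1⟩ | h1
    · obtain ⟨s', t', P', h2, _⟩ := injT_jn hM hj h1
      exact .inl ⟨_, _, _, h2⟩
    · exact .inr (stuck_jn hM hj h1)
  | h2 b a ih =>
    intro Γ ε σ M N hM hN hj h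
    rw [R_spr]
    rcases R_spr.1 h with ⟨s, t, P, h1, h0⟩ | h1
    · obtain ⟨s', t', P', h2, h3, h4, h5⟩ := injT_jn hM hj h1
      have h6 := TyEquiv.ite (b := b) h4 h5
      exact .inl ⟨_, _, _, h2, ih (.equiv (injT_ht (Steps.ht h1 hM)).1 h6)
        (injT_ht (Steps.ht h2 hN)).1 h3 (h0.equiv h6)⟩
    · exact .inr (stuck_jn hM hj h1)
  | h3 b a ih =>
    intro Γ ε σ M N hM hN hj h
    rw [R_ppr]
    rcases R_ppr.1 h with ⟨s, t, P, Q, h1, h0⟩ | h1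
    · obtain ⟨s', t', P', Q', h2, h3, h3', h4, h5⟩ := pairT_jn hM hj h1
      have h6 := TyEquiv.ite (b := b) h4 h5
      refine .inl ⟨_, _, _, _, h2, ih (.equiv (pairT_ht (Steps.ht h1 hM) b).1 h6)
        (pairT_ht (Steps.ht h2 hN) b).1 ?_ (h0.equiv h6)⟩
      cases b
      · exact h3
      · exact h3'
    · exact .inr (stuck_jn hM hj h1)
  | h4 X b ihX ih =>
    intro Γ ε σ M N hM hN hj h
    rw [R_fn] at h ⊢
    refine ⟨h.1.jn hM hj, fun r Δ δ h1 h2 h3 σ' τ' h4 P hP hX => ?_⟩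
    exact ih (.app (.equiv (hM.ren' h2) h4) hP) (.app (.equiv (hN.ren' h2) h4) hP)
      ((hj.ren' r).appL P) (h.2 r Δ δ h1 h2 h3 σ' τ' h4 P hP hX)

theorem R.expand {p : Pm} {Γ : List TyExpr} {ε : Env} {σ : TyExpr} {M N : Tm} (hM : HT Γ M σ)
    (hs : Steps M N) (h : R Γ ε σ p N) : R Γ ε σ p M :=
  R.jn (Steps.ht hs hM) hM (Jn.of hs).symm h
theorem R.red {p : Pm} {Γ : List TyExpr} {ε : Env} {σ : TyExpr} {M N : Tm} (hM : HT Γ M σ)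
    (hs : Steps M N) (h : R Γ ε σ p M) : R Γ ε σ p N :=
  R.jn hM (Steps.ht hs hM) (Jn.of hs) h

/-- Stuck terms reflect approximability. -/
theorem Stuck.R {p : Pm} : ∀ {Γ : List TyExpr} {ε : Env} {σ : TyExpr} {M : Tm}, HT Γ M σ →
    Stuck M → Ap ε p M → R Γ ε σ p M := by
  induction p using Pm.ind with
  | h1 b => intro Γ ε σ M hM hs h; exact R_stag.2 (.inr ⟨M, .refl, hs, h⟩)
  | h2 b a ih => intro Γ ε σ M hM hs h; exact R_spr.2 (.inr ⟨M, .refl, hs, h⟩)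
  | h3 b a ih => intro Γ ε σ M hM hs h; exact R_ppr.2 (.inr ⟨M, .refl, hs, h⟩)
  | h4 X b ihX ih =>
    intro Γ ε σ M hM hs h
    refine R_fn.2 ⟨h, fun r Δ δ h1 h2 h3 σ' τ' h4 P hP hX => ?_⟩
    exact ih (.app (.equiv (hM.ren' h2) h4) hP) ((hs.ren' r).app P)
      (Ap.app hP (h.ren' h3) (fun x hx => (hX x hx).ap hP h1) ((hs.ren' r).rootStable P))

/-- Weakening. -/
theorem R.ren' {p : Pm} : ∀ {Γ : List TyExpr} {ε : Env} {σ : TyExpr} {M : Tm},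
    R Γ ε σ p M → ∀ {r : ℕ → ℕ} {Δ : List TyExpr} {δ : Env},
      (∀ n τ, Γ[n]? = some τ → Δ[r n]? = some τ) → (∀ n, δ (r n) = ε n) →
      R Δ δ σ p (ren r M) := by
  have hst : ∀ {ε δ : Env} {p : Pm} {M : Tm} {r : ℕ → ℕ}, (∀ n, δ (r n) = ε n) →
      (∃ M', Steps M M' ∧ Stuck M' ∧ Ap ε p M') →
      ∃ M', Steps (ren r M) M' ∧ Stuck M' ∧ Ap δ p M' := by
    rintro ε δ p M r hr ⟨M', h1, h2, h3⟩
    exact ⟨_, h1.ren' r, h2.ren' r, h3.ren' hr⟩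
  induction p using Pm.ind with
  | h1 b =>
    intro Γ ε σ M h r Δ δ hr hr'
    rw [R_stag]
    rcases R_stag.1 h with ⟨s, t, P, h1⟩ | h1
    · have := h1.ren' r
      rw [ren_injT] at this; exact .inl ⟨_, _, _, this⟩
    · exact .inr (hst hr' h1)
  | h2 b a ih =>
    intro Γ ε σ M h r Δ δ hr hr'
    rw [R_spr]
    rcases R_spr.1 h with ⟨s, t, P, h1, h2⟩ | h1
    · have := h1.ren' r
      rw [ren_injT] at this; exact .inl ⟨_, _, _, this, ih h2 hr hr'⟩
    · exact .inr (hst hr' h1)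
  | h3 b a ih =>
    intro Γ ε σ M h r Δ δ hr hr'
    rw [R_ppr]
    rcases R_ppr.1 h with ⟨s, t, P, Q, h1, h2⟩ | h1
    · have h4 : Steps (ren r M) (pairT s t (ren r P) (ren r Q)) := h1.ren' r
      have h3 := ih h2 hr hr'
      refine .inl ⟨_, _, _, _, h4, ?_⟩
      cases b <;> exact h3
    · exact .inr (hst hr' h1)
  | h4 X b ihX ih =>
    intro Γ ε σ M h r Δ δ hr hr'
    rw [R_fn] at h ⊢
    refine ⟨h.1.ren' hr', fun r2 Δ2 δ2 h1 h2 h3 σ' τ' h4 P hP hX => ?_⟩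
    rw [ren_ren]
    exact h.2 _ Δ2 δ2 h1 (fun n τ hn => h2 _ _ (hr _ _ hn)) (fun n => (h3 _).trans (hr' n))
      σ' τ' h4 P hP hX

theorem R.app {X : List Pm} {b : Pm} {Γ : List TyExpr} {ε : Env} {σ τ : TyExpr} {M P : Tm}
    (hε : GoodEnv Γ ε) (h : R Γ ε (.arrow σ τ) (.fn X b) M) (hP : HT Γ P σ)
    (hX : ∀ x ∈ X, R Γ ε σ x P) : R Γ ε τ b (.app M P) := by
  have := (R_fn.1 h).2 (fun n => n) Γ ε hε (fun _ _ h => h) (fun _ => rfl) σ τ .rfl' P hP hX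
  rwa [ren_id] at this

theorem R.inj_inv {b b' : Bool} {a : Pm} {Γ : List TyExpr} {ε : Env} {σ s t : TyExpr} {M P : Tm}
    (hM : HT Γ M σ) (h : R Γ ε σ (.spr b a) M) (hs : Steps M (injT b' s t P)) :
    b = b' ∧ R Γ ε (if b' then t else s) a P := by
  have h1 := R_spr.1 (R.red hM hs h)
  have h0 := Steps.ht hs hM
  rcases h1 with ⟨s', t', P', h1, h2⟩ | ⟨M', h1, h2, _⟩
  · obtain ⟨P2, h3, h4⟩ := injT_steps h1
    obtain ⟨rfl, rfl, rfl, rfl⟩ := injT_inj h3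
    exact ⟨rfl, R.expand (injT_ht h0).1 h4 h2⟩
  · obtain ⟨P2, rfl, _⟩ := injT_steps h1
    exact absurd (injT_val _ _ _ _) (h2 _ .refl).1

theorem R.tag_inv {b b' : Bool} {Γ : List TyExpr} {ε : Env} {σ s t : TyExpr} {M P : Tm}
    (hM : HT Γ M σ) (h : R Γ ε σ (.stag b) M) (hs : Steps M (injT b' s t P)) : b = b' := by
  have h1 := R_stag.1 (R.red hM hs h)
  rcases h1 with ⟨s', t', P', h1⟩ | ⟨M', h1, h2, _⟩
  · obtain ⟨P2, h3, h4⟩ := injT_steps h1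
    exact (injT_inj h3).1
  · obtain ⟨P2, rfl, _⟩ := injT_steps h1
    exact absurd (injT_val _ _ _ _) (h2 _ .refl).1

theorem R.pair_inv {b : Bool} {a : Pm} {Γ : List TyExpr} {ε : Env} {σ s t : TyExpr} {M P Q : Tm}
    (hM : HT Γ M σ) (h : R Γ ε σ (.ppr b a) M) (hs : Steps M (pairT s t P Q)) :
    R Γ ε (if b then t else s) a (if b then Q else P) := by
  have h1 := R_ppr.1 (R.red hM hs h)
  have h0 := Steps.ht hs hM
  rcases h1 with ⟨s', t', P', Q', h1, h2⟩ | ⟨M', h1, h2, _⟩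
  · obtain ⟨P2, Q2, h3, h4, h5⟩ := steps_pair h1
    simp only [pairT, Tm.app.injEq, Tm.const.injEq, Const.cpair.injEq] at h3
    obtain ⟨⟨⟨rfl, rfl⟩, rfl⟩, rfl⟩ := h3
    refine R.expand (pairT_ht h0 b).1 ?_ h2
    cases b
    · exact h4
    · exact h5
  · obtain ⟨P2, Q2, rfl, _⟩ := steps_pair h1
    exact absurd (pairT_val _ _ _ _) (h2 _ .refl).1

/-- Down-closure. -/
theorem R.down_aux (p : Pm) : (∀ {Γ : List TyExpr} {ε : Env} {σ : TyExpr} {M : Tm} {q : Pm},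
    HT Γ M σ → GoodEnv Γ ε → R Γ ε σ p M → q ∈ car σ → pmLe q p → R Γ ε σ q M) ∧
    (∀ {Γ : List TyExpr} {ε : Env} {σ : TyExpr} {M : Tm} {q : Pm},
    HT Γ M σ → GoodEnv Γ ε → R Γ ε σ q M → p ∈ car σ → pmLe p q → R Γ ε σ p M) := by
  have hst : ∀ {Γ : List TyExpr} {ε : Env} {σ : TyExpr} {M : Tm} {p q : Pm}, HT Γ M σ →
      GoodEnv Γ ε → p ∈ car σ → pmLe p q → (∃ M', Steps M M' ∧ Stuck M' ∧ Ap ε q M') →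
      R Γ ε σ p M := by
    rintro Γ ε σ M p q hM hε hp hl ⟨M', h1, h2, h3⟩
    have := Steps.ht h1 hM
    exact R.expand hM h1 (Stuck.R this h2 (h3.down this hε hp hl))
  have hcar : ∀ {Γ : List TyExpr} {ε : Env} {σ s t : TyExpr} {M P : Tm} {b : Bool} {a : Pm},
      HT Γ M σ → Steps M (injT b s t P) → Pm.spr b a ∈ car σ → a ∈ car (if b then t else s) := by
    intro Γ ε σ s t M P b a hM hs h
    have := (injT_ht (Steps.ht hs hM)).2.interp
    unfold RecLam.car at h; rw [← this] at h
    exact mem_sum_spr.1 h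
  have hcar' : ∀ {Γ : List TyExpr} {ε : Env} {σ s t : TyExpr} {M P Q : Tm} {b : Bool} {a : Pm},
      HT Γ M σ → Steps M (pairT s t P Q) → Pm.ppr b a ∈ car σ → a ∈ car (if b then t else s) := by
    intro Γ ε σ s t M P Q b a hM hs h
    have := (pairT_ht (Steps.ht hs hM) b).2.interp
    unfold RecLam.car at h; rw [← this] at h
    exact mem_prod_ppr.1 h
  have htag : ∀ {Γ : List TyExpr} {ε : Env} {σ : TyExpr} {M : Tm} {b : Bool} {q : Pm},
      HT Γ M σ → GoodEnv Γ ε → R Γ ε σ q M → Pm.stag b ∈ car σ → pmLe (.stag b) q →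
      R Γ ε σ (.stag b) M := by
    intro Γ ε σ M b q hM hε h hp hl
    cases q with
    | stag c => simp only [pmLe] at hl; subst hl; exact h
    | spr c a =>
      have hl' := hl
      simp only [pmLe] at hl'; subst hl'
      rcases R_spr.1 h with ⟨s, t, P, h1, _⟩ | h1
      · exact R_stag.2 (.inl ⟨_, _, _, h1⟩)
      · exact hst hM hε hp hl h1
    | _ => simp [pmLe] at hl
  induction p using Pm.ind with
  | h1 b =>
    refine ⟨?_, fun hM hε h hp hl => htag hM hε h hp hl⟩
    intro Γ ε σ M q hM hε h hq hl
    cases q with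
    | stag c => exact htag hM hε h hq hl
    | _ => simp [pmLe] at hl
  | h2 b a ih =>
    constructor
    · intro Γ ε σ M q hM hε h hq hl
      cases q with
      | stag c => exact htag hM hε h hq hl
      | spr c a' =>
        have hl' := hl
        simp only [pmLe] at hl'
        obtain ⟨rfl, hl'⟩ := hl'
        rcases R_spr.1 h with ⟨s, t, P, h1, h2⟩ | h1
        · exact R_spr.2 (.inl ⟨_, _, _, h1, ih.1 (injT_ht (Steps.ht h1 hM)).1 hε h2
            (hcar (ε := ε) hM h1 hq) hl'⟩)
        · exact hst hM hε hq hl h1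
      | _ => simp [pmLe] at hl
    · intro Γ ε σ M q hM hε h hq hl
      cases q with
      | spr c a' =>
        have hl' := hl
        simp only [pmLe] at hl'
        obtain ⟨rfl, hl'⟩ := hl'
        rcases R_spr.1 h with ⟨s, t, P, h1, h2⟩ | h1
        · exact R_spr.2 (.inl ⟨_, _, _, h1, ih.2 (injT_ht (Steps.ht h1 hM)).1 hε h2
            (hcar (ε := ε) hM h1 hq) hl'⟩)
        · exact hst hM hε hq hl h1
      | _ => simp [pmLe] at hl
  | h3 b a ih =>
    constructor
    · intro Γ ε σ M q hM hε h hq hl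
      cases q with
      | ppr c a' =>
        have hl' := hl
        simp only [pmLe] at hl'
        obtain ⟨rfl, hl'⟩ := hl'
        rcases R_ppr.1 h with ⟨s, t, P, Q, h1, h2⟩ | h1
        · exact R_ppr.2 (.inl ⟨_, _, _, _, h1, ih.1 (pairT_ht (Steps.ht h1 hM) _).1 hε h2
            (hcar' (ε := ε) hM h1 hq) hl'⟩)
        · exact hst hM hε hq hl h1
      | _ => simp [pmLe] at hl
    · intro Γ ε σ M q hM hε h hq hl
      cases q with
      | ppr c a' =>
        have hl' := hl
        simp only [pmLe] at hl'
        obtain ⟨rfl, hl'⟩ := hl'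
        rcases R_ppr.1 h with ⟨s, t, P, Q, h1, h2⟩ | h1
        · exact R_ppr.2 (.inl ⟨_, _, _, _, h1, ih.2 (pairT_ht (Steps.ht h1 hM) _).1 hε h2
            (hcar' (ε := ε) hM h1 hq) hl'⟩)
        · exact hst hM hε hq hl h1
      | _ => simp [pmLe] at hl
  | h4 X b ihX ih =>
    constructor
    · intro Γ ε σ M q hM hε h hq hl
      cases q with
      | fn Y c =>
        have hl' := hl
        simp only [pmLe] at hl'
        have hp := (R.ap hM hε h).car hM hε
        rw [R_fn] at h ⊢
        refine ⟨h.1.down hM hε hq hl, fun r Δ δ h1 h2 h3 σ' τ' h4 P hP hX => ?_⟩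
        unfold RecLam.car at hp hq; rw [h4.interp] at hp hq
        have hp := mem_arrow_fn.1 hp
        have hq := mem_arrow_fn.1 hq
        refine ih.1 (.app (.equiv (hM.ren' h2) h4) hP) h1
          (h.2 r Δ δ h1 h2 h3 σ' τ' h4 P hP fun x hx => ?_) hq.2 hl'.2
        obtain ⟨u, hu, hxu⟩ := hl'.1 x hx
        exact (ihX x hx).2 hP h1 (hX u hu) ((GoodL_iff.1 hp.1).1 x hx) hxu
      | _ => simp [pmLe] at hl
    · intro Γ ε σ M q hM hε h hp hl
      cases q with
      | fn Y c =>
        have hl' := hl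
        simp only [pmLe] at hl'
        have hq := (R.ap hM hε h).car hM hε
        rw [R_fn] at h ⊢
        refine ⟨h.1.down hM hε hp hl, fun r Δ δ h1 h2 h3 σ' τ' h4 P hP hX => ?_⟩
        unfold RecLam.car at hp hq; rw [h4.interp] at hp hq
        have hp := mem_arrow_fn.1 hp
        have hq := mem_arrow_fn.1 hq
        refine ih.2 (.app (.equiv (hM.ren' h2) h4) hP) h1
          (h.2 r Δ δ h1 h2 h3 σ' τ' h4 P hP fun x hx => ?_) hp.2 hl'.2
        obtain ⟨u, hu, hxu⟩ := hl'.1 x hx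
        exact (ihX u hu).1 hP h1 (hX u hu) ((GoodL_iff.1 hq.1).1 x hx) hxu
      | _ => simp [pmLe] at hl

theorem R.dn {Γ : List TyExpr} {ε : Env} {σ : TyExpr} {M : Tm} {X : List Pm} (hM : HT Γ M σ)
    (hε : GoodEnv Γ ε) (hX : ∀ x ∈ X, R Γ ε σ x M) {a : Pm} (ha : a ∈ dn σ X) : R Γ ε σ a M := by
  obtain ⟨h1, x, hx, _, h2⟩ := mem_dn.1 ha
  exact (R.down_aux x).1 hM hε (hX x hx) h1 h2

end RecLam


set_option autoImplicit false
set_option linter.all false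

namespace RecLam

/-! ### Part G: adequacy -/

def pcT (s t r : TyExpr) (x y z : Tm) : Tm := .app (.app (.app (.const (.cpcase s t r)) x) y) z

theorem steps_pcT (s t r : TyExpr) {x y z x' y' z' : Tm} (hx : Steps x x') (hy : Steps y y')
    (hz : Steps z z') : Steps (pcT s t r x y z) (pcT s t r x' y' z') :=
  steps_app (steps_app (steps_app .refl hx) hy) hz

theorem dir_const (c : Const) : dir (.const c) = .const c := rfl

theorem Ap.pcase {Γ : List TyExpr} {ε : Env} {s t r : TyExpr} {x y z : Tm} {a : Pm}
    (hε : GoodEnv Γ ε) (hx : HT Γ x (.sum s t)) (hy : HT Γ y r) (hz : HT Γ z r)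
    (h : (Ap ε a y ∧ Ap ε a z) ∨ (Ap ε (.stag false) x ∧ Ap ε a y) ∨ (Ap ε (.stag true) x ∧ Ap ε a z))
    (hs : RootStable (.app (.app (.const (.cpcase s t r)) x) y) z) :
    Ap ε a (pcT s t r x y z) := by
  have key : ∀ x' y' z', Steps x x' → Steps y y' → Steps z z' →
      a ∈ pcaseS (sem (dir x') ε) (sem (dir y') ε) (sem (dir z') ε) → Ap ε a (pcT s t r x y z) := by
    intro x' y' z' h1 h2 h3 h4
    have h5 := steps_pcT s t r h1 h2 h3
    refine ⟨_, h5, ?_⟩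
    have h6 := (Steps.ht h5 (ht_pcase hx hy hz)).dir
    have h7 : dir (pcT s t r x' y' z') = pcT s t r (dir x') (dir y') (dir z') := by
      unfold pcT
      rw [dir_app (hs.steps (steps_app (steps_app .refl h1) h2) h3),
        dir_app (rs_const2 x' y' (by simp) (by simp)), dir_app (rs_const x' (by simp) (by simp)),
        dir_const]
    rw [h7] at h6 ⊢
    rw [pcT, sem_pcase hε h6]
    exact h4
  rcases h with ⟨⟨y', h1, h2⟩, ⟨z', h3, h4⟩⟩ | ⟨⟨x', h1, h2⟩, ⟨y', h3, h4⟩⟩ | ⟨⟨x', h1, h2⟩, ⟨z', h3, h4⟩⟩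
  · exact key x y' z' .refl h1 h3 (mem_pcaseS.2 (.inl ⟨h2, h4⟩))
  · exact key x' y' z h1 h3 .refl (mem_pcaseS.2 (.inr (.inl ⟨h2, h4⟩)))
  · exact key x' y z' h1 .refl h3 (mem_pcaseS.2 (.inr (.inr ⟨h2, h4⟩)))

def PH (Γ : List TyExpr) (ε : Env) (s t r : TyExpr) (a : Pm) (x y z : Tm) : Prop :=
  (R Γ ε r a y ∧ R Γ ε r a z) ∨ (R Γ ε (.sum s t) (.stag false) x ∧ R Γ ε r a y) ∨
    (R Γ ε (.sum s t) (.stag true) x ∧ R Γ ε r a z)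

theorem PH.map {Γ Δ : List TyExpr} {ε δ : Env} {s t r r' : TyExpr} {a b : Pm} {x y z x' y' z' : Tm}
    (h : PH Γ ε s t r a x y z)
    (hx : ∀ b, R Γ ε (.sum s t) (.stag b) x → R Δ δ (.sum s t) (.stag b) x')
    (hy : R Γ ε r a y → R Δ δ r' b y') (hz : R Γ ε r a z → R Δ δ r' b z') :
    PH Δ δ s t r' b x' y' z' := by
  rcases h with ⟨h, h'⟩ | ⟨h, h'⟩ | ⟨h, h'⟩
  · exact .inl ⟨hy h, hz h'⟩
  · exact .inr (.inl ⟨hx _ h, hy h'⟩)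
  · exact .inr (.inr ⟨hx _ h, hz h'⟩)

theorem pcase_redex {s t r : TyExpr} {x y z N : Tm} (h : Root (pcT s t r x y z) N) :
    (∃ b s' t' P, x = injT b s' t' P) ∨
    (∃ b r0 r1 s1 t1 s2 t2 y' z', r = .sum r0 r1 ∧ y = injT b s1 t1 y' ∧ z = injT b s2 t2 z' ∧
      N = injT b r0 r1 (pcT s t (if b then r1 else r0) x y' z')) ∨
    (∃ r0 r1 s1 t1 s2 t2 y1 y2 z1 z2, r = .prod r0 r1 ∧ y = pairT s1 t1 y1 y2 ∧
      z = pairT s2 t2 z1 z2 ∧ N = pairT r0 r1 (pcT s t r0 x y1 z1) (pcT s t r1 x y2 z2)) := by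
  unfold pcT at h
  cases h with
  | pcaseZero => exact .inl ⟨false, _, _, _, rfl⟩
  | pcaseOne => exact .inl ⟨true, _, _, _, rfl⟩
  | pcaseZZ => exact .inr (.inl ⟨false, _, _, _, _, _, _, _, _, rfl, rfl, rfl, rfl⟩)
  | pcaseOO => exact .inr (.inl ⟨true, _, _, _, _, _, _, _, _, rfl, rfl, rfl, rfl⟩)
  | pcasePair => exact .inr (.inr ⟨_, _, _, _, _, _, _, _, _, _, rfl, rfl, rfl, rfl⟩)

theorem pcase_steps {s t r : TyExpr} {x y P : Tm}
    (h : Steps (.app (.app (.const (.cpcase s t r)) x) y) P) :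
    ∃ x' y', P = .app (.app (.const (.cpcase s t r)) x') y' ∧ Steps x x' ∧ Steps y y' := by
  obtain ⟨A, B, rfl, h6, h7⟩ := (rs_const2 x y (by simp) (by simp)).steps_app h
  obtain ⟨A', B', rfl, h8, h9⟩ := (rs_const x (by simp) (by simp)).steps_app h6
  cases Steps.const_eq h8
  exact ⟨_, _, rfl, h9, h7⟩

theorem PH.ap {Γ : List TyExpr} {ε : Env} {s t r : TyExpr} {x y z : Tm} {a : Pm}
    (hε : GoodEnv Γ ε) (hx : HT Γ x (.sum s t)) (hy : HT Γ y r) (hz : HT Γ z r)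
    (h : PH Γ ε s t r a x y z) :
    (Ap ε a y ∧ Ap ε a z) ∨ (Ap ε (.stag false) x ∧ Ap ε a y) ∨ (Ap ε (.stag true) x ∧ Ap ε a z) := by
  rcases h with ⟨h, h'⟩ | ⟨h, h'⟩ | ⟨h, h'⟩
  · exact .inl ⟨h.ap hy hε, h'.ap hz hε⟩
  · exact .inr (.inl ⟨h.ap hx hε, h'.ap hy hε⟩)
  · exact .inr (.inr ⟨h.ap hx hε, h'.ap hz hε⟩)

theorem PH.or {Γ : List TyExpr} {ε : Env} {s t r : TyExpr} {x y z : Tm} {a : Pm}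
    (h : PH Γ ε s t r a x y z) : R Γ ε r a y ∨ R Γ ε r a z := by
  rcases h with ⟨h, h'⟩ | ⟨h, h'⟩ | ⟨h, h'⟩
  · exact .inl h
  · exact .inl h'
  · exact .inr h'

theorem R.pcase (a : Pm) : ∀ {Γ : List TyExpr} {ε : Env} {s t r : TyExpr} {x y z : Tm},
    GoodEnv Γ ε → HT Γ x (.sum s t) → HT Γ y r → HT Γ z r → PH Γ ε s t r a x y z →
    R Γ ε r a (pcT s t r x y z) := by
  -- the common part: everything except the recursive cases
  have main : ∀ (a : Pm)
      (IH : ∀ {Γ : List TyExpr} {ε : Env} {s t r : TyExpr} {x y z : Tm} (q : Pm),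
        ((∃ b, a = .spr b q) ∨ (∃ b, a = .ppr b q) ∨ ∃ X, a = .fn X q) →
        GoodEnv Γ ε → HT Γ x (.sum s t) → HT Γ y r → HT Γ z r → PH Γ ε s t r q x y z →
        R Γ ε r q (pcT s t r x y z)),
      ∀ {Γ : List TyExpr} {ε : Env} {s t r : TyExpr} {x y z : Tm},
      GoodEnv Γ ε → HT Γ x (.sum s t) → HT Γ y r → HT Γ z r → PH Γ ε s t r a x y z →
      R Γ ε r a (pcT s t r x y z) := by
    intro a IH Γ ε s t r x y z hε hx hy hz h
    have hT : HT Γ (pcT s t r x y z) r := ht_pcase hx hy hz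
    by_cases hred : ∃ b s' t' P, Steps x (injT b s' t' P)
    · obtain ⟨b, s', t', P, h1⟩ := hred
      cases b
      · have h2 : R Γ ε r a y := by
          rcases h with ⟨h, h'⟩ | ⟨h, h'⟩ | ⟨h, h'⟩
          · exact h
          · exact h'
          · exact absurd (R.tag_inv hx h h1) (by simp)
        exact R.expand hT ((steps_pcT s t r h1 .refl .refl).trans
          (Root.steps (.pcaseZero ..))) h2
      · have h2 : R Γ ε r a z := by
          rcases h with ⟨h, h'⟩ | ⟨h, h'⟩ | ⟨h, h'⟩
          · exact h'
          · exact absurd (R.tag_inv hx h h1) (by simp)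
          · exact h'
        exact R.expand hT ((steps_pcT s t r h1 .refl .refl).trans
          (Root.steps (.pcaseOne ..))) h2
    have hcar : a ∈ car r := by
      rcases h.or with h | h
      · exact (h.ap hy hε).car hy hε
      · exact (h.ap hz hε).car hz hε
    by_cases harr : ∃ r1 r2, r = .arrow r1 r2
    · obtain ⟨r1, r2, rfl⟩ := harr
      obtain ⟨X, q, rfl, _, _⟩ := mem_arrow hcar
      have hs : RootStable (.app (.app (.const (.cpcase s t (.arrow r1 r2))) x) y) z := by
        intro P' z' h1 h2 N h3
        obtain ⟨x', y', rfl, h4, h5⟩ := pcase_steps h1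
        rcases pcase_redex h3 with ⟨b, s', t', P, rfl⟩ | ⟨_, _, _, _, _, _, _, _, _, h6, _⟩ |
          ⟨_, _, _, _, _, _, _, _, _, _, h6, _⟩
        · exact hred ⟨_, _, _, _, h4⟩
        · cases h6
        · cases h6
      refine R_fn.2 ⟨Ap.pcase hε hx hy hz (h.ap hε hx hy hz) hs, ?_⟩
      intro r0 Δ δ h1 h2 h3 σ' τ' h4 P hP hX
      have h5 := h4.arrow_inv
      have hP' : HT Δ P r1 := .equiv hP h5.1.symm'
      have hT' : HT Δ (.app (ren r0 (pcT s t (.arrow r1 r2) x y z)) P) τ' :=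
        .app (.equiv (hT.ren' h2) h4) hP
      refine R.expand hT' (Root.steps (.pcaseArrow ..)) (R.equiv ?_ h5.2)
      have hX' : ∀ x ∈ X, R Δ δ r1 x P := fun x hx => (hX x hx).equiv h5.1.symm'
      refine IH q (.inr (.inr ⟨X, rfl⟩)) h1 (hx.ren' h2) (.app (hy.ren' h2) hP')
        (.app (hz.ren' h2) hP') ?_
      exact h.map (fun b hb => hb.ren' h2 h3)
        (fun hb => R.app h1 (hb.ren' h2 h3) hP' hX') (fun hb => R.app h1 (hb.ren' h2 h3) hP' hX')
    by_cases hs : RootStable (.app (.app (.const (.cpcase s t r)) x) y) z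
    · exact Stuck.R hT (stuck_pcase (fun r1 r2 h => harr ⟨r1, r2, h⟩) hs)
        (Ap.pcase hε hx hy hz (h.ap hε hx hy hz) hs)
    · unfold RootStable at hs
      push Not at hs
      obtain ⟨P', z', h1, h2, N, h3⟩ := hs
      obtain ⟨x', y', rfl, h4, h5⟩ := pcase_steps h1
      have hN : Steps (pcT s t r x y z) N := (steps_pcT s t r h4 h5 h2).trans h3.steps
      have hx' := Steps.ht h4 hx
      have hy' := Steps.ht h5 hy
      have hz' := Steps.ht h2 hz
      rcases pcase_redex h3 with ⟨b, s', t', P, rfl⟩ |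
          ⟨b, r0, r1, s1, t1, s2, t2, y2, z2, rfl, rfl, rfl, rfl⟩ |
          ⟨r0, r1, s1, t1, s2, t2, y1, y2, z1, z2, rfl, rfl, rfl, rfl⟩
      · exact absurd ⟨_, _, _, _, h4⟩ hred
      · have hyt := injT_ht hy'
        have hzt := injT_ht hz'
        have e1 := TyEquiv.ite (b := b) hyt.2.sum_inv.1 hyt.2.sum_inv.2
        have e2 := TyEquiv.ite (b := b) hzt.2.sum_inv.1 hzt.2.sum_inv.2
        obtain ⟨c, rfl | ⟨q, _, rfl⟩⟩ := mem_sum hcar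
        · have hc : c = b := by
            rcases h.or with h | h
            · exact R.tag_inv hy h h5
            · exact R.tag_inv hz h h2
          subst hc
          exact R_stag.2 (.inl ⟨_, _, _, hN⟩)
        · have hc : c = b := by
            rcases h.or with h | h
            · exact (R.inj_inv hy h h5).1
            · exact (R.inj_inv hz h h2).1
          subst hc
          refine R_spr.2 (.inl ⟨_, _, _, hN, ?_⟩)
          refine IH q (.inl ⟨_, rfl⟩) hε hx' (.equiv hyt.1 e1) (.equiv hzt.1 e2) ?_
          exact h.map (fun b hb => hb.red hx h4) (fun hb => (R.inj_inv hy hb h5).2.equiv e1)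
            (fun hb => (R.inj_inv hz hb h2).2.equiv e2)
      · obtain ⟨b, q, _, rfl⟩ := mem_prod hcar
        have hyt := pairT_ht hy' b
        have hzt := pairT_ht hz' b
        have e1 := TyEquiv.ite (b := b) hyt.2.prod_inv.1 hyt.2.prod_inv.2
        have e2 := TyEquiv.ite (b := b) hzt.2.prod_inv.1 hzt.2.prod_inv.2
        refine R_ppr.2 (.inl ⟨_, _, _, _, hN, ?_⟩)
        have h6 := IH q (.inr (.inl ⟨_, rfl⟩)) hε hx' (.equiv hyt.1 e1) (.equiv hzt.1 e2)
          (h.map (fun b hb => hb.red hx h4) (fun hb => (R.pair_inv hy hb h5).equiv e1)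
            (fun hb => (R.pair_inv hz hb h2).equiv e2))
        cases b <;> exact h6
  induction a using Pm.ind with
  | h1 b =>
    refine @main _ ?_
    rintro Γ ε s t r x y z q (⟨_, h⟩ | ⟨_, h⟩ | ⟨_, h⟩) <;> cases h
  | h2 b a ih =>
    refine @main _ ?_
    rintro Γ ε s t r x y z q (⟨_, h⟩ | ⟨_, h⟩ | ⟨_, h⟩) <;> cases h
    exact @ih _ _ _ _ _ _ _ _
  | h3 b a ih =>
    refine @main _ ?_
    rintro Γ ε s t r x y z q (⟨_, h⟩ | ⟨_, h⟩ | ⟨_, h⟩) <;> cases h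
    exact @ih _ _ _ _ _ _ _ _
  | h4 X a ihX ih =>
    refine @main _ ?_
    rintro Γ ε s t r x y z q (⟨_, h⟩ | ⟨_, h⟩ | ⟨_, h⟩) <;> cases h
    exact @ih _ _ _ _ _ _ _ _

/-! Introduction rules for constants of one, two, three arguments. -/

theorem R_intro {Γ : List TyExpr} {ε : Env} {σ τ : TyExpr} {X : List Pm} {b : Pm} {M : Tm}
    (h : Ap ε (.fn X b) M)
    (H : ∀ (r : ℕ → ℕ) (Δ : List TyExpr) (δ : Env), GoodEnv Δ δ →
      (∀ n τ, Γ[n]? = some τ → Δ[r n]? = some τ) → (∀ n, δ (r n) = ε n) →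
      ∀ P, HT Δ P σ → (∀ x ∈ X, R Δ δ σ x P) → R Δ δ τ b (.app (ren r M) P)) :
    R Γ ε (.arrow σ τ) (.fn X b) M := by
  refine R_fn.2 ⟨h, fun r Δ δ h1 h2 h3 σ' τ' h4 P hP hX => ?_⟩
  have h5 := h4.arrow_inv
  exact (H r Δ δ h1 h2 h3 P (.equiv hP h5.1.symm') fun x hx => (hX x hx).equiv h5.1.symm').equiv h5.2

theorem ap_const {ε : Env} {c : Const} {a : Pm} (h : a ∈ constSem c) : Ap ε a (.const c) :=
  ⟨_, .refl, h⟩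

theorem R_const1 {Γ : List TyExpr} {ε : Env} {σ τ : TyExpr} {X : List Pm} {b : Pm} {c : Const}
    (h : .fn X b ∈ constSem c)
    (H : ∀ (Δ : List TyExpr) (δ : Env), GoodEnv Δ δ →
      ∀ P, HT Δ P σ → (∀ x ∈ X, R Δ δ σ x P) → R Δ δ τ b (.app (.const c) P)) :
    R Γ ε (.arrow σ τ) (.fn X b) (.const c) :=
  R_intro (ap_const h) fun r Δ δ h1 h2 h3 P hP hX => H Δ δ h1 P hP hX

theorem R_const2 {Γ : List TyExpr} {ε : Env} {σ σ' τ : TyExpr} {X Y : List Pm} {b : Pm} {c : Const}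
    (h : .fn X (.fn Y b) ∈ constSem c) (h1 : ∀ s t, c ≠ .cfst s t) (h2 : ∀ s t, c ≠ .csnd s t)
    (H : ∀ (Δ : List TyExpr) (δ : Env), GoodEnv Δ δ →
      ∀ P, HT Δ P σ → (∀ x ∈ X, R Δ δ σ x P) → ∀ Q, HT Δ Q σ' → (∀ x ∈ Y, R Δ δ σ' x Q) →
      R Δ δ τ b (.app (.app (.const c) P) Q)) :
    R Γ ε (.arrow σ (.arrow σ' τ)) (.fn X (.fn Y b)) (.const c) := by
  refine R_const1 h fun Δ δ h3 P hP hX => ?_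
  refine R_intro (Ap.app hP (ap_const h) (fun x hx => (hX x hx).ap hP h3) (rs_const P h1 h2)) ?_
  intro r Δ' δ' h4 h5 h6 Q hQ hY
  exact H Δ' δ' h4 (ren r P) (hP.ren' h5) (fun x hx => (hX x hx).ren' h5 h6) Q hQ hY

theorem R_const3 {Γ : List TyExpr} {ε : Env} {σ σ' σ'' τ : TyExpr} {X Y Z : List Pm} {b : Pm}
    {c : Const}
    (h : .fn X (.fn Y (.fn Z b)) ∈ constSem c) (h1 : ∀ s t, c ≠ .cfst s t) (h2 : ∀ s t, c ≠ .csnd s t)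
    (H : ∀ (Δ : List TyExpr) (δ : Env), GoodEnv Δ δ →
      ∀ P, HT Δ P σ → (∀ x ∈ X, R Δ δ σ x P) → ∀ Q, HT Δ Q σ' → (∀ x ∈ Y, R Δ δ σ' x Q) →
      ∀ K, HT Δ K σ'' → (∀ x ∈ Z, R Δ δ σ'' x K) →
      R Δ δ τ b (.app (.app (.app (.const c) P) Q) K)) :
    R Γ ε (.arrow σ (.arrow σ' (.arrow σ'' τ))) (.fn X (.fn Y (.fn Z b))) (.const c) := by
  refine R_const2 h h1 h2 fun Δ δ h3 P hP hX Q hQ hY => ?_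
  refine R_intro (Ap.app hQ (Ap.app hP (ap_const h) (fun x hx => (hX x hx).ap hP h3)
    (rs_const P h1 h2)) (fun x hx => (hY x hx).ap hQ h3) (rs_const2 P Q h1 h2)) ?_
  intro r Δ' δ' h4 h5 h6 K hK hZ
  exact H Δ' δ' h4 (ren r P) (hP.ren' h5) (fun x hx => (hX x hx).ren' h5 h6)
    (ren r Q) (hQ.ren' h5) (fun x hx => (hY x hx).ren' h5 h6) K hK hZ

theorem prOf_inv {A : PData} {f : Set Pm → Set Pm} {a : Pm} (h : a ∈ PrOf A f) :
    ∃ X b, a = .fn X b ∧ b ∈ f (downListP A X) := by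
  obtain ⟨X, b, h1, _, h2⟩ := h; exact ⟨X, b, h1, h2⟩

theorem R.case {Γ : List TyExpr} {ε : Env} {s t r : TyExpr} {x y z : Tm} {d : Set Pm} {q : Pm}
    (b : Bool) (hε : GoodEnv Γ ε)
    (hx : HT Γ x (.sum s t)) (hy : HT Γ y (.arrow s r)) (hz : HT Γ z (.arrow t r))
    (hd : ∀ p ∈ d, R Γ ε (.sum s t) p x) (h0 : Pm.stag b ∈ d) {W : List Pm}
    (hW : ∀ w ∈ W, Pm.spr b w ∈ d)
    (hf : R Γ ε (.arrow (if b then t else s) r) (.fn W q) (if b then z else y))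
    (hA : ∀ x', Steps x x' → Stuck x' →
      Ap ε q (.app (.app (.app (.const (.ccase s t r)) x') y) z)) :
    R Γ ε r q (.app (.app (.app (.const (.ccase s t r)) x) y) z) := by
  have hT : HT Γ (.app (.app (.app (.const (.ccase s t r)) x) y) z) r :=
    .app (.app (.app (.const (.ccase s t r)) hx) hy) hz
  rcases R_stag.1 (hd _ h0) with ⟨s', t', P, h1⟩ | ⟨x', h1, h2, _⟩
  · have hP := injT_ht (Steps.ht h1 hx)
    have e := TyEquiv.ite (b := b) hP.2.sum_inv.1 hP.2.sum_inv.2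
    have hP' := HT.equiv hP.1 e
    have hw : ∀ w ∈ W, R Γ ε (if b then t else s) w P := fun w hw =>
      (R.inj_inv hx (hd _ (hW w hw)) h1).2.equiv e
    have h3 := R.app hε hf hP' hw
    refine R.expand hT ?_ h3
    refine (steps_app (steps_app (steps_app .refl h1) .refl) .refl).trans ?_
    cases b
    · exact Root.steps (.caseZero ..)
    · exact Root.steps (.caseOne ..)
  · have h3 := steps_app (steps_app (steps_app (.refl : Steps (.const (.ccase s t r)) _) h1)
      (.refl : Steps y y)) (.refl : Steps z z)
    exact R.expand hT h3 (Stuck.R (Steps.ht h3 hT) (stuck_case h2) (hA x' h1 h2))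

theorem R.const {Γ : List TyExpr} {ε : Env} (c : Const) {a : Pm} (ha : a ∈ constSem c) :
    R Γ ε (constType c) a (.const c) := by
  cases c with
  | czero σ τ =>
    have ha' := ha
    obtain ⟨X, b, rfl, hb⟩ := prOf_inv ha'
    refine R_const1 ha fun Δ δ hδ P hP hX => ?_
    rcases hb with rfl | ⟨q, hq, rfl⟩
    · exact R_stag.2 (.inl ⟨σ, τ, P, .refl⟩)
    · exact R_spr.2 (.inl ⟨σ, τ, P, .refl, R.dn hP hδ hX hq⟩)
  | cone σ τ =>
    have ha' := ha
    obtain ⟨X, b, rfl, hb⟩ := prOf_inv ha'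
    refine R_const1 ha fun Δ δ hδ P hP hX => ?_
    rcases hb with rfl | ⟨q, hq, rfl⟩
    · exact R_stag.2 (.inl ⟨σ, τ, P, .refl⟩)
    · exact R_spr.2 (.inl ⟨σ, τ, P, .refl, R.dn hP hδ hX hq⟩)
  | cpair σ τ =>
    have ha' := ha
    unfold constSem at ha'
    obtain ⟨X, b1, rfl, hb1⟩ := prOf_inv ha'
    obtain ⟨Y, b, rfl, hb⟩ := prOf_inv hb1
    refine R_const2 ha (by simp) (by simp) fun Δ δ hδ P hP hX Q hQ hY => ?_
    rcases hb with ⟨q, hq, rfl⟩ | ⟨q, hq, rfl⟩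
    · exact R_ppr.2 (.inl ⟨σ, τ, P, Q, .refl, R.dn hP hδ hX hq⟩)
    · exact R_ppr.2 (.inl ⟨σ, τ, P, Q, .refl, R.dn hQ hδ hY hq⟩)
  | cfst σ τ =>
    have ha' := ha
    obtain ⟨X, b, rfl, hb⟩ := prOf_inv ha'
    refine R_const1 ha fun Δ δ hδ P hP hX => ?_
    have hT : HT Δ (.app (.const (.cfst σ τ)) P) σ := .app (.const (.cfst σ τ)) hP
    rcases R_ppr.1 (R.dn hP hδ hX hb) with ⟨s', t', A, B, h1, h2⟩ | ⟨P', h1, h2, _⟩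
    · have e := (pairT_ht (Steps.ht h1 hP) false).2.prod_inv
      exact R.expand hT ((steps_app .refl h1).trans (Root.steps (.fstPair ..))) (R.equiv h2 e.1)
    · have hP' := Steps.ht h1 hP
      have h3 := steps_app (.refl : Steps (.const (.cfst σ τ)) _) h1
      exact R.expand hT h3 (Stuck.R (Steps.ht h3 hT) (stuck_fst h2) (Ap.app hP' (ap_const ha)
        (fun x hx => ((hX x hx).red hP h1).ap hP' hδ) (rs_fst h2)))
  | csnd σ τ =>
    have ha' := ha
    obtain ⟨X, b, rfl, hb⟩ := prOf_inv ha'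
    refine R_const1 ha fun Δ δ hδ P hP hX => ?_
    have hT : HT Δ (.app (.const (.csnd σ τ)) P) τ := .app (.const (.csnd σ τ)) hP
    rcases R_ppr.1 (R.dn hP hδ hX hb) with ⟨s', t', A, B, h1, h2⟩ | ⟨P', h1, h2, _⟩
    · have e := (pairT_ht (Steps.ht h1 hP) true).2.prod_inv
      exact R.expand hT ((steps_app .refl h1).trans (Root.steps (.sndPair ..))) (R.equiv h2 e.2)
    · have hP' := Steps.ht h1 hP
      have h3 := steps_app (.refl : Steps (.const (.csnd σ τ)) _) h1
      exact R.expand hT h3 (Stuck.R (Steps.ht h3 hT) (stuck_snd h2) (Ap.app hP' (ap_const ha)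
        (fun x hx => ((hX x hx).red hP h1).ap hP' hδ) (rs_snd h2)))
  | ccase σ τ ρ =>
    have ha' := ha
    unfold constSem at ha'
    obtain ⟨X, b1, rfl, hb1⟩ := prOf_inv ha'
    obtain ⟨Y, b2, rfl, hb2⟩ := prOf_inv hb1
    obtain ⟨Z, b, rfl, hb⟩ := prOf_inv hb2
    refine R_const3 ha (by simp) (by simp) fun Δ δ hδ x hx hX y hy hY z hz hZ => ?_
    have hA : ∀ x', Steps x x' → Stuck x' →
        Ap δ b (.app (.app (.app (.const (.ccase σ τ ρ)) x') y) z) := by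
      intro x' h1 h2
      have hx' := Steps.ht h1 hx
      exact Ap.app hz (Ap.app hy (Ap.app hx' (ap_const ha)
        (fun x0 h0 => ((hX x0 h0).red hx h1).ap hx' hδ) (rs_const x' (by simp) (by simp)))
        (fun x0 h0 => (hY x0 h0).ap hy hδ) (rs_const2 x' y (by simp) (by simp)))
        (fun x0 h0 => (hZ x0 h0).ap hz hδ) (rs_case h2)
    rcases hb with ⟨h0, W, hW, hf⟩ | ⟨h0, W, hW, hf⟩
    · exact R.case false hδ hx hy hz (fun p hp => R.dn hx hδ hX hp) h0 hW (R.dn hy hδ hY hf) hA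
    · exact R.case true hδ hx hy hz (fun p hp => R.dn hx hδ hX hp) h0 hW (R.dn hz hδ hZ hf) hA
  | cpcase σ τ ρ =>
    have ha' := ha
    unfold constSem at ha'
    obtain ⟨X, b1, rfl, hb1⟩ := prOf_inv ha'
    obtain ⟨Y, b2, rfl, hb2⟩ := prOf_inv hb1
    obtain ⟨Z, b, rfl, hb⟩ := prOf_inv hb2
    refine R_const3 ha (by simp) (by simp) fun Δ δ hδ x hx hX y hy hY z hz hZ => ?_
    refine R.pcase b hδ hx hy hz ?_
    rcases mem_pcaseS.1 hb with ⟨h1, h2⟩ | ⟨h1, h2⟩ | ⟨h1, h2⟩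
    · exact .inl ⟨R.dn hy hδ hY h1, R.dn hz hδ hZ h2⟩
    · exact .inr (.inl ⟨R.dn hx hδ hX h1, R.dn hy hδ hY h2⟩)
    · exact .inr (.inr ⟨R.dn hx hδ hX h1, R.dn hz hδ hZ h2⟩)
  | comega σ => exact absurd ha (by simp [constSem])

theorem adequacy {Γ : List TyExpr} {M : Tm} {σ : TyExpr} (h : HT Γ M σ) :
    ∀ {ε : Env} {Δ : List TyExpr} {δ : Env} {s : ℕ → Tm}, GoodEnv Δ δ →
    (∀ n τ, Γ[n]? = some τ → HT Δ (s n) τ) →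
    (∀ n τ, Γ[n]? = some τ → ∀ a ∈ ε n, R Δ δ τ a (s n)) →
    ∀ a ∈ sem M ε, R Δ δ σ a (sub s M) := by
  induction h with
  | var h => intro ε Δ δ s hδ hs hR a ha; exact hR _ _ h a ha
  | const c => intro ε Δ δ s hδ hs hR a ha; exact R.const c ha
  | om τ σ => intro ε Δ δ s hδ hs hR a ha; exact absurd ha (by simp [sem, constSem])
  | app h1 h2 ih1 ih2 =>
    rintro ε Δ δ s hδ hs hR a ⟨X, hX, ha⟩
    exact R.app hδ (ih1 hδ hs hR _ ha) (h2.sub' hs) fun x hx => ih2 hδ hs hR x (hX x hx)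
  | equiv h1 h2 ih => intro ε Δ δ s hδ hs hR a ha; exact (ih hδ hs hR a ha).equiv h2
  | @lam Γ M σ τ h1 ih =>
    rintro ε Δ δ s hδ hs hR a ⟨X, p, rfl, hX, hp⟩
    refine R_intro ?_ ?_
    · have hδ' : GoodEnv (σ :: Δ) (envCons (dn σ X) δ) := hδ.cons (El_GoodL hX)
      have hsh : ∀ n τ, Δ[n]? = some τ → (σ :: Δ)[Nat.succ n]? = some τ := fun n τ h => by simpa using h
      have hs' : ∀ n τ, (σ :: Γ)[n]? = some τ → HT (σ :: Δ) (ups s n) τ := by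
        intro n τ hn
        cases n with
        | zero => exact .var (by simpa using hn)
        | succ n => exact (hs n τ (by simpa using hn)).ren' hsh
      have hR' : ∀ n τ, (σ :: Γ)[n]? = some τ → ∀ a ∈ envCons (dn σ X) ε n,
          R (σ :: Δ) (envCons (dn σ X) δ) τ a (ups s n) := by
        intro n τ hn a ha
        cases n with
        | zero => exact Stuck.R (hs' 0 τ hn) (stuck_var 0) ⟨_, .refl, ha⟩
        | succ n => exact (hR n τ (by simpa using hn) a ha).ren' hsh fun _ => rfl
      obtain ⟨N, h2, h3⟩ := (ih hδ' hs' hR' p hp).ap (h1.sub' hs') hδ'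
      exact ⟨.lam σ N, steps_lam σ h2, ⟨X, p, rfl, hX, h3⟩⟩
    · intro r Δ' δ' hδ' hr hr' P hP hPX
      have hs' : ∀ n τ, (σ :: Γ)[n]? = some τ → HT Δ' (consS P (fun n => ren r (s n)) n) τ := by
        intro n τ hn
        cases n with
        | zero => cases (by simpa using hn : σ = τ); exact hP
        | succ n => exact (hs n τ (by simpa using hn)).ren' hr
      have hR' : ∀ n τ, (σ :: Γ)[n]? = some τ → ∀ a ∈ envCons (dn σ X) ε n,
          R Δ' δ' τ a (consS P (fun n => ren r (s n)) n) := by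
        intro n τ hn a ha
        cases n with
        | zero => cases (by simpa using hn : σ = τ); exact R.dn hP hδ' hPX ha
        | succ n => exact (hR n τ (by simpa using hn) a ha).ren' hr hr'
      have h2 := ih hδ' hs' hR' p hp
      refine R.expand (.app (HT.ren' (HT.sub' (.lam h1) hs) hr) hP) ?_ h2
      rw [← substTm_ren_sub]
      exact Root.steps (.beta ..)

theorem sem_approx {Γ : List TyExpr} {M : Tm} {σ : TyExpr} (h : HT Γ M σ) {ε : Env}
    (hε : GoodEnv Γ ε) {a : Pm} (ha : a ∈ sem M ε) : Ap ε a M := by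
  have := adequacy h (s := .var) hε (fun n τ hn => .var hn)
    (fun n τ hn a ha => Stuck.R (.var hn) (stuck_var n) ⟨_, .refl, ha⟩) a ha
  rw [sub_var] at this
  exact this.ap h hε

theorem approx_main (Γ : List TyExpr) (M : Tm) (σ : TyExpr)
    (hM : HasType Γ M σ) (ε : Env) (hε : GoodEnv Γ ε) :
    sem M ε = (⋃ A ∈ approxSet M, sem A ε) ∧
    sem M ε = ⋃ A ∈ {A : Tm | Normal A ∧ ∃ N, Steps M N ∧ TmPre A N}, sem A ε := by
  have h1 : sem M ε ⊆ ⋃ A ∈ approxSet M, sem A ε := by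
    intro a ha
    obtain ⟨N, h2, h3⟩ := sem_approx hM.ht hε ha
    exact Set.mem_iUnion₂.2 ⟨dir N, ⟨N, h2, dir_approx N⟩, h3⟩
  have h2 : (⋃ A ∈ approxSet M, sem A ε) ⊆
      ⋃ A ∈ {A : Tm | Normal A ∧ ∃ N, Steps M N ∧ TmPre A N}, sem A ε := by
    intro a ha
    obtain ⟨A, ⟨N, h3, h4⟩, h5⟩ := Set.mem_iUnion₂.1 ha
    exact Set.mem_iUnion₂.2 ⟨A, ⟨h4.1, N, h3, h4.2 N .refl⟩, h5⟩
  have h3 : (⋃ A ∈ {A : Tm | Normal A ∧ ∃ N, Steps M N ∧ TmPre A N}, sem A ε) ⊆ sem M ε := by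
    intro a ha
    obtain ⟨A, ⟨_, N, h4, h5⟩, h6⟩ := Set.mem_iUnion₂.1 ha
    rw [Steps.sound h4 hM.ht hε]
    exact h5.sem ε h6
  exact ⟨h1.antisymm (h2.trans h3), (h1.trans h2).antisymm h3⟩

end RecLam

namespace RecLam

/-- **Approximation Theorem.**  For every typed term `M` and
every (typed) environment `ε`, the semantics of `M` equals the union of the
semantics of its normal form approximations:
`⟦M⟧ε = ⋃_{A ∈ 𝒜(M)} ⟦A⟧ε`; equivalently,
`⟦M⟧ε = ⋃ { ⟦A⟧ε ∣ A a normal form and ∃N. M →* N and A ≼ N }`. -/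
theorem approximation_theorem (Γ : List TyExpr) (M : Tm) (σ : TyExpr)
    (hM : HasType Γ M σ) (ε : Env) (hε : GoodEnv Γ ε) :
    sem M ε = (⋃ A ∈ approxSet M, sem A ε) ∧
    sem M ε = ⋃ A ∈ {A : Tm | Normal A ∧ ∃ N, Steps M N ∧ TmPre A N}, sem A ε := by
  exact approx_main Γ M σ hM ε hε

end RecLam
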